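/- There exists an absolute constant δ with 0 < δ < 1/12 such that for every prime p and every integer u with gcd(u, 4p) = 1, there is z_0(p) with the following property: for all z ≥ z_0(p), the number of primes r with z/2 ≤ r ≤ z, r ≡ u (mod 4p), and P(r−1) ∈ [z^{1/2−2δ}, z^{1/2−δ}] is at least (log((1−2δ)/(1−4δ))/(5·φ(4p)))·π(z). -/

import Mathlib

open scoped Classical

/-- The prime counting function `π(z)`. -/
noncomputable def primePi (x : ℝ) : ℕ :=
  ((Finset.range (⌊x⌋₊ + 1)).filter Nat.Prime).card

/-- `P(n)`, the largest prime factor of `n > 1`, with `P(1) = P(0) = 1`. -/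
def largestPrimeFactor (n : ℕ) : ℕ :=
  if n ≤ 1 then 1 else n.primeFactors.sup id

section PrimesInProgressions

open MeasureTheory Filter Topology Set

/-- The Fejér kernel, up to normalisation. -/
noncomputable def fejer (u : ℝ) : ℝ := (2 - 2 * Real.cos u) / u ^ 2

lemma fejer_nonneg (u : ℝ) : 0 ≤ fejer u :=
  div_nonneg (by linarith [Real.cos_le_one u]) (sq_nonneg u)

lemma measurable_fejer : Measurable fejer := by
  unfold fejer
  fun_prop

lemma fejer_le (u : ℝ) : fejer u ≤ 8 * (1 + u ^ 2)⁻¹ := by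
  unfold fejer
  rcases eq_or_ne u 0 with rfl | hu
  · norm_num
  have hu2 : 0 < u ^ 2 := by positivity
  rw [div_le_iff₀ hu2, ← div_eq_mul_inv]
  have h1 := Real.one_sub_sq_div_two_le_cos (x := u)
  have h2 := Real.neg_one_le_cos u
  rw [div_mul_eq_mul_div, le_div_iff₀ (by positivity)]
  by_cases h : u ^ 2 ≤ 1
  · nlinarith
  · nlinarith

lemma integrable_fejer : Integrable fejer := by
  refine Integrable.mono' (integrable_inv_one_add_sq.const_mul 8)
    measurable_fejer.aestronglyMeasurable (ae_of_all _ fun u => ?_)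
  rw [Real.norm_of_nonneg (fejer_nonneg u)]
  exact fejer_le u

lemma integral_fejer_pos : 0 < ∫ u, fejer u := by
  rw [integral_pos_iff_support_of_nonneg fejer_nonneg integrable_fejer]
  have : Ioo (0 : ℝ) 1 ⊆ Function.support fejer := by
    intro u hu
    have h1 : Real.cos u < 1 := by
      have := Real.cos_lt_cos_of_nonneg_of_le_pi (le_refl 0) (by linarith [Real.pi_gt_three, hu.2] : u ≤ Real.pi) hu.1
      simpa using this
    have : 0 < fejer u := div_pos (by linarith) (by have := hu.1; positivity)
    exact this.ne'
  refine lt_of_lt_of_le ?_ (measure_mono this)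
  simp

open Complex in
lemma integral_triangle_mul_exp {lam u : ℝ} (hl : 0 < lam) (hu : u ≠ 0) :
    ∫ ξ in (-lam)..lam, ((1 - |ξ| / lam : ℝ) : ℂ) * cexp (I * (u * ξ)) =
      ((lam * fejer (lam * u) : ℝ) : ℂ) := by
  have huC : (u : ℂ) ≠ 0 := by exact_mod_cast hu
  have hlC : (lam : ℂ) ≠ 0 := by exact_mod_cast hl.ne'
  have key : ∀ s : ℝ, ∀ ξ : ℝ, HasDerivAt (fun ξ : ℝ => ((1 - s * ξ / lam : ℂ)) * cexp (I * (u * ξ)) / (I * u)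
      - (s / lam) * cexp (I * (u * ξ)) / u ^ 2)
      ((1 - s * ξ / lam : ℂ) * cexp (I * (u * ξ))) ξ := by
    intro s ξ
    have h0 : HasDerivAt (fun ξ : ℝ => (ξ : ℂ)) 1 ξ := ofRealCLM.hasDerivAt
    have h1 : HasDerivAt (fun ξ : ℝ => cexp (I * (u * ξ))) (cexp (I * (u * ξ)) * (I * (u * 1))) ξ :=
      ((h0.const_mul (u : ℂ)).const_mul I).cexp
    have h2 : HasDerivAt (fun ξ : ℝ => (1 - s * ξ / lam : ℂ)) (-(s * 1 / lam)) ξ :=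
      ((h0.const_mul (s : ℂ)).div_const (lam : ℂ)).const_sub 1
    have h3 := ((h2.mul h1).div_const (I * u)).sub ((h1.const_mul (s / lam : ℂ)).div_const ((u : ℂ) ^ 2))
    refine h3.congr_deriv ?_
    have hI : (I : ℂ) ≠ 0 := I_ne_zero
    field_simp
    ring_nf
    rw [I_sq]
    ring
  have h_int : ∀ a b : ℝ, IntervalIntegrable
      (fun ξ : ℝ => ((1 - |ξ| / lam : ℝ) : ℂ) * cexp (I * (u * ξ))) volume a b := by
    intro a b
    apply Continuous.intervalIntegrable
    fun_prop
  rw [← intervalIntegral.integral_add_adjacent_intervals (h_int (-lam) 0) (h_int 0 lam)]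
  have e1 : ∫ ξ in (-lam)..0, ((1 - |ξ| / lam : ℝ) : ℂ) * cexp (I * (u * ξ)) =
      ∫ ξ in (-lam)..0, (1 - ((-1 : ℝ) : ℂ) * ξ / lam : ℂ) * cexp (I * (u * ξ)) := by
    apply intervalIntegral.integral_congr
    intro ξ hξ
    rw [uIcc_of_le (by linarith)] at hξ
    simp only [abs_of_nonpos hξ.2]
    push_cast
    ring
  have e2 : ∫ ξ in (0)..lam, ((1 - |ξ| / lam : ℝ) : ℂ) * cexp (I * (u * ξ)) =
      ∫ ξ in (0)..lam, (1 - ((1 : ℝ) : ℂ) * ξ / lam : ℂ) * cexp (I * (u * ξ)) := by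
    apply intervalIntegral.integral_congr
    intro ξ hξ
    rw [uIcc_of_le (by linarith)] at hξ
    simp only [abs_of_nonneg hξ.1]
    push_cast
    ring
  rw [e1, e2, intervalIntegral.integral_eq_sub_of_hasDerivAt (fun ξ _ => key (-1) ξ)
    (Continuous.intervalIntegrable (by fun_prop) _ _),
    intervalIntegral.integral_eq_sub_of_hasDerivAt (fun ξ _ => key 1 ξ)
    (Continuous.intervalIntegrable (by fun_prop) _ _)]
  unfold fejer
  push_cast
  have hc : 2 * Complex.cos (lam * u) = cexp (I * (u * lam)) + cexp (I * (u * -lam)) := by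
    rw [Complex.two_cos]
    congr 2 <;> ring
  rw [hc]
  simp only [mul_zero, Complex.exp_zero]
  field_simp
  ring_nf

section
open Complex

variable {D : ℝ → ℝ} {C : ℝ} {H : ℂ → ℂ} {lam : ℝ}

lemma integral_mul_exp_mul_fejer (hD : Measurable D) (hC : ∀ u, |D u| ≤ C)
    (hH : ∀ s : ℂ, 1 < s.re → ∫ u in Ioi (0:ℝ), (D u : ℂ) * cexp (-(s - 1) * u) = H s)
    (hl : 0 < lam) {ε : ℝ} (hε : 0 < ε) (v : ℝ) :
    ((∫ u in Ioi (0:ℝ), D u * Real.exp (-ε * u) * (lam * fejer (lam * (v - u))) : ℝ) : ℂ) =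
      ∫ ξ in (-lam)..lam, cexp (I * (v * ξ)) * (((1 - |ξ| / lam : ℝ) : ℂ) * H (1 + ε + I * ξ)) := by
  have hDe : IntegrableOn (fun u => D u * Real.exp (-ε * u)) (Ioi 0) := by
    refine Integrable.mono' ((exp_neg_integrableOn_Ioi 0 hε).const_mul C)
      (by fun_prop) (ae_of_all _ fun u => ?_)
    rw [norm_mul, Real.norm_eq_abs, Real.norm_of_nonneg (Real.exp_pos _).le]
    exact mul_le_mul_of_nonneg_right (hC u) (Real.exp_pos _).le
  have h1 : ((∫ u in Ioi (0:ℝ), D u * Real.exp (-ε * u) * (lam * fejer (lam * (v - u))) : ℝ) : ℂ) =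
      ∫ u in Ioi (0:ℝ), ∫ ξ in (-lam)..lam, (D u * Real.exp (-ε * u) : ℝ) *
        (((1 - |ξ| / lam : ℝ) : ℂ) * cexp (I * ((v - u : ℝ) * ξ))) := by
    rw [← integral_complex_ofReal]
    apply integral_congr_ae
    have : ∀ᵐ u ∂(volume.restrict (Ioi (0:ℝ))), u ≠ v := by
      apply ae_restrict_of_ae
      simp [ae_iff, measure_singleton]
    filter_upwards [this] with u hu
    rw [intervalIntegral.integral_const_mul, integral_triangle_mul_exp hl (sub_ne_zero.mpr hu.symm)]
    push_cast
    ring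
  rw [h1]
  simp_rw [intervalIntegral.integral_of_le (show -lam ≤ lam by linarith)]
  rw [MeasureTheory.integral_integral_swap]
  · apply integral_congr_ae
    refine ae_of_all _ fun ξ => ?_
    simp only
    rw [← hH (1 + ε + I * ξ) (by simp [hε]), ← integral_const_mul, ← integral_const_mul]
    apply integral_congr_ae
    refine ae_of_all _ fun u => ?_
    simp only
    push_cast
    have e : cexp (I * ((v - u) * ξ)) * cexp (-ε * u)= cexp (I * (v * ξ)) * cexp (-(1 + ε + I * ξ - 1) * u) := by
      rw [← Complex.exp_add, ← Complex.exp_add]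
      congr 1
      ring
    linear_combination (D u : ℂ) * (1 - |ξ| / lam : ℂ) * e
  · have hb : Integrable (fun p : ℝ × ℝ => (D p.1 * Real.exp (-ε * p.1)) * (1 : ℝ))
        ((volume.restrict (Ioi 0)).prod (volume.restrict (Ioc (-lam) lam))) := by
      exact Integrable.mul_prod (f := fun u => D u * Real.exp (-ε * u)) (g := fun _ => (1 : ℝ)) hDe
        (integrable_const _)
    refine Integrable.mono (hb.mul_const 2) ?_ ?_
    · apply Measurable.aestronglyMeasurable
      unfold Function.uncurry
      fun_prop
    · have hm : ∀ᵐ p : ℝ × ℝ ∂((volume.restrict (Ioi 0)).prod (volume.restrict (Ioc (-lam) lam))),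
          p.2 ∈ Ioc (-lam) lam := by
        apply Measure.quasiMeasurePreserving_snd.ae
        exact ae_restrict_mem measurableSet_Ioc
      filter_upwards [hm] with p hp
      simp only [Function.uncurry]
      rw [norm_mul, norm_mul, Complex.norm_exp, Complex.norm_real, mul_one, norm_mul _ (2 : ℝ)]
      refine mul_le_mul_of_nonneg_left ?_ (norm_nonneg _)
      simp only [mul_re, I_re, zero_mul, I_im, mul_im, ofReal_re, ofReal_im, mul_zero,
        add_zero, sub_zero, Real.exp_zero, mul_one, Complex.norm_real, Real.norm_eq_abs]
      have hp' : |p.2| ≤ lam := abs_le.mpr ⟨hp.1.le, hp.2⟩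
      have : |p.2| / lam ≤ 1 := by rw [div_le_one hl]; exact hp'
      have h0 : 0 ≤ |p.2| / lam := by positivity
      rw [abs_of_nonneg (by linarith)]
      norm_num
      linarith

lemma integral_mul_fejer (hD : Measurable D) (hC : ∀ u, |D u| ≤ C)
    (hcont : ContinuousOn H {s | 1 ≤ s.re})
    (hH : ∀ s : ℂ, 1 < s.re → ∫ u in Ioi (0:ℝ), (D u : ℂ) * cexp (-(s - 1) * u) = H s)
    (hl : 0 < lam) (v : ℝ) :
    ((∫ u in Ioi (0:ℝ), D u * (lam * fejer (lam * (v - u))) : ℝ) : ℂ) =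
      ∫ ξ in (-lam)..lam, cexp (I * (v * ξ)) * (((1 - |ξ| / lam : ℝ) : ℂ) * H (1 + I * ξ)) := by
  have hK : Integrable (fun u => lam * fejer (lam * (v - u))) :=
    ((integrable_fejer.comp_mul_left' hl.ne').comp_sub_left v).const_mul lam
  have hC0 : 0 ≤ C := (abs_nonneg _).trans (hC 0)
  have t1 : Tendsto (fun ε : ℝ => ((∫ u in Ioi (0:ℝ), D u * Real.exp (-ε * u) * (lam * fejer (lam * (v - u))) : ℝ) : ℂ))
      (𝓝[>] 0) (𝓝 ((∫ u in Ioi (0:ℝ), D u * (lam * fejer (lam * (v - u))) : ℝ) : ℂ)) := by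
    refine (continuous_ofReal.tendsto _).comp ?_
    refine tendsto_integral_filter_of_dominated_convergence
      (fun u => C * (lam * fejer (lam * (v - u)))) ?_ ?_ (hK.integrableOn.const_mul C) ?_
    · refine Eventually.of_forall fun ε => ?_
      have := measurable_fejer
      fun_prop
    · filter_upwards [self_mem_nhdsWithin] with ε hε
      filter_upwards [ae_restrict_mem measurableSet_Ioi] with u hu
      have hk : 0 ≤ lam * fejer (lam * (v - u)) := mul_nonneg hl.le (fejer_nonneg _)
      rw [norm_mul, norm_mul, Real.norm_of_nonneg hk, Real.norm_of_nonneg (Real.exp_pos _).le, Real.norm_eq_abs]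
      refine mul_le_mul_of_nonneg_right ?_ hk
      have h2 : Real.exp (-ε * u) ≤ 1 := by
        rw [Real.exp_le_one_iff]
        have h3 : (0 : ℝ) < ε := hε
        have h4 : (0 : ℝ) < u := hu
        nlinarith
      calc |D u| * Real.exp (-ε * u) ≤ C * 1 := mul_le_mul (hC u) h2 (Real.exp_pos _).le hC0
        _ = C := mul_one C
    · refine ae_of_all _ fun u => ?_
      have : Tendsto (fun ε : ℝ => D u * Real.exp (-ε * u) * (lam * fejer (lam * (v - u)))) (𝓝 0)
          (𝓝 (D u * Real.exp (-0 * u) * (lam * fejer (lam * (v - u))))) := by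
        apply Continuous.tendsto (f := fun ε : ℝ => D u * Real.exp (-ε * u) * (lam * fejer (lam * (v - u))))
        fun_prop
      simp only [neg_zero, zero_mul, Real.exp_zero, mul_one] at this
      exact this.mono_left nhdsWithin_le_nhds
  have hcomp : IsCompact ((uIcc (0:ℝ) 1) ×ˢ (uIcc (-lam) lam)) := isCompact_uIcc.prod isCompact_uIcc
  have hc2 : ContinuousOn (fun p : ℝ × ℝ => H (1 + p.1 + I * p.2)) ((uIcc (0:ℝ) 1) ×ˢ (uIcc (-lam) lam)) := by
    refine hcont.comp (by fun_prop) ?_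
    rintro ⟨x, y⟩ ⟨hx, hy⟩
    rw [uIcc_of_le zero_le_one] at hx
    simp [hx.1]
  obtain ⟨M, hM⟩ := hcomp.exists_bound_of_continuousOn hc2
  have t2 : Tendsto (fun ε : ℝ => ∫ ξ in (-lam)..lam, cexp (I * (v * ξ)) * (((1 - |ξ| / lam : ℝ) : ℂ) * H (1 + ε + I * ξ)))
      (𝓝[>] 0) (𝓝 (∫ ξ in (-lam)..lam, cexp (I * (v * ξ)) * (((1 - |ξ| / lam : ℝ) : ℂ) * H (1 + I * ξ)))) := by
    have hmem : Ioo (0:ℝ) 1 ∈ 𝓝[>] (0:ℝ) := Ioo_mem_nhdsGT zero_lt_one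
    refine intervalIntegral.tendsto_integral_filter_of_dominated_convergence (fun _ => 2 * M) ?_ ?_ (by simp) ?_
    · filter_upwards [hmem] with ε hε
      apply ContinuousOn.aestronglyMeasurable _ measurableSet_uIoc
      refine ContinuousOn.mul (by fun_prop) (ContinuousOn.mul (by fun_prop) ?_)
      refine hcont.comp (by fun_prop) ?_
      intro y hy
      simp [hε.1.le]
    · filter_upwards [hmem] with ε hε
      refine ae_of_all _ fun ξ hξ => ?_
      have hξ' := uIoc_subset_uIcc hξ
      have h3 := hM (ε, ξ) ⟨by rw [uIcc_of_le zero_le_one]; exact ⟨hε.1.le, hε.2.le⟩, hξ'⟩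
      rw [norm_mul, norm_mul, Complex.norm_exp]
      simp only [mul_re, I_re, zero_mul, I_im, mul_im, ofReal_re, ofReal_im, mul_zero,
        one_mul, add_zero, sub_zero, Real.exp_zero, Complex.norm_real, Real.norm_eq_abs]
      rw [uIcc_of_le (by linarith)] at hξ'
      have hp' : |ξ| ≤ lam := abs_le.mpr ⟨hξ'.1, hξ'.2⟩
      have : |ξ| / lam ≤ 1 := by rw [div_le_one hl]; exact hp'
      have h0 : 0 ≤ |ξ| / lam := by positivity
      refine mul_le_mul ?_ h3 (norm_nonneg _) (by norm_num)
      rw [abs_of_nonneg (by linarith)]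
      linarith
    · refine ae_of_all _ fun ξ hξ => ?_
      refine Tendsto.const_mul _ (Tendsto.const_mul _ ?_)
      have h4 : ContinuousWithinAt H {s | 1 ≤ s.re} (1 + I * ξ) := hcont _ (by simp)
      refine h4.tendsto.comp ?_
      rw [tendsto_nhdsWithin_iff]
      refine ⟨?_, ?_⟩
      · have : Tendsto (fun ε : ℝ => (1 + ε + I * ξ : ℂ)) (𝓝 0) (𝓝 (1 + (0:ℝ) + I * ξ)) := by
          apply Continuous.tendsto (f := fun ε : ℝ => (1 + ε + I * ξ : ℂ))
          fun_prop
        simp only [ofReal_zero, add_zero] at this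
        exact this.mono_left nhdsWithin_le_nhds
      · filter_upwards [hmem] with ε hε
        simp [hε.1.le]
  refine tendsto_nhds_unique t1 (t2.congr' ?_)
  filter_upwards [self_mem_nhdsWithin] with ε hε
  exact (integral_mul_exp_mul_fejer hD hC hH hl hε v).symm

lemma tendsto_integral_mul_fejer (hD : Measurable D) (hC : ∀ u, |D u| ≤ C)
    (hcont : ContinuousOn H {s | 1 ≤ s.re})
    (hH : ∀ s : ℂ, 1 < s.re → ∫ u in Ioi (0:ℝ), (D u : ℂ) * cexp (-(s - 1) * u) = H s)
    (hl : 0 < lam) :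
    Tendsto (fun v => ∫ u in Ioi (0:ℝ), D u * (lam * fejer (lam * (v - u)))) atTop (𝓝 0) := by
  have hR := Real.tendsto_integral_exp_smul_cocompact
    ((Ioc (-lam) lam).indicator (fun ξ : ℝ => (((1 - |ξ| / lam : ℝ) : ℂ) * H (1 + I * ξ))))
  have hT : Tendsto (fun v : ℝ => -v / (2 * Real.pi)) atTop (cocompact ℝ) := by
    rw [cocompact_eq_atBot_atTop]
    refine Tendsto.mono_right ?_ le_sup_left
    exact tendsto_neg_atTop_atBot.atBot_div_const (by positivity)
  have h2 := hR.comp hT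
  have h3 : Tendsto (fun v => ((∫ u in Ioi (0:ℝ), D u * (lam * fejer (lam * (v - u))) : ℝ) : ℂ)) atTop (𝓝 0) := by
    refine h2.congr fun v => ?_
    rw [integral_mul_fejer hD hC hcont hH hl v, intervalIntegral.integral_of_le (by linarith),
      ← integral_indicator measurableSet_Ioc]
    simp only [Function.comp]
    apply integral_congr_ae
    refine ae_of_all _ fun ξ => ?_
    simp only [indicator]
    split_ifs with h
    · rw [Circle.smul_def, Real.fourierChar_apply, smul_eq_mul]
      congr 2
      push_cast
      have : (Real.pi : ℂ) ≠ 0 := by exact_mod_cast Real.pi_ne_zero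
      field_simp
    · simp
  have h5 := (continuous_re.tendsto _).comp h3
  simpa [Function.comp_def] using h5

end

lemma integrable_bounded_mul_fejer {B : ℝ → ℝ} {M : ℝ} (hm : Measurable B)
    (h0 : ∀ u, 0 ≤ B u) (hM : ∀ u, B u ≤ M) (v lam : ℝ) :
    Integrable (fun t => B (v - t / lam) * fejer t) := by
  refine Integrable.mono' (integrable_fejer.const_mul M) ?_ (ae_of_all _ fun t => ?_)
  · have := measurable_fejer
    fun_prop
  · rw [Real.norm_of_nonneg (mul_nonneg (h0 _) (fejer_nonneg _))]
    exact mul_le_mul_of_nonneg_right (hM _) (fejer_nonneg _)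

lemma tendsto_of_tendsto_fejer_mean {B : ℝ → ℝ} {A M : ℝ} (hm : Measurable B)
    (h0 : ∀ u, 0 ≤ B u) (hM : ∀ u, B u ≤ M)
    (hmono : ∀ u s, 0 ≤ s → B u * Real.exp (-s) ≤ B (u + s))
    (hlim : ∀ lam : ℝ, 0 < lam →
      Tendsto (fun v => ∫ t, B (v - t / lam) * fejer t) atTop (𝓝 (A * ∫ t, fejer t))) :
    Tendsto B atTop (𝓝 A) := by
  set c := ∫ t, fejer t with hc
  have hc0 : 0 < c := integral_fejer_pos
  have hM0 : 0 ≤ M := (h0 0).trans (hM 0)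
  -- mass concentrated on a compact interval
  have hmass : Tendsto (fun T : ℝ => ∫ t in Icc (-T) T, fejer t) atTop (𝓝 c) :=
    (aecover_Icc tendsto_neg_atTop_atBot tendsto_id).integral_tendsto_of_countably_generated
      integrable_fejer
  have key : ∀ ε > 0, ∀ η > 0, ∀ᶠ v in atTop,
      B v * (Real.exp (-(2 * ε)) * (c - η)) ≤ A * c + η ∧
      A * c - η ≤ B v * Real.exp (2 * ε) * c + M * η := by
    intro ε hε η hη
    obtain ⟨T, hT1, hT0⟩ := ((hmass.eventually (lt_mem_nhds (show c - η < c by linarith))).and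
      (eventually_gt_atTop (0:ℝ))).exists
    set lam := T / ε with hlam
    have hl : 0 < lam := by positivity
    have ht : ∀ t, t ∈ Icc (-T) T → -ε ≤ t / lam ∧ t / lam ≤ ε := by
      intro t ht
      constructor
      · rw [le_div_iff₀ hl, hlam]; have : -ε * (T / ε) = -T := by field_simp
        linarith [ht.1]
      · rw [div_le_iff₀ hl, hlam]; have : ε * (T / ε) = T := by field_simp
        linarith [ht.2]
    have e1 := (hlim lam hl).comp (tendsto_atTop_add_const_right atTop ε tendsto_id)
    have e2 := (hlim lam hl).comp (tendsto_atTop_add_const_right atTop (-ε) tendsto_id)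
    filter_upwards [e1.eventually (gt_mem_nhds (show A * c < A * c + η by linarith)),
      e2.eventually (lt_mem_nhds (show A * c - η < A * c by linarith))] with v hv1 hv2
    simp only [Function.comp, id] at hv1 hv2
    have hf : Integrable fejer := integrable_fejer
    constructor
    · refine le_trans ?_ hv1.le
      calc B v * (Real.exp (-(2 * ε)) * (c - η))
          ≤ B v * (Real.exp (-(2 * ε)) * ∫ t in Icc (-T) T, fejer t) := by
            gcongr
            exact h0 v
        _ = ∫ t in Icc (-T) T, B v * Real.exp (-(2 * ε)) * fejer t := by
            rw [integral_const_mul, mul_assoc]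
        _ ≤ ∫ t in Icc (-T) T, B (v + ε - t / lam) * fejer t := by
            refine setIntegral_mono_on (hf.integrableOn.const_mul _)
              (integrable_bounded_mul_fejer hm h0 hM _ _).integrableOn measurableSet_Icc ?_
            intro t htm
            refine mul_le_mul_of_nonneg_right ?_ (fejer_nonneg t)
            obtain ⟨h1, h2⟩ := ht t htm
            have := hmono v (ε - t / lam) (by linarith)
            rw [show v + (ε - t / lam) = v + ε - t / lam by ring] at this
            refine le_trans ?_ this
            gcongr
            · exact h0 v
            · linarith
        _ ≤ _ := setIntegral_le_integral (integrable_bounded_mul_fejer hm h0 hM _ _)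
            (ae_of_all _ fun t => mul_nonneg (h0 _) (fejer_nonneg _))
    · refine hv2.le.trans ?_
      rw [← integral_add_compl (measurableSet_Icc (a := -T) (b := T))
        (integrable_bounded_mul_fejer hm h0 hM _ _)]
      have hs := integral_add_compl (measurableSet_Icc (a := -T) (b := T)) hf
      have hfc : 0 ≤ ∫ t in (Icc (-T) T)ᶜ, fejer t :=
        setIntegral_nonneg measurableSet_Icc.compl fun t _ => fejer_nonneg t
      have b1 : ∫ t in Icc (-T) T, B (v + -ε - t / lam) * fejer t ≤
          B v * Real.exp (2 * ε) * ∫ t in Icc (-T) T, fejer t := by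
        rw [← integral_const_mul]
        refine setIntegral_mono_on (integrable_bounded_mul_fejer hm h0 hM _ _).integrableOn
          (hf.integrableOn.const_mul _) measurableSet_Icc ?_
        intro t htm
        refine mul_le_mul_of_nonneg_right ?_ (fejer_nonneg t)
        obtain ⟨h1, h2⟩ := ht t htm
        have := hmono (v + -ε - t / lam) (ε + t / lam) (by linarith)
        rw [show v + -ε - t / lam + (ε + t / lam) = v by ring, Real.exp_neg,
          ← div_eq_mul_inv, div_le_iff₀ (Real.exp_pos _)] at this
        refine this.trans ?_
        gcongr
        · exact h0 v
        · linarith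
      have b2 : ∫ t in (Icc (-T) T)ᶜ, B (v + -ε - t / lam) * fejer t ≤
          M * ∫ t in (Icc (-T) T)ᶜ, fejer t := by
        rw [← integral_const_mul]
        refine setIntegral_mono_on (integrable_bounded_mul_fejer hm h0 hM _ _).integrableOn
          (hf.integrableOn.const_mul _) measurableSet_Icc.compl ?_
        intro t htm
        exact mul_le_mul_of_nonneg_right (hM _) (fejer_nonneg t)
      refine add_le_add (b1.trans ?_) (b2.trans ?_)
      · refine mul_le_mul_of_nonneg_left ?_ (mul_nonneg (h0 v) (Real.exp_pos _).le)
        linarith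
      · refine mul_le_mul_of_nonneg_left ?_ hM0
        linarith
  rw [tendsto_order]
  constructor
  · intro a ha
    have hcont : Tendsto (fun ε : ℝ => (a * Real.exp (2 * ε) * c + M * ε) - (A * c - ε)) (𝓝[>] 0)
        (𝓝 (a * c - A * c)) := by
      have : Tendsto (fun ε : ℝ => (a * Real.exp (2 * ε) * c + M * ε) - (A * c - ε)) (𝓝 0)
        (𝓝 ((a * Real.exp (2 * 0) * c + M * 0) - (A * c - 0))) := by
        apply Continuous.tendsto
          (f := fun ε : ℝ => (a * Real.exp (2 * ε) * c + M * ε) - (A * c - ε))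
        fun_prop
      simpa using this.mono_left nhdsWithin_le_nhds
    obtain ⟨ε, he1, he2⟩ := ((hcont.eventually (gt_mem_nhds
      (show a * c - A * c < 0 by nlinarith))).and self_mem_nhdsWithin).exists
    filter_upwards [key ε he2 ε he2] with v hv
    by_contra! hcon
    have h1 : B v * Real.exp (2 * ε) * c ≤ a * Real.exp (2 * ε) * c := by gcongr
    linarith [hv.2]
  · intro a ha
    have hA : 0 ≤ A * c := by
      refine ge_of_tendsto' (hlim 1 one_pos) fun v => ?_
      exact integral_nonneg fun t => mul_nonneg (h0 _) (fejer_nonneg _)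
    have hA' : 0 ≤ A := nonneg_of_mul_nonneg_left hA hc0
    have hcont : Tendsto (fun ε : ℝ => a * (Real.exp (-(2 * ε)) * (c - ε)) - (A * c + ε)) (𝓝[>] 0)
        (𝓝 (a * c - A * c)) := by
      have : Tendsto (fun ε : ℝ => a * (Real.exp (-(2 * ε)) * (c - ε)) - (A * c + ε)) (𝓝 0)
        (𝓝 (a * (Real.exp (-(2 * 0)) * (c - 0)) - (A * c + 0))) := by
        apply Continuous.tendsto
          (f := fun ε : ℝ => a * (Real.exp (-(2 * ε)) * (c - ε)) - (A * c + ε))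
        fun_prop
      simpa using this.mono_left nhdsWithin_le_nhds
    have hlt : ∀ᶠ ε in 𝓝[>] (0:ℝ), ε < c := by
      filter_upwards [Ioo_mem_nhdsGT hc0] with ε hε using hε.2
    obtain ⟨ε, ⟨he1, he3⟩, he2⟩ := (((hcont.eventually (lt_mem_nhds
      (show 0 < a * c - A * c by nlinarith))).and hlt).and self_mem_nhdsWithin).exists
    filter_upwards [key ε he2 ε he2] with v hv
    by_contra! hcon
    have h1 : a * (Real.exp (-(2 * ε)) * (c - ε)) ≤ B v * (Real.exp (-(2 * ε)) * (c - ε)) := by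
      have : 0 ≤ c - ε := by linarith
      gcongr
    linarith [hv.1]

section
open ArithmeticFunction.vonMangoldt

/-- The Chebyshev function of the residue class `a` modulo `q`. -/
noncomputable def psiRes {q : ℕ} (a : ZMod q) (x : ℝ) : ℝ :=
  ∑ k ∈ Finset.Icc 1 ⌊x⌋₊, residueClass a k

variable {q : ℕ} (a : ZMod q)

lemma psiRes_nonneg (x : ℝ) : 0 ≤ psiRes a x :=
  Finset.sum_nonneg fun _ _ => residueClass_nonneg a _

lemma psiRes_mono : Monotone (psiRes a) := fun _ _ h =>
  Finset.sum_le_sum_of_subset_of_nonneg (Finset.Icc_subset_Icc le_rfl (Nat.floor_le_floor h))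
    fun _ _ _ => residueClass_nonneg a _

lemma psiRes_le {x : ℝ} (hx : 0 ≤ x) : psiRes a x ≤ (Real.log 4 + 4) * x := by
  refine le_trans ?_ (Chebyshev.psi_le_const_mul_self hx)
  rw [Chebyshev.psi, show Finset.Ioc 0 ⌊x⌋₊ = Finset.Icc 1 ⌊x⌋₊ from rfl]
  exact Finset.sum_le_sum fun _ _ => residueClass_le a _

lemma psiRes_eq_zero {x : ℝ} (hx : x < 1) : psiRes a x = 0 := by
  rw [psiRes, Nat.floor_eq_zero.mpr hx]
  simp

lemma integral_psiRes_sub [NeZero q] {a : ZMod q} (ha : IsUnit a) {s : ℂ} (hs : 1 < s.re) :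
    ∫ u in Ioi (0:ℝ), ((Real.exp (-u) * psiRes a (Real.exp u) - (q.totient : ℝ)⁻¹ : ℝ) : ℂ) *
      Complex.exp (-(s - 1) * u) =
      (LFunctionResidueClassAux a s - (q.totient : ℂ)⁻¹) / s := by
  have hs0 : s ≠ 0 := by rintro rfl; norm_num at hs
  have hs1 : s - 1 ≠ 0 := by
    intro h
    rw [sub_eq_zero] at h
    subst h
    norm_num at hs
  have hsre : (-(s - 1)).re < 0 := by simp; linarith
  have hO : (fun n : ℕ ↦ ∑ k ∈ Finset.Icc 1 n, residueClass a k) =O[atTop]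
      fun n ↦ (n : ℝ) ^ (1:ℝ) := by
    refine Asymptotics.IsBigO.of_bound (Real.log 4 + 4) (Eventually.of_forall fun n => ?_)
    rw [Real.rpow_one, Real.norm_natCast, Real.norm_of_nonneg
      (Finset.sum_nonneg fun _ _ => residueClass_nonneg a _)]
    simpa [psiRes] using psiRes_le a (Nat.cast_nonneg n)
  have hL := LSeries_eq_mul_integral_of_nonneg (residueClass a) zero_le_one hs hO
    (residueClass_nonneg a)
  have hG := eqOn_LFunctionResidueClassAux ha (show s ∈ {s : ℂ | 1 < s.re} from hs)
  simp only at hG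
  have h_int : ∫ u in Ioi (0:ℝ), ((Real.exp (-u) * psiRes a (Real.exp u) : ℝ) : ℂ) *
      Complex.exp (-(s - 1) * u) = ∫ t in Set.Ioi (1 : ℝ),
        (∑ k ∈ Finset.Icc 1 ⌊t⌋₊, (residueClass a k : ℂ)) * t ^ (-(s + 1)) := by
    rw [← Real.exp_zero, ← integral_comp_exp_Ioi]
    refine integral_congr_ae (ae_of_all _ fun u => ?_)
    simp only [psiRes]
    rw [Complex.cpow_def_of_ne_zero (by exact_mod_cast (Real.exp_pos u).ne'),
      ← Complex.ofReal_log (Real.exp_pos u).le, Real.log_exp]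
    push_cast
    rw [Complex.real_smul]
    push_cast
    have e : Complex.exp (-u) * Complex.exp (-(s - 1) * u) =
        Complex.exp u * Complex.exp (u * -(s + 1)) := by
      rw [← Complex.exp_add, ← Complex.exp_add]
      congr 1
      ring
    linear_combination (∑ k ∈ Finset.Icc 1 ⌊Real.exp u⌋₊, (residueClass a k : ℂ)) * e
  have hi2 : IntegrableOn (fun u : ℝ => Complex.exp (-(s - 1) * u)) (Ioi 0) :=
    integrableOn_exp_mul_complex_Ioi hsre 0
  have hm : Measurable (psiRes a) := (psiRes_mono a).measurable
  have hi1 : IntegrableOn (fun u : ℝ => ((Real.exp (-u) * psiRes a (Real.exp u) : ℝ) : ℂ) *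
      Complex.exp (-(s - 1) * u)) (Ioi 0) := by
    refine Integrable.mono' (hi2.norm.const_mul (Real.log 4 + 4)) ?_ (ae_of_all _ fun u => ?_)
    · apply Measurable.aestronglyMeasurable
      fun_prop
    · rw [norm_mul, Complex.norm_real]
      refine mul_le_mul_of_nonneg_right ?_ (norm_nonneg _)
      rw [Real.norm_of_nonneg (mul_nonneg (Real.exp_pos _).le (psiRes_nonneg a _))]
      calc Real.exp (-u) * psiRes a (Real.exp u)
          ≤ Real.exp (-u) * ((Real.log 4 + 4) * Real.exp u) := by
            gcongr
            exact psiRes_le a (Real.exp_pos u).le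
        _ = (Real.log 4 + 4) * (Real.exp (-u) * Real.exp u) := by ring
        _ = _ := by rw [← Real.exp_add]; simp
  have : ∀ u : ℝ, ((Real.exp (-u) * psiRes a (Real.exp u) - (q.totient : ℝ)⁻¹ : ℝ) : ℂ) *
      Complex.exp (-(s - 1) * u) = ((Real.exp (-u) * psiRes a (Real.exp u) : ℝ) : ℂ) *
      Complex.exp (-(s - 1) * u) - (q.totient : ℂ)⁻¹ * Complex.exp (-(s - 1) * u) := by
    intro u
    push_cast
    ring
  simp_rw [this]
  rw [integral_sub hi1 (hi2.const_mul _), integral_const_mul, h_int,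
    integral_exp_mul_complex_Ioi hsre, hG]
  rw [show LSeries (fun n => (residueClass a n : ℂ)) s = _ from hL]
  simp only [Complex.ofReal_zero, mul_zero, Complex.exp_zero]
  field_simp
  ring

lemma tendsto_exp_mul_psiRes [NeZero q] {a : ZMod q} (ha : IsUnit a) :
    Tendsto (fun u => Real.exp (-u) * psiRes a (Real.exp u)) atTop (𝓝 (q.totient : ℝ)⁻¹) := by
  have hm0 : Measurable (psiRes a) := (psiRes_mono a).measurable
  have hm : Measurable (fun u => Real.exp (-u) * psiRes a (Real.exp u)) := by fun_prop
  have h0 : ∀ u, 0 ≤ Real.exp (-u) * psiRes a (Real.exp u) := fun u =>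
    mul_nonneg (Real.exp_pos _).le (psiRes_nonneg a _)
  have hM : ∀ u, Real.exp (-u) * psiRes a (Real.exp u) ≤ Real.log 4 + 4 := by
    intro u
    calc Real.exp (-u) * psiRes a (Real.exp u)
        ≤ Real.exp (-u) * ((Real.log 4 + 4) * Real.exp u) := by
          gcongr
          exact psiRes_le a (Real.exp_pos u).le
      _ = (Real.log 4 + 4) * (Real.exp (-u) * Real.exp u) := by ring
      _ = _ := by rw [← Real.exp_add]; simp
  refine tendsto_of_tendsto_fejer_mean hm h0 hM ?_ ?_
  · intro u s hs
    calc Real.exp (-u) * psiRes a (Real.exp u) * Real.exp (-s)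
        = Real.exp (-(u + s)) * psiRes a (Real.exp u) := by
          rw [neg_add, Real.exp_add]; ring
      _ ≤ _ := by
          gcongr
          apply psiRes_mono a
          gcongr
          linarith
  · intro lam hl
    set A : ℝ := (q.totient : ℝ)⁻¹ with hA
    have hA0 : 0 ≤ A := by positivity
    set B : ℝ → ℝ := fun u => Real.exp (-u) * psiRes a (Real.exp u) with hB
    have hcont : ContinuousOn (fun s : ℂ => (LFunctionResidueClassAux a s - (q.totient : ℂ)⁻¹) / s)
        {s | 1 ≤ s.re} := by
      refine ((continuousOn_LFunctionResidueClassAux a).sub continuousOn_const).div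
        continuousOn_id ?_
      rintro s hs rfl
      norm_num at hs
    have h1 := tendsto_integral_mul_fejer (D := fun u => B u - A)
      (C := Real.log 4 + 4 + A) (lam := lam)
      (hm.sub_const A) (by
        intro u
        rw [abs_le]
        constructor
        · linarith [h0 u, Real.log_nonneg (show (1:ℝ) ≤ 4 by norm_num)]
        · linarith [hM u]) hcont (fun s hs => integral_psiRes_sub ha hs) hl
    have hK : ∀ v, Integrable (fun u => lam * fejer (lam * (v - u))) := fun v =>
      ((integrable_fejer.comp_mul_left' hl.ne').comp_sub_left v).const_mul lam
    have hBK : ∀ v, Integrable (fun u => B u * (lam * fejer (lam * (v - u)))) := by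
      intro v
      refine Integrable.mono' ((hK v).const_mul (Real.log 4 + 4)) ?_ (ae_of_all _ fun u => ?_)
      · have := measurable_fejer
        apply Measurable.aestronglyMeasurable
        fun_prop
      · have hk : 0 ≤ lam * fejer (lam * (v - u)) := mul_nonneg hl.le (fejer_nonneg _)
        rw [Real.norm_of_nonneg (mul_nonneg (h0 u) hk)]
        exact mul_le_mul_of_nonneg_right (hM u) hk
    have hsub : ∀ (g : ℝ → ℝ) (v : ℝ), ∫ u, g u * (lam * fejer (lam * (v - u))) =
        ∫ t, g (v - t / lam) * fejer t := by
      intro g v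
      have e1 := Measure.integral_comp_mul_left (fun t => g (v - t / lam) * fejer t) lam
      have e2 := integral_sub_left_eq_self (fun t => g (v - lam * t / lam) * fejer (lam * t))
        volume v
      rw [abs_of_pos (inv_pos.mpr hl), smul_eq_mul, inv_mul_eq_div, eq_div_iff hl.ne',
        ← e2] at e1
      rw [← e1, ← integral_mul_const]
      refine integral_congr_ae (ae_of_all _ fun u => ?_)
      simp only
      rw [mul_div_cancel_left₀ _ hl.ne', sub_sub_cancel]
      ring
    have h2 : Tendsto (fun v => ∫ u in Ioi (0:ℝ), lam * fejer (lam * (v - u))) atTop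
        (𝓝 (∫ t, fejer t)) := by
      have e : ∀ v, ∫ u in Ioi (0:ℝ), lam * fejer (lam * (v - u)) =
          ∫ t in Iio (lam * v), fejer t := by
        intro v
        have := hsub ((Ioi (0:ℝ)).indicator fun _ => 1) v
        rw [← integral_indicator measurableSet_Ioi, ← integral_indicator measurableSet_Iio]
        convert this using 2
        · ext u
          by_cases h : u ∈ Ioi (0:ℝ) <;> simp [h]
        · ext t
          have : t ∈ Iio (lam * v) ↔ v - t / lam ∈ Ioi (0:ℝ) := by
            simp only [mem_Iio, mem_Ioi, sub_pos]
            rw [div_lt_iff₀ hl, mul_comm]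
          by_cases h : t ∈ Iio (lam * v)
          · simp only [indicator, h, this.mp h, if_true, one_mul]
          · have h' := (not_congr this).mp h
            simp only [indicator, h, h', if_false, zero_mul]
      simp_rw [e]
      exact (aecover_Iio (tendsto_id.const_mul_atTop hl)).integral_tendsto_of_countably_generated
        integrable_fejer
    have h3 := h1.add (h2.const_mul A)
    rw [zero_add] at h3
    refine h3.congr fun v => ?_
    rw [← hsub B v, ← integral_const_mul, ← integral_add]
    · rw [← integral_indicator measurableSet_Ioi]
      refine integral_congr_ae ?_
      have : ∀ᵐ u : ℝ, u ≠ 0 := by simp [ae_iff, measure_singleton]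
      filter_upwards [this] with u hu
      by_cases h : u ∈ Ioi (0:ℝ)
      · simp only [indicator, h, if_true]
        ring
      · have hu' : u < 0 := lt_of_le_of_ne (not_lt.mp h) hu
        simp only [indicator, h, if_false, hB]
        rw [psiRes_eq_zero a (by rwa [Real.exp_lt_one_iff])]
        simp
    · have := ((hBK v).sub ((hK v).const_mul A)).integrableOn (s := Ioi 0)
      refine this.congr (ae_of_all _ fun u => ?_)
      simp only [Pi.sub_apply]
      ring
    · exact ((hK v).const_mul A).integrableOn

/-- The prime number theorem in arithmetic progressions. -/
theorem tendsto_psiRes_div [NeZero q] {a : ZMod q} (ha : IsUnit a) :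
    Tendsto (fun x => psiRes a x / x) atTop (𝓝 (q.totient : ℝ)⁻¹) := by
  have := (tendsto_exp_mul_psiRes ha).comp Real.tendsto_log_atTop
  refine this.congr' ?_
  filter_upwards [eventually_gt_atTop 0] with x hx
  simp only [Function.comp]
  rw [Real.exp_neg, Real.exp_log hx]
  field_simp

end

end PrimesInProgressions

section LargeSieve
open Complex

/-- The additive character `x ↦ exp (2πix)`. -/
noncomputable def expChar (x : ℝ) : ℂ := cexp (I * ((2 * Real.pi * x : ℝ) : ℂ))

lemma norm_expChar (x : ℝ) : ‖expChar x‖ = 1 := by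
  rw [expChar, mul_comm, Complex.norm_exp_ofReal_mul_I]

lemma expChar_add (x y : ℝ) : expChar (x + y) = expChar x * expChar y := by
  rw [expChar, expChar, expChar, ← Complex.exp_add]
  congr 1
  push_cast
  ring

lemma conj_expChar (x : ℝ) : (starRingEnd ℂ) (expChar x) = expChar (-x) := by
  rw [expChar, expChar, ← Complex.exp_conj]
  congr 1
  rw [map_mul, Complex.conj_I, Complex.conj_ofReal]
  push_cast
  ring

lemma expChar_intCast (k : ℤ) : expChar k = 1 := by
  rw [expChar, Complex.exp_eq_one_iff]
  exact ⟨k, by push_cast; ring⟩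

lemma expChar_natCast_mul (n : ℕ) (x : ℝ) : expChar (n * x) = expChar x ^ n := by
  rw [expChar, expChar, ← Complex.exp_nat_mul]
  congr 1
  push_cast
  ring

lemma expChar_sub_intCast (x : ℝ) (k : ℤ) : expChar (x - k) = expChar x := by
  rw [sub_eq_add_neg, expChar_add, ← Int.cast_neg, expChar_intCast, mul_one]

lemma four_mul_abs_le_norm_expChar_sub_one {x : ℝ} (hx : |x| ≤ 1 / 2) :
    4 * |x| ≤ ‖expChar x - 1‖ := by
  rw [expChar, Complex.norm_exp_I_mul_ofReal_sub_one, norm_mul, Real.norm_eq_abs,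
    show 2 * Real.pi * x / 2 = Real.pi * x by ring]
  have hpi := Real.pi_pos
  have h := Real.mul_abs_le_abs_sin (x := Real.pi * x) (by
    rw [abs_mul, abs_of_pos hpi]; nlinarith)
  rw [abs_mul, abs_of_pos hpi] at h
  have : 2 / Real.pi * (Real.pi * |x|) = 2 * |x| := by field_simp
  rw [abs_two, Real.norm_eq_abs]
  linarith

lemma norm_sum_expChar_le (N : ℕ) (x : ℝ) :
    ‖∑ i ∈ Finset.range N, expChar (i * x)‖ ≤ N := by
  refine (norm_sum_le _ _).trans ?_
  simp [norm_expChar]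

lemma norm_sum_expChar_mul_le (N : ℕ) (x : ℝ) :
    ‖∑ i ∈ Finset.range N, expChar (i * x)‖ * (2 * |x - round x|) ≤ 1 := by
  set y := x - round x with hy
  have hxy : expChar x = expChar y := by rw [hy, expChar_sub_intCast]
  simp_rw [expChar_natCast_mul, hxy]
  have h1 : (∑ i ∈ Finset.range N, expChar y ^ i) * (expChar y - 1) = expChar y ^ N - 1 :=
    geom_sum_mul _ _
  have h2 : ‖∑ i ∈ Finset.range N, expChar y ^ i‖ * ‖expChar y - 1‖ ≤ 2 := by
    rw [← norm_mul, h1]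
    refine (norm_sub_le _ _).trans ?_
    rw [norm_pow, norm_expChar]
    norm_num
  have h3 := four_mul_abs_le_norm_expChar_sub_one (abs_sub_round x)
  rw [← hy] at h3
  have h4 := mul_le_mul_of_nonneg_left h3
    (norm_nonneg (∑ i ∈ Finset.range N, expChar y ^ i))
  linarith

/-- The constant in the large sieve inequality. -/
noncomputable def largeSieveConst : ℝ := 8 * ∑' k : ℤ, 1 / (1 + (k : ℝ) ^ 2)

lemma summable_one_div_one_add_int_sq : Summable fun k : ℤ => 1 / (1 + (k : ℝ) ^ 2) := by
  have h : Summable fun k : ℤ => 1 / (k : ℝ) ^ 2 :=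
    Real.summable_one_div_int_pow.mpr (by norm_num)
  refine Summable.of_norm_bounded_eventually h ?_
  have : ({0} : Set ℤ)ᶜ ∈ Filter.cofinite := (Set.finite_singleton 0).compl_mem_cofinite
  filter_upwards [this] with k hk
  have hk' : (k : ℝ) ≠ 0 := by exact_mod_cast hk
  have : 0 < (k : ℝ) ^ 2 := by positivity
  rw [Real.norm_of_nonneg (by positivity)]
  exact one_div_le_one_div_of_le this (by linarith)

lemma largeSieveConst_nonneg : 0 ≤ largeSieveConst := by
  rw [largeSieveConst]
  have : 0 ≤ ∑' k : ℤ, 1 / (1 + (k : ℝ) ^ 2) := tsum_nonneg fun k => by positivity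
  positivity

lemma norm_sum_expChar_sq_le {N : ℕ} {X : ℝ} (hX : 0 < X) (hXN : X ≤ N) (x : ℝ) :
    ‖∑ i ∈ Finset.range (2 * N), expChar (i * x)‖ ^ 2 ≤
      8 * N ^ 2 * (1 / (1 + (⌊(x - round x) * X⌋ : ℝ) ^ 2)) := by
  set D := ‖∑ i ∈ Finset.range (2 * N), expChar (i * x)‖ with hD
  have h1 : D ≤ 2 * N := by simpa using norm_sum_expChar_le (2 * N) x
  have h2 : D * (2 * |x - round x|) ≤ 1 := norm_sum_expChar_mul_le (2 * N) x
  have hD0 : 0 ≤ D := norm_nonneg _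
  set y := x - round x
  set k := ⌊y * X⌋ with hk
  have hN : (0:ℝ) < N := hX.trans_le hXN
  rw [mul_one_div, le_div_iff₀ (by positivity)]
  by_cases hk1 : |k| ≤ 1
  · have : (k : ℝ) ^ 2 ≤ 1 := by
      rw [sq_le_one_iff_abs_le_one]; exact_mod_cast hk1
    calc D ^ 2 * (1 + (k : ℝ) ^ 2) ≤ (2 * (N : ℝ)) ^ 2 * (1 + 1) := by gcongr
      _ = 8 * (N : ℝ) ^ 2 := by ring
  · push Not at hk1
    have hk2 : (2 : ℝ) ≤ |(k : ℝ)| := by exact_mod_cast hk1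
    have hfl := Int.floor_le (y * X)
    have hfl2 := Int.lt_floor_add_one (y * X)
    rw [← hk] at hfl hfl2
    have hk3 : |(k : ℝ)| ≤ 2 * (|y| * X) := by
      have e : |y| * X = |y * X| := by rw [abs_mul, abs_of_pos hX]
      rw [e]
      rcases abs_cases (k : ℝ) with ⟨h, h'⟩ | ⟨h, h'⟩
      · have := le_abs_self (y * X)
        linarith
      · have := neg_abs_le (y * X)
        linarith
    have h4 : D * |(k : ℝ)| ≤ N := by
      calc D * |(k : ℝ)| ≤ D * (2 * (|y| * X)) := by gcongr
        _ = (D * (2 * |y|)) * X := by ring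
        _ ≤ 1 * X := by gcongr
        _ ≤ N := by linarith
    have h5 : D ^ 2 * (k : ℝ) ^ 2 ≤ N ^ 2 := by
      rw [← sq_abs (k : ℝ), ← mul_pow]
      gcongr
    have h6 : (1 : ℝ) ≤ (k : ℝ) ^ 2 := by
      rw [← sq_abs]; nlinarith
    nlinarith [sq_nonneg D]

variable {ι : Type*}

lemma sum_norm_sum_expChar_sq_le (R : Finset ι) (α : ι → ℝ) {N : ℕ} {X : ℝ} (hX : 0 < X)
    (hXN : X ≤ N)
    (hsp : ∀ r ∈ R, ∀ s ∈ R, ∀ k : ℤ, |α r - α s - k| < 1 / X → r = s) (t : ℝ) :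
    ∑ s ∈ R, ‖∑ i ∈ Finset.range (2 * N), expChar (i * (t - α s))‖ ^ 2 ≤
      N ^ 2 * largeSieveConst := by
  set f : ι → ℤ := fun s => ⌊(t - α s - round (t - α s)) * X⌋ with hf
  have hinj : Set.InjOn f R := by
    intro r hr s hs h
    refine hsp r hr s hs (round (t - α s) - round (t - α r)) ?_
    have := Int.abs_sub_lt_one_of_floor_eq_floor h
    rw [← sub_mul, abs_mul, abs_of_pos hX, ← lt_div_iff₀ hX] at this
    have e : -(α r - α s - ((round (t - α s) - round (t - α r) : ℤ) : ℝ)) =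
        t - α r - round (t - α r) - (t - α s - round (t - α s)) := by
      push_cast
      ring
    rw [← abs_neg, e]
    exact this
  calc _ ≤ ∑ s ∈ R, 8 * (N : ℝ) ^ 2 * (1 / (1 + (f s : ℝ) ^ 2)) :=
        Finset.sum_le_sum fun s _ => norm_sum_expChar_sq_le hX hXN _
    _ = 8 * (N : ℝ) ^ 2 * ∑ k ∈ R.image f, 1 / (1 + (k : ℝ) ^ 2) := by
        rw [← Finset.mul_sum, Finset.sum_image hinj]
    _ ≤ 8 * (N : ℝ) ^ 2 * ∑' k : ℤ, 1 / (1 + (k : ℝ) ^ 2) := by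
        gcongr
        exact summable_one_div_one_add_int_sq.sum_le_tsum _ fun k _ => by positivity
    _ = _ := by rw [largeSieveConst]; ring

lemma dual_large_sieve (R : Finset ι) (α : ι → ℝ) {N : ℕ} {X : ℝ} (hX : 0 < X)
    (hXN : X ≤ N)
    (hsp : ∀ r ∈ R, ∀ s ∈ R, ∀ k : ℤ, |α r - α s - k| < 1 / X → r = s) (c : ι → ℂ) (M : ℕ) :
    ∑ n ∈ Finset.Ico M (M + N), ‖∑ r ∈ R, c r * expChar (n * α r)‖ ^ 2 ≤
      N * largeSieveConst * ∑ r ∈ R, ‖c r‖ ^ 2 := by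
  have hN : (0:ℝ) < N := hX.trans_le hXN
  set G : ℤ → ℝ := fun n => ‖∑ r ∈ R, c r * expChar (n * α r)‖ ^ 2 with hG
  -- the autocorrelation majorant
  have h1 : (N : ℝ) * ∑ n ∈ Finset.Ico M (M + N), G n ≤
      ∑ i ∈ Finset.range (2 * N), ∑ j ∈ Finset.range (2 * N), G (i - j + M) := by
    rw [← Finset.sum_product', Finset.mul_sum]
    have h2 : ∀ n ∈ Finset.Ico M (M + N), (N : ℝ) * G n =
        ∑ j ∈ Finset.range N, G (((n - M + j : ℕ) : ℤ) - j + M) := by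
      intro n hn
      rw [Finset.mem_Ico] at hn
      rw [Finset.sum_congr rfl (g := fun _ => G n)]
      · simp
      · intro j _
        congr 1
        omega
    rw [Finset.sum_congr rfl h2, ← Finset.sum_product']
    refine le_trans (le_of_eq ?_) (Finset.sum_le_sum_of_subset_of_nonneg
      (s := ((Finset.Ico M (M + N)) ×ˢ (Finset.range N)).image fun p => (p.1 - M + p.2, p.2))
      ?_ fun _ _ _ => by positivity)
    · rw [Finset.sum_image]
      rintro ⟨n, j⟩ h ⟨n', j'⟩ h' he
      simp only [Finset.coe_product, Finset.coe_Ico, Finset.coe_range, Set.mem_prod, Set.mem_Ico,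
        Set.mem_Iio] at h h'
      simp only [Prod.mk.injEq] at he ⊢
      omega
    · intro p hp
      simp only [Finset.mem_image, Finset.mem_product, Finset.mem_Ico, Finset.mem_range] at hp ⊢
      obtain ⟨q, ⟨h, h'⟩, rfl⟩ := hp
      dsimp only
      omega
  have h3 : ((∑ i ∈ Finset.range (2 * N), ∑ j ∈ Finset.range (2 * N), G (i - j + M) : ℝ) : ℂ) =
      ∑ r ∈ R, ∑ s ∈ R, c r * (starRingEnd ℂ) (c s) * expChar (M * (α r - α s)) *
        ((∑ i ∈ Finset.range (2 * N), expChar (i * (α r - α s))) *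
        (starRingEnd ℂ) (∑ i ∈ Finset.range (2 * N), expChar (i * (α r - α s)))) := by
    have e : ∀ n : ℤ, ((G n : ℝ) : ℂ) =
        ∑ r ∈ R, ∑ s ∈ R, c r * (starRingEnd ℂ) (c s) * expChar (n * (α r - α s)) := by
      intro n
      rw [hG]
      push_cast
      rw [← Complex.mul_conj', map_sum, Finset.sum_mul_sum]
      refine Finset.sum_congr rfl fun r _ => Finset.sum_congr rfl fun s _ => ?_
      rw [map_mul, conj_expChar, mul_sub, sub_eq_add_neg, expChar_add]
      ring
    push_cast
    simp_rw [e]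
    simp_rw [map_sum, Finset.sum_mul_sum, Finset.mul_sum]
    rw [Finset.sum_congr rfl fun i _ => Finset.sum_comm, Finset.sum_comm]
    refine Finset.sum_congr rfl fun r _ => ?_
    rw [Finset.sum_congr rfl fun i _ => Finset.sum_comm, Finset.sum_comm]
    refine Finset.sum_congr rfl fun s _ => Finset.sum_congr rfl fun i _ =>
      Finset.sum_congr rfl fun j _ => ?_
    rw [conj_expChar, ← expChar_add, mul_assoc (c r * _), ← expChar_add]
    congr 2
    push_cast
    ring
  have h4 : ∑ i ∈ Finset.range (2 * N), ∑ j ∈ Finset.range (2 * N), G (i - j + M) ≤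
      ∑ r ∈ R, ∑ s ∈ R, (‖c r‖ ^ 2 + ‖c s‖ ^ 2) / 2 *
        ‖∑ i ∈ Finset.range (2 * N), expChar (i * (α r - α s))‖ ^ 2 := by
    refine (Complex.re_le_norm _).trans' (le_of_eq (Complex.ofReal_re _).symm) |>.trans ?_
    rw [h3]
    refine (norm_sum_le _ _).trans (Finset.sum_le_sum fun r _ => (norm_sum_le _ _).trans
      (Finset.sum_le_sum fun s _ => ?_))
    rw [norm_mul, norm_mul, norm_mul, norm_expChar, mul_one, norm_mul, RCLike.norm_conj,
      RCLike.norm_conj, ← sq]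
    refine mul_le_mul_of_nonneg_right ?_ (sq_nonneg _)
    nlinarith [sq_nonneg (‖c r‖ - ‖c s‖)]
  have h5 : ∑ r ∈ R, ∑ s ∈ R, (‖c r‖ ^ 2 + ‖c s‖ ^ 2) / 2 *
        ‖∑ i ∈ Finset.range (2 * N), expChar (i * (α r - α s))‖ ^ 2 ≤
      N ^ 2 * largeSieveConst * ∑ r ∈ R, ‖c r‖ ^ 2 := by
    have hsymm : ∀ r s, ‖∑ i ∈ Finset.range (2 * N), expChar (i * (α r - α s))‖ =
        ‖∑ i ∈ Finset.range (2 * N), expChar (i * (α s - α r))‖ := by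
      intro r s
      rw [← RCLike.norm_conj, map_sum]
      congr 1
      refine Finset.sum_congr rfl fun i _ => ?_
      rw [conj_expChar]
      congr 1
      ring
    have e1 : ∑ r ∈ R, ∑ s ∈ R, ‖c s‖ ^ 2 *
        ‖∑ i ∈ Finset.range (2 * N), expChar (i * (α r - α s))‖ ^ 2 =
        ∑ r ∈ R, ∑ s ∈ R, ‖c r‖ ^ 2 *
        ‖∑ i ∈ Finset.range (2 * N), expChar (i * (α r - α s))‖ ^ 2 := by
      rw [Finset.sum_comm]
      refine Finset.sum_congr rfl fun r _ => Finset.sum_congr rfl fun s _ => ?_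
      rw [hsymm]
    have e2 : ∑ r ∈ R, ∑ s ∈ R, (‖c r‖ ^ 2 + ‖c s‖ ^ 2) / 2 *
        ‖∑ i ∈ Finset.range (2 * N), expChar (i * (α r - α s))‖ ^ 2 =
        ∑ r ∈ R, ∑ s ∈ R, ‖c r‖ ^ 2 *
        ‖∑ i ∈ Finset.range (2 * N), expChar (i * (α r - α s))‖ ^ 2 := by
      simp_rw [add_div, add_mul, Finset.sum_add_distrib, div_mul_eq_mul_div]
      simp_rw [← Finset.sum_div]
      rw [e1]
      ring
    rw [e2, Finset.mul_sum]
    refine Finset.sum_le_sum fun r _ => ?_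
    rw [← Finset.mul_sum, mul_comm]
    exact mul_le_mul_of_nonneg_right (sum_norm_sum_expChar_sq_le R α hX hXN hsp _) (sq_nonneg _)
  have h6 : (N : ℝ) * ∑ n ∈ Finset.Ico M (M + N), G n ≤
      N * (N * largeSieveConst * ∑ r ∈ R, ‖c r‖ ^ 2) := by
    refine (h1.trans (h4.trans h5)).trans (le_of_eq ?_)
    ring
  have h7 := le_of_mul_le_mul_left h6 hN
  simpa [hG] using h7

theorem large_sieve (R : Finset ι) (α : ι → ℝ) {N : ℕ} {X : ℝ} (hX : 0 < X)
    (hXN : X ≤ N)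
    (hsp : ∀ r ∈ R, ∀ s ∈ R, ∀ k : ℤ, |α r - α s - k| < 1 / X → r = s) (a : ℕ → ℝ) (M : ℕ) :
    ∑ r ∈ R, ‖∑ n ∈ Finset.Ico M (M + N), (a n : ℂ) * expChar (n * α r)‖ ^ 2 ≤
      N * largeSieveConst * ∑ n ∈ Finset.Ico M (M + N), a n ^ 2 := by
  set S : ι → ℂ := fun r => ∑ n ∈ Finset.Ico M (M + N), (a n : ℂ) * expChar (n * α r) with hS
  set T := ∑ r ∈ R, ‖S r‖ ^ 2 with hT
  have hT0 : 0 ≤ T := Finset.sum_nonneg fun _ _ => sq_nonneg _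
  have hd := dual_large_sieve R α hX hXN hsp (fun r => (starRingEnd ℂ) (S r)) M
  simp only [RCLike.norm_conj] at hd
  rw [← hT] at hd
  have h1 : (T : ℂ) = ∑ n ∈ Finset.Ico M (M + N), (a n : ℂ) *
      ∑ r ∈ R, (starRingEnd ℂ) (S r) * expChar (n * α r) := by
    rw [hT]
    push_cast
    simp_rw [← Complex.conj_mul', Finset.mul_sum]
    rw [Finset.sum_comm]
    refine Finset.sum_congr rfl fun r _ => ?_
    conv_lhs => rw [hS]
    simp only
    rw [Finset.mul_sum]
    refine Finset.sum_congr rfl fun n _ => ?_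
    ring
  have h2 : T ≤ ∑ n ∈ Finset.Ico M (M + N), |a n| *
      ‖∑ r ∈ R, (starRingEnd ℂ) (S r) * expChar (n * α r)‖ := by
    calc T = ‖(T : ℂ)‖ := by rw [Complex.norm_real, Real.norm_of_nonneg hT0]
      _ ≤ _ := by
        rw [h1]
        refine (norm_sum_le _ _).trans (le_of_eq ?_)
        simp
  have h3 : T ^ 2 ≤ (∑ n ∈ Finset.Ico M (M + N), a n ^ 2) * (N * largeSieveConst * T) := by
    calc T ^ 2 ≤ _ := by gcongr
      _ ≤ (∑ n ∈ Finset.Ico M (M + N), |a n| ^ 2) * ∑ n ∈ Finset.Ico M (M + N),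
          ‖∑ r ∈ R, (starRingEnd ℂ) (S r) * expChar (n * α r)‖ ^ 2 :=
        Finset.sum_mul_sq_le_sq_mul_sq _ _ _
      _ ≤ _ := by
        simp only [sq_abs]
        gcongr
  rcases hT0.eq_or_lt with h0 | h0
  · rw [← h0]
    have := largeSieveConst_nonneg
    positivity
  · nlinarith

end LargeSieve

section Variance
open Complex

lemma expChar_eq_one_iff (x : ℝ) : expChar x = 1 ↔ ∃ k : ℤ, x = k := by
  rw [expChar, Complex.exp_eq_one_iff]
  have hpi : (Real.pi : ℂ) ≠ 0 := by exact_mod_cast Real.pi_ne_zero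
  refine exists_congr fun k => ?_
  constructor
  · intro h
    push_cast at h
    have : (x : ℂ) = k := by
      have h2 : I * 2 * Real.pi * ((x : ℂ) - k) = 0 := by linear_combination h
      have h3 : I * 2 * (Real.pi : ℂ) ≠ 0 := by simp [hpi]
      exact sub_eq_zero.mp ((mul_eq_zero.mp h2).resolve_left h3)
    exact_mod_cast this
  · rintro rfl
    push_cast
    ring

lemma sum_range_expChar_div {q : ℕ} (hq : 0 < q) (k : ℤ) :
    ∑ b ∈ Finset.range q, expChar (k * (b / q : ℝ)) = if (q : ℤ) ∣ k then (q : ℂ) else 0 := by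
  have hq' : (q : ℝ) ≠ 0 := by positivity
  have e : ∀ b : ℕ, expChar (k * (b / q : ℝ)) = expChar (k / q) ^ b := by
    intro b
    rw [← expChar_natCast_mul]
    congr 1
    ring
  simp_rw [e]
  split_ifs with h
  · obtain ⟨j, rfl⟩ := h
    have : expChar (((q : ℤ) * j : ℤ) / (q : ℝ)) = 1 := by
      rw [expChar_eq_one_iff]
      refine ⟨j, ?_⟩
      push_cast
      field_simp
    rw [this]
    simp
  · have h1 : expChar (k / q) ≠ 1 := by
      rw [Ne, expChar_eq_one_iff]
      rintro ⟨j, hj⟩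
      apply h
      refine ⟨j, ?_⟩
      rw [div_eq_iff hq'] at hj
      have : (k : ℝ) = ((j * q : ℤ) : ℝ) := by push_cast; exact hj
      rw [mul_comm]
      exact_mod_cast this
    have h2 : expChar (k / q) ^ q = 1 := by
      rw [← expChar_natCast_mul, expChar_eq_one_iff]
      exact ⟨k, by field_simp⟩
    have h3 := geom_sum_mul (expChar (k / q)) q
    rw [h2, sub_self] at h3
    exact (mul_eq_zero.mp h3).resolve_right (sub_ne_zero.mpr h1)

/-- The sum of `a` over the members of `s` in the residue class `c`. -/
noncomputable def classSum (q : ℕ) (s : Finset ℕ) (a : ℕ → ℝ) (c : ZMod q) : ℝ :=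
  ∑ n ∈ s.filter (fun n : ℕ => (n : ZMod q) = c), a n

lemma sum_classSum_mul {q : ℕ} [NeZero q] (s : Finset ℕ) (a : ℕ → ℝ) (f : ZMod q → ℝ) :
    ∑ c, classSum q s a c * f c = ∑ n ∈ s, a n * f n := by
  simp_rw [classSum, Finset.sum_mul, Finset.sum_filter]
  rw [Finset.sum_comm]
  simp

lemma sum_classSum {q : ℕ} [NeZero q] (s : Finset ℕ) (a : ℕ → ℝ) :
    ∑ c, classSum q s a c = ∑ n ∈ s, a n := by
  simpa using sum_classSum_mul s a (fun _ => 1)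

lemma sum_norm_sq_eq_sum_classSum_sq {q : ℕ} [NeZero q] (s : Finset ℕ) (a : ℕ → ℝ) :
    ∑ b ∈ Finset.range q, ‖∑ n ∈ s, (a n : ℂ) * expChar (n * (b / q : ℝ))‖ ^ 2 =
      q * ∑ c, classSum q s a c ^ 2 := by
  have h : ((∑ b ∈ Finset.range q, ‖∑ n ∈ s, (a n : ℂ) * expChar (n * (b / q : ℝ))‖ ^ 2 : ℝ) : ℂ)
      = ((q * ∑ c, classSum q s a c ^ 2 : ℝ) : ℂ) := by
    have h1 : ∑ c, classSum q s a c ^ 2 =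
        ∑ n ∈ s, ∑ m ∈ s, a n * a m * if (q : ℤ) ∣ (n : ℤ) - m then 1 else 0 := by
      simp_rw [sq]
      rw [sum_classSum_mul s a (classSum q s a)]
      refine Finset.sum_congr rfl fun n _ => ?_
      rw [classSum, Finset.sum_filter, Finset.mul_sum]
      refine Finset.sum_congr rfl fun m _ => ?_
      have : ((m : ZMod q) = n) ↔ (q : ℤ) ∣ (n : ℤ) - m := by
        rw [← ZMod.intCast_zmod_eq_zero_iff_dvd]
        push_cast
        rw [sub_eq_zero, eq_comm]
      simp only [this]
      split_ifs <;> simp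
    rw [h1]
    push_cast
    simp_rw [← Complex.mul_conj', map_sum, Finset.sum_mul_sum]
    rw [Finset.sum_comm, Finset.mul_sum]
    refine Finset.sum_congr rfl fun n _ => ?_
    rw [Finset.sum_comm, Finset.mul_sum]
    refine Finset.sum_congr rfl fun m _ => ?_
    have := sum_range_expChar_div (q := q) (Nat.pos_of_neZero q) ((n : ℤ) - m)
    have e : ∀ b : ℕ, (a n : ℂ) * expChar (n * (b / q : ℝ)) *
        (starRingEnd ℂ) ((a m : ℂ) * expChar (m * (b / q : ℝ))) =
        a n * a m * expChar (((n : ℤ) - m : ℤ) * (b / q : ℝ)) := by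
      intro b
      rw [map_mul, conj_expChar, Complex.conj_ofReal]
      push_cast
      rw [sub_mul, sub_eq_add_neg, expChar_add]
      ring
    simp_rw [e]
    rw [← Finset.mul_sum, this]
    split_ifs <;> simp; ring
  exact_mod_cast h

/-- The mean of the class sums over invertible residues. -/
noncomputable def classMean (q : ℕ) [NeZero q] (s : Finset ℕ) (a : ℕ → ℝ) : ℝ :=
  (∑ c ∈ Finset.univ.erase (0 : ZMod q), classSum q s a c) / (q - 1)

/-- The variance of the class sums over invertible residues. -/
noncomputable def classVar (q : ℕ) [NeZero q] (s : Finset ℕ) (a : ℕ → ℝ) : ℝ :=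
  ∑ c ∈ Finset.univ.erase (0 : ZMod q), (classSum q s a c - classMean q s a) ^ 2

lemma card_erase_zero (q : ℕ) [NeZero q] :
    ((Finset.univ.erase (0 : ZMod q)).card : ℝ) = q - 1 := by
  rw [Finset.card_erase_of_mem (Finset.mem_univ _), Finset.card_univ, ZMod.card,
    Nat.cast_sub (Nat.pos_of_neZero q)]
  simp

lemma classVar_le {q : ℕ} [NeZero q] (hq : 2 ≤ q) (s : Finset ℕ) (a : ℕ → ℝ) :
    q * classVar q s a ≤
      ∑ b ∈ Finset.Ico 1 q, ‖∑ n ∈ s, (a n : ℂ) * expChar (n * (b / q : ℝ))‖ ^ 2 := by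
  have hq0 : (2 : ℝ) ≤ q := by exact_mod_cast hq
  have h1 := sum_norm_sq_eq_sum_classSum_sq (q := q) s a
  rw [Finset.range_eq_Ico, ← Finset.sum_Ioo_add_eq_sum_Ico (Nat.pos_of_neZero q)] at h1
  have h2 : ‖∑ n ∈ s, (a n : ℂ) * expChar (n * ((0 : ℕ) / q : ℝ))‖ ^ 2 =
      (∑ c, classSum q s a c) ^ 2 := by
    rw [sum_classSum]
    have : expChar 0 = 1 := by simp [expChar]
    simp only [Nat.cast_zero, zero_div, mul_zero, this, mul_one]
    rw [← Complex.ofReal_sum, Complex.norm_real, Real.norm_eq_abs, sq_abs]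
  rw [h2] at h1
  have h3 : Finset.Ioo 0 q = Finset.Ico 1 q := rfl
  rw [h3] at h1
  have h4 : classVar q s a = ∑ c ∈ Finset.univ.erase (0 : ZMod q), classSum q s a c ^ 2 -
      (q - 1) * classMean q s a ^ 2 := by
    rw [classVar]
    simp_rw [sub_sq, Finset.sum_add_distrib, Finset.sum_sub_distrib, Finset.sum_const,
      nsmul_eq_mul, card_erase_zero, ← Finset.sum_mul, ← Finset.mul_sum]
    have : ∑ c ∈ Finset.univ.erase (0 : ZMod q), classSum q s a c =
        (q - 1) * classMean q s a := by
      rw [classMean]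
      have : (q : ℝ) - 1 ≠ 0 := by linarith
      field_simp
    rw [this]
    ring
  have h5 := Finset.add_sum_erase Finset.univ (classSum q s a) (Finset.mem_univ 0)
  have h6 := Finset.add_sum_erase Finset.univ (fun c => classSum q s a c ^ 2)
    (Finset.mem_univ 0)
  rw [← h5, ← h6] at h1
  have h7 : ∑ c ∈ Finset.univ.erase (0 : ZMod q), classSum q s a c =
      (q - 1) * classMean q s a := by
    rw [classMean]
    have : (q : ℝ) - 1 ≠ 0 := by linarith
    field_simp
  rw [h7] at h1
  rw [h4]
  set x := classSum q s a 0
  set μ := classMean q s a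
  nlinarith [mul_nonneg (show (0:ℝ) ≤ q - 1 by linarith) (sq_nonneg (x - μ))]

/-- The kernel detecting the class `1` modulo `q` against the mean over invertible classes. -/
noncomputable def resKer (q : ℕ) (n : ℕ) : ℝ :=
  (if (n : ZMod q) = 1 then 1 else 0) - (if (n : ZMod q) = 0 then 0 else 1 / ((q : ℝ) - 1))

lemma abs_bilinear_resKer_le {q : ℕ} (hq : q.Prime) (s t : Finset ℕ) (a b : ℕ → ℝ) :
    haveI : NeZero q := ⟨hq.ne_zero⟩
    |∑ m ∈ s, ∑ k ∈ t, a m * b k * resKer q (m * k)| ≤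
      √(classVar q s a) * √(classVar q t b) := by
  have : NeZero q := ⟨hq.ne_zero⟩
  have : Fact q.Prime := ⟨hq⟩
  have hq1 : (q : ℝ) - 1 ≠ 0 := by
    have : (2 : ℝ) ≤ q := by exact_mod_cast hq.two_le
    linarith
  set U := Finset.univ.erase (0 : ZMod q) with hU
  have hmean : ∀ s a, ∑ c ∈ U, classSum q s a c = (q - 1) * classMean q s a := by
    intro s a
    rw [classMean]
    field_simp
    rfl
  have hinv : ∀ f : ZMod q → ℝ, ∑ c ∈ U, f c⁻¹ = ∑ c ∈ U, f c := by
    intro f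
    refine Finset.sum_nbij' (fun c => c⁻¹) (fun c => c⁻¹) ?_ ?_ ?_ ?_ ?_ <;> simp [hU]
  have key : ∑ m ∈ s, ∑ k ∈ t, a m * b k * resKer q (m * k) =
      ∑ c ∈ U, (classSum q s a c - classMean q s a) * (classSum q t b c⁻¹ - classMean q t b) := by
    have h1 : ∑ c ∈ U, (classSum q s a c - classMean q s a) *
        (classSum q t b c⁻¹ - classMean q t b) =
        ∑ c ∈ U, classSum q s a c * (classSum q t b c⁻¹ - classMean q t b) := by
      simp_rw [sub_mul _ (classMean q s a), Finset.sum_sub_distrib, ← Finset.mul_sum,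
        Finset.sum_sub_distrib, Finset.sum_const, nsmul_eq_mul, hU, card_erase_zero, ← hU]
      rw [hinv (classSum q t b), hmean]
      ring
    have h2 : ∑ c ∈ U, classSum q s a c * (classSum q t b c⁻¹ - classMean q t b) =
        ∑ c, classSum q s a c * (if c = 0 then 0 else classSum q t b c⁻¹ - classMean q t b) := by
      rw [← Finset.add_sum_erase Finset.univ _ (Finset.mem_univ (0 : ZMod q))]
      simp only [if_true, mul_zero, zero_add]
      refine Finset.sum_congr rfl fun c hc => ?_
      rw [if_neg (Finset.ne_of_mem_erase hc)]
    rw [h1, h2, sum_classSum_mul]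
    refine Finset.sum_congr rfl fun m _ => ?_
    simp_rw [mul_assoc, ← Finset.mul_sum]
    congr 1
    split_ifs with hm
    · refine Finset.sum_eq_zero fun k _ => ?_
      simp [resKer, hm]
    · have h3 : classMean q t b = ∑ k ∈ t, b k * (if (k : ZMod q) = 0 then 0 else 1 / ((q:ℝ) - 1)) := by
        rw [← sum_classSum_mul t b (fun c => if c = 0 then 0 else 1 / ((q:ℝ) - 1)), classMean,
          ← Finset.add_sum_erase Finset.univ _ (Finset.mem_univ (0 : ZMod q)), Finset.sum_div]
        simp only [if_true, mul_zero, zero_add]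
        refine Finset.sum_congr rfl fun c hc => ?_
        rw [if_neg (Finset.ne_of_mem_erase hc)]
        ring
      rw [h3, classSum, Finset.sum_filter, ← Finset.sum_sub_distrib]
      refine Finset.sum_congr rfl fun k _ => ?_
      rw [resKer]
      have e1 : ((m * k : ℕ) : ZMod q) = 1 ↔ (k : ZMod q) = (m : ZMod q)⁻¹ := by
        push_cast
        rw [mul_comm]
        exact mul_eq_one_iff_eq_inv₀ hm
      have e2 : ((m * k : ℕ) : ZMod q) = 0 ↔ (k : ZMod q) = 0 := by
        push_cast
        rw [mul_eq_zero, or_iff_right hm]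
      simp only [e1, e2]
      split_ifs <;> ring
  rw [key]
  refine abs_le_of_sq_le_sq ?_ (by positivity)
  rw [mul_pow, Real.sq_sqrt (show 0 ≤ classVar q s a from Finset.sum_nonneg fun _ _ => sq_nonneg _),
    Real.sq_sqrt (show 0 ≤ classVar q t b from Finset.sum_nonneg fun _ _ => sq_nonneg _)]
  refine (Finset.sum_mul_sq_le_sq_mul_sq _ _ _).trans (le_of_eq ?_)
  rw [classVar, classVar]
  congr 1
  exact hinv fun c => (classSum q t b c - classMean q t b) ^ 2

lemma prime_fractions_spaced {q q' b b' : ℕ} (hq : q.Prime) (hq' : q'.Prime) {Q : ℝ}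
    (hqQ : (q : ℝ) ≤ Q) (hqQ' : (q' : ℝ) ≤ Q) (hb : b ∈ Finset.Ico 1 q)
    (hb' : b' ∈ Finset.Ico 1 q') {k : ℤ}
    (h : |(b / q : ℝ) - b' / q' - k| < 1 / Q ^ 2) : q = q' ∧ b = b' := by
  rw [Finset.mem_Ico] at hb hb'
  have hq0 : (0 : ℝ) < q := by exact_mod_cast hq.pos
  have hq0' : (0 : ℝ) < q' := by exact_mod_cast hq'.pos
  have hQ : 0 < Q := hq0.trans_le hqQ
  have e : (b / q : ℝ) - b' / q' - k = ((b * q' - b' * q - k * (q * q') : ℤ) : ℝ) / (q * q') := by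
    push_cast
    field_simp
  rw [e, abs_div, abs_of_pos (mul_pos hq0 hq0'), div_lt_iff₀ (mul_pos hq0 hq0'),
    ← Int.cast_abs] at h
  have h2 : 1 / Q ^ 2 * (q * q') ≤ 1 := by
    rw [one_div, inv_mul_le_iff₀ (by positivity), mul_one, sq]
    gcongr
  have h3 : |(b * q' - b' * q - k * (q * q') : ℤ)| < 1 := by
    have : ((|(b * q' - b' * q - k * (q * q') : ℤ)| : ℤ) : ℝ) < 1 := h.trans_le h2
    exact_mod_cast this
  rw [Int.abs_lt_one_iff] at h3
  have h4 : (q : ℤ) ∣ b * q' := ⟨b' + k * q', by linear_combination h3⟩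
  have h5 : q ∣ b * q' := by exact_mod_cast h4
  have h6 : q ∣ q' := by
    refine (hq.dvd_mul.mp h5).resolve_left fun h => ?_
    exact absurd (Nat.le_of_dvd (by omega) h) (by omega)
  have h7 : q = q' := (Nat.prime_dvd_prime_iff_eq hq hq').mp h6
  refine ⟨h7, ?_⟩
  subst h7
  have hqz : (q : ℤ) ≠ 0 := by exact_mod_cast hq.ne_zero
  have h8 : (b : ℤ) - b' - k * q = 0 := by
    have : (q : ℤ) * (b - b' - k * q) = 0 := by linear_combination h3
    exact (mul_eq_zero.mp this).resolve_left hqz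
  have h9 : k = 0 := by
    by_contra hk
    have : (q : ℤ) ≤ |k * q| := by
      rw [abs_mul, Nat.abs_cast]
      have := Int.one_le_abs hk
      nlinarith
    have h10 : k * q = b - b' := by linarith
    rw [h10] at this
    have : |(b : ℤ) - b'| < q := by
      rw [abs_lt]
      omega
    omega
  subst h9
  omega

lemma sum_classVar_le {P : Finset ℕ} {Q₁ Q₂ : ℝ} (hQ₁ : 0 < Q₁) (hP : ∀ q ∈ P, q.Prime)
    (hP₁ : ∀ q ∈ P, Q₁ ≤ q) (hP₂ : ∀ q ∈ P, (q : ℝ) ≤ Q₂) (hQ₂ : 0 < Q₂)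
    {s : Finset ℕ} {M N : ℕ} (hs : s ⊆ Finset.Ico M (M + N)) (hN : Q₂ ^ 2 ≤ N) (a : ℕ → ℝ)
    (v : ℕ → ℝ) (hv : ∀ q (_ : NeZero q), v q = classVar q s a) :
    ∑ q ∈ P, v q ≤ largeSieveConst / Q₁ * N * ∑ n ∈ s, a n ^ 2 := by
  have hv0 : ∀ q ∈ P, 0 ≤ v q := by
    intro q hq
    rw [hv q ⟨(hP q hq).ne_zero⟩]
    exact Finset.sum_nonneg fun _ _ => sq_nonneg _
  have h1 : ∑ q ∈ P, Q₁ * v q ≤ ∑ q ∈ P, ∑ b ∈ Finset.Ico 1 q,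
      ‖∑ n ∈ s, (a n : ℂ) * expChar (n * (b / q : ℝ))‖ ^ 2 := by
    refine Finset.sum_le_sum fun q hq => ?_
    have : NeZero q := ⟨(hP q hq).ne_zero⟩
    have h := classVar_le (hP q hq).two_le s a
    have := hv0 q hq
    rw [← hv q ‹_›] at h
    refine le_trans ?_ h
    gcongr
    exact hP₁ q hq
  rw [Finset.sum_sigma'] at h1
  have h2 := large_sieve (P.sigma fun q => Finset.Ico 1 q) (fun r => (r.2 / r.1 : ℝ))
    (N := N) (X := Q₂ ^ 2) (by positivity) hN ?_ (fun n => if n ∈ s then a n else 0) M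
  · have h3 : ∑ n ∈ Finset.Ico M (M + N), (if n ∈ s then a n else 0) ^ 2 = ∑ n ∈ s, a n ^ 2 := by
      simp_rw [ite_pow]
      rw [← Finset.sum_filter_add_sum_filter_not (Finset.Ico M (M + N)) (· ∈ s)]
      rw [Finset.sum_eq_zero (s := Finset.filter (fun n => n ∉ s) _)
        (fun n hn => by simp [(Finset.mem_filter.mp hn).2]), add_zero]
      rw [Finset.filter_mem_eq_inter, Finset.inter_eq_right.mpr hs]
      exact Finset.sum_congr rfl fun n hn => by simp [hn]
    have h4 : ∀ x : ℝ, ∑ n ∈ Finset.Ico M (M + N),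
        ((if n ∈ s then a n else 0 : ℝ) : ℂ) * expChar (n * x) =
        ∑ n ∈ s, (a n : ℂ) * expChar (n * x) := by
      intro x
      rw [← Finset.sum_subset hs]
      · exact Finset.sum_congr rfl fun n hn => by simp [hn]
      · intro n _ hn
        simp [hn]
    simp_rw [h4] at h2
    rw [h3] at h2
    have h5 := h1.trans h2
    rw [← Finset.mul_sum] at h5
    rw [div_mul_eq_mul_div, div_mul_eq_mul_div, le_div_iff₀ hQ₁]
    linarith
  · rintro ⟨q, b⟩ hr ⟨q', b'⟩ hr' k h
    rw [Finset.mem_sigma] at hr hr'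
    obtain ⟨h1, h2⟩ := prime_fractions_spaced (hP q hr.1) (hP q' hr'.1) (hP₂ q hr.1)
      (hP₂ q' hr'.1) hr.2 hr'.2 h
    subst h1 h2
    rfl

theorem sum_abs_bilinear_resKer_le {P : Finset ℕ} {Q₁ Q₂ : ℝ} (hQ₁ : 0 < Q₁)
    (hP : ∀ q ∈ P, q.Prime)
    (hP₁ : ∀ q ∈ P, Q₁ ≤ q) (hP₂ : ∀ q ∈ P, (q : ℝ) ≤ Q₂) (hQ₂ : 0 < Q₂)
    {s t : Finset ℕ} {M N M' N' : ℕ} (hs : s ⊆ Finset.Ico M (M + N)) (hN : Q₂ ^ 2 ≤ N)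
    (ht : t ⊆ Finset.Ico M' (M' + N')) (hN' : Q₂ ^ 2 ≤ N') (a b : ℕ → ℝ) :
    ∑ q ∈ P, |∑ m ∈ s, ∑ k ∈ t, a m * b k * resKer q (m * k)| ≤
      largeSieveConst / Q₁ * √(N * ∑ n ∈ s, a n ^ 2) * √(N' * ∑ n ∈ t, b n ^ 2) := by
  set va : ℕ → ℝ := fun q => if h : q ≠ 0 then haveI : NeZero q := ⟨h⟩; classVar q s a else 0
    with hva
  set vb : ℕ → ℝ := fun q => if h : q ≠ 0 then haveI : NeZero q := ⟨h⟩; classVar q t b else 0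
    with hvb
  have hva' : ∀ q (_ : NeZero q), va q = classVar q s a := by
    intro q hq
    simp [hva, hq.ne]
  have hvb' : ∀ q (_ : NeZero q), vb q = classVar q t b := by
    intro q hq
    simp [hvb, hq.ne]
  have ha := sum_classVar_le hQ₁ hP hP₁ hP₂ hQ₂ hs hN a va hva'
  have hb := sum_classVar_le hQ₁ hP hP₁ hP₂ hQ₂ ht hN' b vb hvb'
  have h0 := largeSieveConst_nonneg
  calc _ ≤ ∑ q ∈ P, √(va q) * √(vb q) := by
        refine Finset.sum_le_sum fun q hq => ?_
        rw [hva' q ⟨(hP q hq).ne_zero⟩, hvb' q ⟨(hP q hq).ne_zero⟩]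
        exact abs_bilinear_resKer_le (hP q hq) s t a b
    _ ≤ √(∑ q ∈ P, va q) * √(∑ q ∈ P, vb q) := by
        apply Real.sum_sqrt_mul_sqrt_le
        · intro q
          simp only [hva]
          split_ifs
          · exact Finset.sum_nonneg fun _ _ => sq_nonneg _
          · exact le_rfl
        · intro q
          simp only [hvb]
          split_ifs
          · exact Finset.sum_nonneg fun _ _ => sq_nonneg _
          · exact le_rfl
    _ ≤ √(largeSieveConst / Q₁ * (N * ∑ n ∈ s, a n ^ 2)) *
          √(largeSieveConst / Q₁ * (N' * ∑ n ∈ t, b n ^ 2)) := by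
        gcongr
        · linarith
        · linarith
    _ = _ := by
        rw [Real.sqrt_mul (show 0 ≤ largeSieveConst / Q₁ by positivity) (N * _),
          Real.sqrt_mul (show 0 ≤ largeSieveConst / Q₁ by positivity) (N' * _)]
        have := Real.mul_self_sqrt (show 0 ≤ largeSieveConst / Q₁ by positivity)
        linear_combination (√(N * ∑ n ∈ s, a n ^ 2) * √(N' * ∑ n ∈ t, b n ^ 2)) * this

end Variance

section TriangleWeight

open MeasureTheory

section LogTriangle

/-- The triangle function in `log x`, supported on `[z / 2, z]`. -/
noncomputable def logTri (z x : ℝ) : ℝ :=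
  max 0 (1 - |Real.log x - (Real.log z - Real.log 2 / 2)| / (Real.log 2 / 2))

lemma logTri_nonneg (z x : ℝ) : 0 ≤ logTri z x := le_max_left _ _

lemma half_log_two_pos : 0 < Real.log 2 / 2 := by
  have := Real.log_pos one_lt_two
  linarith

lemma logTri_le_one (z x : ℝ) : logTri z x ≤ 1 := by
  refine max_le zero_le_one ?_
  have := half_log_two_pos
  have : 0 ≤ |Real.log x - (Real.log z - Real.log 2 / 2)| / (Real.log 2 / 2) := by positivity
  linarith

lemma logTri_ne_zero {z x : ℝ} (h : logTri z x ≠ 0) :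
    Real.log z - Real.log 2 < Real.log x ∧ Real.log x < Real.log z := by
  have h2 := half_log_two_pos
  have h1 : 0 < 1 - |Real.log x - (Real.log z - Real.log 2 / 2)| / (Real.log 2 / 2) := by
    by_contra! hc
    exact h (max_eq_left hc)
  rw [sub_pos, div_lt_one h2, abs_lt] at h1
  constructor <;> linarith [h1.1, h1.2]

lemma mem_of_logTri_ne_zero {z x : ℝ} (hz : 0 < z) (hx : 0 < x) (h : logTri z x ≠ 0) :
    z / 2 < x ∧ x < z := by
  obtain ⟨h1, h2⟩ := logTri_ne_zero h
  rw [← Real.log_div hz.ne' two_ne_zero] at h1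
  exact ⟨(Real.log_lt_log_iff (by positivity) hx).mp h1, (Real.log_lt_log_iff hx hz).mp h2⟩

lemma abs_logTri_sub_le (z x y : ℝ) :
    |logTri z x - logTri z y| ≤ |Real.log x - Real.log y| / (Real.log 2 / 2) := by
  have h2 := half_log_two_pos
  rw [logTri, logTri, max_comm 0, max_comm 0]
  refine (abs_max_sub_max_le_abs (α := ℝ) _ _ _).trans ?_
  rw [sub_sub_sub_cancel_left, ← sub_div, abs_div, abs_of_pos h2]
  refine div_le_div_of_nonneg_right ?_ h2.le
  have := abs_abs_sub_abs_le (Real.log y - (Real.log z - Real.log 2 / 2))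
    (Real.log x - (Real.log z - Real.log 2 / 2))
  rw [sub_sub_sub_cancel_right, abs_sub_comm (Real.log y) (Real.log x)] at this
  exact this

lemma integral_indicator_mul_indicator (α β : ℝ) {h : ℝ} (hh : 0 < h) :
    ∫ s, (Set.Icc α (α + h)).indicator (fun _ => (1 : ℝ)) s *
      (Set.Icc β (β + h)).indicator (fun _ => (1 : ℝ)) s = h * max 0 (1 - |α - β| / h) := by
  have e : ∀ s, (Set.Icc α (α + h)).indicator (fun _ => (1 : ℝ)) s *
      (Set.Icc β (β + h)).indicator (fun _ => (1 : ℝ)) s =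
      (Set.Icc (max α β) (min (α + h) (β + h))).indicator (fun _ => (1 : ℝ)) s := by
    intro s
    rw [← Set.inter_indicator_mul, Set.Icc_inter_Icc]
    simp [Set.indicator]
  simp_rw [e]
  rw [integral_indicator measurableSet_Icc]
  simp only [integral_const, MeasurableSet.univ, measureReal_restrict_apply, Set.univ_inter,
    smul_eq_mul, mul_one, Real.volume_real_Icc]
  rw [mul_max_of_nonneg _ _ hh.le, mul_zero, mul_sub, mul_one, mul_div_cancel₀ _ hh.ne', max_comm]
  congr 1
  rw [min_add_add_right]
  rcases le_total α β with h1 | h1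
  · rw [max_eq_right h1, min_eq_left h1, abs_of_nonpos (by linarith)]
    ring
  · rw [max_eq_left h1, min_eq_right h1, abs_of_nonneg (by linarith)]
    ring

end LogTriangle

end TriangleWeight

section BilinearSums

open MeasureTheory

section TypeII

lemma sum_abs_bilinear_resKer_mod_le {P : Finset ℕ} {Q₁ Q₂ : ℝ} (hQ₁ : 0 < Q₁)
    (hP : ∀ q ∈ P, q.Prime)
    (hP₁ : ∀ q ∈ P, Q₁ ≤ q) (hP₂ : ∀ q ∈ P, (q : ℝ) ≤ Q₂) (hQ₂ : 0 < Q₂)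
    {s t : Finset ℕ} {M N M' N' : ℕ} (hs : s ⊆ Finset.Ico M (M + N)) (hN : Q₂ ^ 2 ≤ N)
    (ht : t ⊆ Finset.Ico M' (M' + N')) (hN' : Q₂ ^ 2 ≤ N') (a b : ℕ → ℝ)
    (K : ℕ) [NeZero K] (u : ZMod K) :
    ∑ q ∈ P, |∑ m ∈ s, ∑ k ∈ t, a m * b k *
        (if ((m * k : ℕ) : ZMod K) = u then resKer q (m * k) else 0)| ≤
      K * (largeSieveConst / Q₁ * √(N * ∑ n ∈ s, a n ^ 2) * √(N' * ∑ n ∈ t, b n ^ 2)) := by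
  have h0 := largeSieveConst_nonneg
  have h1 : ∀ q, ∑ m ∈ s, ∑ k ∈ t, a m * b k *
      (if ((m * k : ℕ) : ZMod K) = u then resKer q (m * k) else 0) =
      ∑ c : ZMod K, ∑ m ∈ s.filter (fun m : ℕ => (m : ZMod K) = c),
        ∑ k ∈ t.filter (fun k : ℕ => c * (k : ZMod K) = u), a m * b k * resKer q (m * k) := by
    intro q
    simp_rw [Finset.sum_filter]
    conv_rhs => rw [Finset.sum_comm]
    refine Finset.sum_congr rfl fun m _ => ?_
    rw [Finset.sum_ite_eq, if_pos (Finset.mem_univ _)]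
    refine Finset.sum_congr rfl fun k _ => ?_
    push_cast
    split_ifs <;> simp
  calc _ ≤ ∑ q ∈ P, ∑ c : ZMod K, |∑ m ∈ s.filter (fun m : ℕ => (m : ZMod K) = c),
        ∑ k ∈ t.filter (fun k : ℕ => c * (k : ZMod K) = u), a m * b k * resKer q (m * k)| := by
        refine Finset.sum_le_sum fun q _ => ?_
        rw [h1]
        exact Finset.abs_sum_le_sum_abs _ _
    _ ≤ ∑ c : ZMod K, (largeSieveConst / Q₁ * √(N * ∑ n ∈ s, a n ^ 2) *
        √(N' * ∑ n ∈ t, b n ^ 2)) := by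
        rw [Finset.sum_comm]
        refine Finset.sum_le_sum fun c _ => ?_
        refine (sum_abs_bilinear_resKer_le hQ₁ hP hP₁ hP₂ hQ₂
          ((Finset.filter_subset _ _).trans hs) hN ((Finset.filter_subset _ _).trans ht) hN'
          a b).trans ?_
        gcongr
        · exact Finset.filter_subset _ _
        · exact Finset.filter_subset _ _
    _ = _ := by simp

lemma sum_log_window_le {P : Finset ℕ} {Q₁ Q₂ : ℝ} (hQ₁ : 0 < Q₁)
    (hP : ∀ q ∈ P, q.Prime)
    (hP₁ : ∀ q ∈ P, Q₁ ≤ q) (hP₂ : ∀ q ∈ P, (q : ℝ) ≤ Q₂) (hQ₂ : 2 ≤ Q₂)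
    {z W L : ℝ} (hW : 1 ≤ W) (hL : 0 ≤ L) {s t : Finset ℕ} {X Y : ℝ}
    (hX : W ≤ X) (hY : W ≤ Y) (hXY : X * Y = z)
    (hs : ∀ m ∈ s, 1 ≤ m ∧ (m : ℝ) ≤ X) (ht : ∀ m ∈ t, 1 ≤ m ∧ (m : ℝ) ≤ Y)
    {a b : ℕ → ℝ} (ha : ∀ m, |a m| ≤ 1) (hb : ∀ k ∈ t, |b k| ≤ L)
    (K : ℕ) [NeZero K] (u : ZMod K) :
    ∑ q ∈ P, |∑ m ∈ s, ∑ k ∈ t, a m * b k *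
        (if ((m * k : ℕ) : ZMod K) = u then resKer q (m * k) else 0)| ≤
      K * (largeSieveConst / Q₁ * (L * (z + 2 * (z * Q₂ / √W) + 2 * (√z * Q₂ ^ 2)))) := by
  have h0 := largeSieveConst_nonneg
  have hX0 : 0 < X := by linarith
  have hY0 : 0 < Y := by linarith
  have hz0 : 0 < z := hXY ▸ mul_pos hX0 hY0
  set R := 2 * Q₂ ^ 2 with hR
  have hR8 : 8 ≤ R := by rw [hR]; nlinarith
  have hwin : ∀ (s : Finset ℕ) (X : ℝ), 0 < X → (∀ m ∈ s, 1 ≤ m ∧ (m : ℝ) ≤ X) →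
      s ⊆ Finset.Ico 0 (0 + ⌈X + Q₂ ^ 2 + 1⌉₊) ∧ Q₂ ^ 2 ≤ ⌈X + Q₂ ^ 2 + 1⌉₊ ∧
      (⌈X + Q₂ ^ 2 + 1⌉₊ : ℝ) ≤ X + R ∧ (s.card : ℝ) ≤ X := by
    intro s X hX0 hs
    refine ⟨?_, ?_, ?_, ?_⟩
    · intro m hm
      rw [Finset.mem_Ico, zero_add]
      refine ⟨Nat.zero_le _, ?_⟩
      rw [Nat.lt_ceil]
      have := (hs m hm).2
      nlinarith
    · refine le_trans ?_ (Nat.le_ceil _)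
      linarith
    · have := Nat.ceil_lt_add_one (show 0 ≤ X + Q₂ ^ 2 + 1 by positivity)
      rw [hR]
      nlinarith
    · have : s ⊆ Finset.Icc 1 ⌊X⌋₊ := by
        intro m hm
        rw [Finset.mem_Icc]
        exact ⟨(hs m hm).1, Nat.le_floor (hs m hm).2⟩
      have := Finset.card_le_card this
      rw [Nat.card_Icc, Nat.add_sub_cancel] at this
      calc (s.card : ℝ) ≤ ⌊X⌋₊ := by exact_mod_cast this
        _ ≤ X := Nat.floor_le hX0.le
  obtain ⟨s1, s2, s3, s4⟩ := hwin s X hX0 hs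
  obtain ⟨t1, t2, t3, t4⟩ := hwin t Y hY0 ht
  refine (sum_abs_bilinear_resKer_mod_le hQ₁ hP hP₁ hP₂ (by linarith) s1 s2 t1 t2 a b K u).trans ?_
  rw [mul_assoc (largeSieveConst / Q₁)]
  refine mul_le_mul_of_nonneg_left (mul_le_mul_of_nonneg_left ?_ (by positivity)) (by positivity)
  have sa : ∑ n ∈ s, a n ^ 2 ≤ X := by
    refine le_trans ?_ s4
    rw [← nsmul_one, ← Finset.sum_const]
    exact Finset.sum_le_sum fun m _ => (sq_le_one_iff_abs_le_one _).mpr (ha m)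
  have sb : ∑ n ∈ t, b n ^ 2 ≤ Y * L ^ 2 := by
    refine le_trans (Finset.sum_le_card_nsmul t _ (L ^ 2) fun m hm => ?_) ?_
    · exact sq_le_sq' (by linarith [(abs_le.mp (hb m hm)).1]) (abs_le.mp (hb m hm)).2
    · rw [nsmul_eq_mul]
      gcongr
  have hW0 : 0 < W := by linarith
  have hXYW : X + Y ≤ 2 * z / W := by
    rw [le_div_iff₀ hW0]
    nlinarith [mul_nonneg (sub_nonneg.mpr hX) hY0.le, mul_nonneg (sub_nonneg.mpr hY) hX0.le]
  have hsz : √z ^ 2 = z := Real.sq_sqrt hz0.le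
  have hsW : √W ^ 2 = W := Real.sq_sqrt hW0.le
  have hsW0 : 0 < √W := Real.sqrt_pos.mpr hW0
  have hsz0 : 0 < √z := Real.sqrt_pos.mpr hz0
  calc √(⌈X + Q₂ ^ 2 + 1⌉₊ * ∑ n ∈ s, a n ^ 2) * √(⌈Y + Q₂ ^ 2 + 1⌉₊ * ∑ n ∈ t, b n ^ 2)
      ≤ √((X + R) * X) * √((Y + R) * (Y * L ^ 2)) := by gcongr
    _ = √((X + R) * X * ((Y + R) * (Y * L ^ 2))) := (Real.sqrt_mul (by positivity) _).symm
    _ ≤ √((L * (z + 2 * (z * Q₂ / √W) + 2 * (√z * Q₂ ^ 2))) ^ 2) := by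
        apply Real.sqrt_le_sqrt
        have e : (X + R) * X * ((Y + R) * (Y * L ^ 2)) =
            L ^ 2 * (z * (z + R * (X + Y) + R ^ 2)) := by rw [← hXY]; ring
        rw [e, mul_pow L]
        refine mul_le_mul_of_nonneg_left ?_ (sq_nonneg L)
        calc z * (z + R * (X + Y) + R ^ 2) ≤ z * (z + R * (2 * z / W) + R ^ 2) := by gcongr
          _ = z ^ 2 + (2 * (z * Q₂ / √W)) ^ 2 + (2 * (√z * Q₂ ^ 2)) ^ 2 := by
              rw [mul_pow 2 (z * Q₂ / √W), div_pow, hsW, mul_pow 2 (√z * Q₂ ^ 2), mul_pow (√z), hsz, hR]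
              ring
          _ ≤ _ := by
              have x1 : 0 ≤ 2 * (z * Q₂ / √W) := by positivity
              have x2 : 0 ≤ 2 * (√z * Q₂ ^ 2) := by positivity
              nlinarith [mul_nonneg hz0.le x1, mul_nonneg hz0.le x2, mul_nonneg x1 x2]
    _ = _ := Real.sqrt_sq (by positivity)

/-- Bilinear sums weighted by `logTri z` have small discrepancy on average over prime moduli. -/
theorem sum_abs_bilinear_logTri_le {P : Finset ℕ} {Q₁ Q₂ : ℝ} (hQ₁ : 0 < Q₁)
    (hP : ∀ q ∈ P, q.Prime)
    (hP₁ : ∀ q ∈ P, Q₁ ≤ q) (hP₂ : ∀ q ∈ P, (q : ℝ) ≤ Q₂) (hQ₂ : 2 ≤ Q₂)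
    {z W L : ℝ} (hz : 2 ≤ z) (hW : 1 ≤ W) (hL : 0 ≤ L)
    {a b : ℕ → ℝ} (ha : ∀ m, |a m| ≤ 1) (haW : ∀ m : ℕ, (m : ℝ) ≤ W → a m = 0)
    (hb : ∀ k : ℕ, (k : ℝ) ≤ z → |b k| ≤ L) (hbW : ∀ k : ℕ, (k : ℝ) ≤ W → b k = 0)
    (K : ℕ) [NeZero K] (u : ZMod K) :
    ∑ q ∈ P, |∑ m ∈ Finset.Icc 1 ⌊z⌋₊, ∑ k ∈ Finset.Icc 1 ⌊z⌋₊, a m * b k *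
        ((if ((m * k : ℕ) : ZMod K) = u then resKer q (m * k) else 0) *
          logTri z ((m * k : ℕ) : ℝ))| ≤
      (Real.log z + 1) / (Real.log 2 / 2) *
      (K * (largeSieveConst / Q₁ * (L * (z + 2 * (z * Q₂ / √W) + 2 * (√z * Q₂ ^ 2))))) := by
  set h := Real.log 2 / 2 with hh
  have hh0 : 0 < h := half_log_two_pos
  have hz0 : 0 < z := by linarith
  have h0 := largeSieveConst_nonneg
  set E := K * (largeSieveConst / Q₁ * (L * (z + 2 * (z * Q₂ / √W) + 2 * (√z * Q₂ ^ 2)))) with hE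
  have hE0 : 0 ≤ E := by positivity
  set c : ℕ → ℕ → ℕ → ℝ := fun q m k => a m * b k *
    (if ((m * k : ℕ) : ZMod K) = u then resKer q (m * k) else 0) with hc
  set I := Finset.Icc 1 ⌊z⌋₊ with hI
  have hIm : ∀ m ∈ I, (1 : ℝ) ≤ m ∧ (m : ℝ) ≤ z := by
    intro m hm
    rw [hI, Finset.mem_Icc] at hm
    exact ⟨by exact_mod_cast hm.1, (Nat.le_floor_iff hz0.le).mp hm.2⟩
  set A : ℝ → ℕ → ℝ := fun s m => (Set.Icc (Real.log m) (Real.log m + h)).indicator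
    (fun _ => (1 : ℝ)) s with hA
  set B : ℝ → ℕ → ℝ := fun s k => (Set.Icc (Real.log z - h - Real.log k)
    (Real.log z - h - Real.log k + h)).indicator (fun _ => (1 : ℝ)) s with hB
  have hAB : ∀ m ∈ I, ∀ k ∈ I, ∫ s, A s m * B s k = h * logTri z ((m * k : ℕ) : ℝ) := by
    intro m hm k hk
    rw [hA, hB, integral_indicator_mul_indicator _ _ hh0, logTri]
    push_cast
    rw [Real.log_mul (by linarith [(hIm m hm).1]) (by linarith [(hIm k hk).1])]
    congr 5
    ring
  have hABi : ∀ m k, Integrable fun s => A s m * B s k := by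
    intro m k
    have e : (fun s => A s m * B s k) = (Set.Icc (Real.log m) (Real.log m + h) ∩
        Set.Icc (Real.log z - h - Real.log k) (Real.log z - h - Real.log k + h)).indicator
        (fun _ => (1 : ℝ)) := by
      ext s
      rw [hA, hB]
      simp only
      rw [← Set.inter_indicator_mul]
      simp [Set.indicator]
    rw [e, Set.Icc_inter_Icc]
    exact (integrable_indicator_iff measurableSet_Icc).mpr (by simp)
  -- pointwise bound in the separating variable
  have hpt : ∀ s, ∑ q ∈ P, |∑ m ∈ I, ∑ k ∈ I, c q m k * (A s m * B s k)| ≤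
      (Set.Icc 0 (Real.log z + h)).indicator (fun _ => E) s := by
    intro s
    have hfil : ∀ q, ∑ m ∈ I, ∑ k ∈ I, c q m k * (A s m * B s k) =
        ∑ m ∈ I.filter (fun m : ℕ => s ∈ Set.Icc (Real.log m) (Real.log m + h) ∧ W < m),
        ∑ k ∈ I.filter (fun k : ℕ => s ∈ Set.Icc (Real.log z - h - Real.log k)
          (Real.log z - h - Real.log k + h) ∧ W < k), c q m k := by
      intro q
      rw [Finset.sum_filter]
      refine Finset.sum_congr rfl fun m _ => ?_
      split_ifs with hm
      · rw [Finset.sum_filter]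
        refine Finset.sum_congr rfl fun k _ => ?_
        rw [hA, hB]
        simp only [Set.indicator, hm.1, if_true]
        by_cases hk : W < (k : ℝ)
        · simp [hk]
        · have : c q m k = 0 := by simp [hc, hbW k (not_lt.mp hk)]
          simp [this]
      · refine Finset.sum_eq_zero fun k _ => ?_
        by_cases hm' : W < (m : ℝ)
        · rw [hA]
          have : s ∉ Set.Icc (Real.log m) (Real.log m + h) := fun h => hm ⟨h, hm'⟩
          simp [this]
        · have : c q m k = 0 := by simp [hc, haW m (not_lt.mp hm')]
          simp [this]
    simp_rw [hfil]
    set s1 := I.filter (fun m : ℕ => s ∈ Set.Icc (Real.log m) (Real.log m + h) ∧ W < m) with hs1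
    set t1 := I.filter (fun k : ℕ => s ∈ Set.Icc (Real.log z - h - Real.log k)
          (Real.log z - h - Real.log k + h) ∧ W < k) with ht1
    have hE' : 0 ≤ (Set.Icc 0 (Real.log z + h)).indicator (fun _ => E) s :=
      Set.indicator_nonneg (fun _ _ => hE0) _
    rcases s1.eq_empty_or_nonempty with he | ⟨m, hm⟩
    · simpa [he] using hE'
    rcases t1.eq_empty_or_nonempty with he | ⟨k, hk⟩
    · simpa [he] using hE'
    have hs1X : ∀ m ∈ s1, 1 ≤ m ∧ (m : ℝ) ≤ Real.exp s := by
      intro m hm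
      rw [hs1, Finset.mem_filter] at hm
      refine ⟨(Finset.mem_Icc.mp hm.1).1, ?_⟩
      rw [← Real.log_le_iff_le_exp (by linarith [(hIm m hm.1).1])]
      exact hm.2.1.1
    have ht1Y : ∀ k ∈ t1, 1 ≤ k ∧ (k : ℝ) ≤ Real.exp (Real.log z - s) := by
      intro m hm
      rw [ht1, Finset.mem_filter] at hm
      refine ⟨(Finset.mem_Icc.mp hm.1).1, ?_⟩
      rw [← Real.log_le_iff_le_exp (by linarith [(hIm m hm.1).1])]
      linarith [hm.2.1.2]
    have hm' := (Finset.mem_filter.mp hm)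
    have hk' := (Finset.mem_filter.mp hk)
    have hsmem : s ∈ Set.Icc 0 (Real.log z + h) := by
      have h1 := Real.log_nonneg (hIm m hm'.1).1
      have h2 := Real.log_le_log (by linarith [(hIm m hm'.1).1]) (hIm m hm'.1).2
      exact ⟨h1.trans hm'.2.1.1, by linarith [hm'.2.1.2]⟩
    rw [Set.indicator_of_mem hsmem]
    refine sum_log_window_le hQ₁ hP hP₁ hP₂ hQ₂ hW hL (X := Real.exp s)
      (Y := Real.exp (Real.log z - s)) ?_ ?_ ?_ hs1X ht1Y ha ?_ K u
    · exact hm'.2.2.le.trans (hs1X m hm).2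
    · exact hk'.2.2.le.trans (ht1Y k hk).2
    · rw [← Real.exp_add, add_sub_cancel, Real.exp_log hz0]
    · intro k hk
      exact hb k (hIm k (Finset.mem_filter.mp hk).1).2
  have hσ : ∀ q, ∃ σ : ℝ, |σ| ≤ 1 ∧ |∑ m ∈ I, ∑ k ∈ I, c q m k *
      (h * logTri z ((m * k : ℕ) : ℝ))| = σ * ∑ m ∈ I, ∑ k ∈ I, c q m k *
      (h * logTri z ((m * k : ℕ) : ℝ)) := by
    intro q
    rcases abs_cases (∑ m ∈ I, ∑ k ∈ I, c q m k * (h * logTri z ((m * k : ℕ) : ℝ))) with h | h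
    · exact ⟨1, by simp, by rw [h.1, one_mul]⟩
    · exact ⟨-1, by simp, by rw [h.1, neg_one_mul]⟩
  choose σ hσ1 hσ2 using hσ
  have hmain : ∑ q ∈ P, |∑ m ∈ I, ∑ k ∈ I, c q m k * (h * logTri z ((m * k : ℕ) : ℝ))| ≤
      (Real.log z + h) * E := by
    have h_int : ∑ q ∈ P, |∑ m ∈ I, ∑ k ∈ I, c q m k * (h * logTri z ((m * k : ℕ) : ℝ))| =
        ∫ s, ∑ q ∈ P, σ q * ∑ m ∈ I, ∑ k ∈ I, c q m k * (A s m * B s k) := by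
      have i1 : ∀ q m k, Integrable fun s => c q m k * (A s m * B s k) := fun q m k =>
        (hABi m k).const_mul _
      have i2 : ∀ q m, Integrable fun s => ∑ k ∈ I, c q m k * (A s m * B s k) := fun q m =>
        integrable_finsetSum _ fun k _ => i1 q m k
      have i3 : ∀ q, Integrable fun s => ∑ m ∈ I, ∑ k ∈ I, c q m k * (A s m * B s k) := fun q =>
        integrable_finsetSum _ fun m _ => i2 q m
      rw [integral_finsetSum _ fun q _ => (i3 q).const_mul _]
      refine Finset.sum_congr rfl fun q _ => ?_
      rw [hσ2, integral_const_mul, integral_finsetSum _ fun m _ => i2 q m]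
      congr 1
      refine Finset.sum_congr rfl fun m hm => ?_
      rw [integral_finsetSum _ fun k _ => i1 q m k]
      refine Finset.sum_congr rfl fun k hk => ?_
      rw [integral_const_mul, hAB m hm k hk]
    have hi : Integrable fun s => ∑ q ∈ P, σ q * ∑ m ∈ I, ∑ k ∈ I, c q m k * (A s m * B s k) :=
      integrable_finsetSum _ fun q _ => (integrable_finsetSum _ fun m _ =>
        integrable_finsetSum _ fun k _ => (hABi m k).const_mul _).const_mul _
    rw [h_int]
    calc _ ≤ ∫ s, (Set.Icc 0 (Real.log z + h)).indicator (fun _ => E) s := by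
          refine integral_mono hi ?_ fun s => ?_
          · exact (integrable_indicator_iff measurableSet_Icc).mpr (by simp)
          · refine le_trans (Finset.sum_le_sum fun q _ => ?_) (hpt s)
            refine (le_abs_self _).trans ?_
            rw [abs_mul]
            exact mul_le_of_le_one_left (abs_nonneg _) (hσ1 q)
      _ = _ := by
          rw [integral_indicator measurableSet_Icc]
          have : 0 ≤ Real.log z + h := by
            have := Real.log_nonneg (show 1 ≤ z by linarith)
            linarith
          simp [Real.volume_real_Icc, this]
  have hfin : ∑ q ∈ P, |∑ m ∈ I, ∑ k ∈ I, c q m k * (h * logTri z ((m * k : ℕ) : ℝ))| =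
      h * ∑ q ∈ P, |∑ m ∈ I, ∑ k ∈ I, c q m k * logTri z ((m * k : ℕ) : ℝ)| := by
    rw [Finset.mul_sum]
    refine Finset.sum_congr rfl fun q _ => ?_
    rw [← abs_of_pos hh0, ← abs_mul, abs_of_pos hh0, Finset.mul_sum]
    congr 1
    refine Finset.sum_congr rfl fun m _ => ?_
    rw [Finset.mul_sum]
    refine Finset.sum_congr rfl fun k _ => ?_
    ring
  rw [hfin] at hmain
  simp_rw [← mul_assoc (a _ * b _)]
  rw [div_mul_eq_mul_div, le_div_iff₀ hh0, mul_comm _ h]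
  refine hmain.trans ?_
  gcongr
  have := Real.log_two_lt_d9
  rw [hh]
  linarith

end TypeII

end BilinearSums

section TypeI

lemma abs_sum_ite_modEq_sub_le {L : ℕ} (hL : 0 < L) (r r' n : ℕ) :
    |∑ k ∈ Finset.range n, ((if k ≡ r [MOD L] then (1 : ℝ) else 0) -
      (if k ≡ r' [MOD L] then (1 : ℝ) else 0))| ≤ 1 := by
  have h : ∀ r, ∑ k ∈ Finset.range n, (if k ≡ r [MOD L] then (1 : ℝ) else 0) =
      (n / L : ℕ) + if r % L < n % L then 1 else 0 := by
    intro r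
    rw [Finset.sum_boole, ← Nat.count_eq_card_filter_range, Nat.count_modEq_card n hL]
    push_cast
    rfl
  rw [Finset.sum_sub_distrib, h, h]
  split_ifs <;> simp

lemma abs_sum_mul_le_of_abs_sum_le {ρ G : ℕ → ℝ} {B : ℝ} (n : ℕ) (hρ : ∀ j, |∑ i ∈ Finset.range j, ρ i| ≤ B)
    (hG : G n = 0) :
    |∑ k ∈ Finset.range (n + 1), G k * ρ k| ≤ B * ∑ k ∈ Finset.range n, |G (k + 1) - G k| := by
  have h := Finset.sum_range_by_parts G ρ (n + 1)
  simp only [smul_eq_mul, Nat.add_sub_cancel, hG, zero_mul, zero_sub] at h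
  rw [h, abs_neg, Finset.mul_sum]
  refine (Finset.abs_sum_le_sum_abs _ _).trans (Finset.sum_le_sum fun i _ => ?_)
  rw [abs_mul, mul_comm]
  exact mul_le_mul_of_nonneg_right (hρ _) (abs_nonneg _)

lemma abs_sum_ite_resKer_le {K : ℕ} [NeZero K] {u : ZMod K} (hu : IsUnit u) {q : ℕ} (hq : q.Prime)
    (hqK : K.Coprime q) {m : ℕ} (hm : m.Coprime q) (n : ℕ) {G : ℕ → ℝ} (hG : G n = 0) :
    |∑ k ∈ Finset.range (n + 1), G k *
      (if ((m * k : ℕ) : ZMod K) = u then resKer q (m * k) else 0)| ≤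
      ∑ k ∈ Finset.range n, |G (k + 1) - G k| := by
  have : Fact q.Prime := ⟨hq⟩
  have hq1 : (1 : ℝ) < q := by exact_mod_cast hq.one_lt
  by_cases hmK : IsUnit (m : ZMod K)
  · have hmq : (m : ZMod q) ≠ 0 := by
      have := (ZMod.isUnit_iff_coprime m q).mpr hm
      exact this.ne_zero
    have hr : ∀ c : ZMod q, ∃ r : ℕ, ∀ k : ℕ, (((m * k : ℕ) : ZMod K) = u ∧
        ((m * k : ℕ) : ZMod q) = c) ↔ k ≡ r [MOD K * q] := by
      intro c
      obtain ⟨v, hv⟩ := hmK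
      obtain ⟨r, hr1, hr2⟩ := Nat.chineseRemainder hqK (((v⁻¹ : (ZMod K)ˣ) : ZMod K) * u).val
        ((m : ZMod q)⁻¹ * c).val
      refine ⟨r, fun k => ?_⟩
      rw [← Nat.modEq_and_modEq_iff_modEq_mul hqK, ← ZMod.natCast_eq_natCast_iff,
        ← ZMod.natCast_eq_natCast_iff]
      rw [← ZMod.natCast_eq_natCast_iff] at hr1 hr2
      rw [hr1, hr2, ZMod.natCast_zmod_val, ZMod.natCast_zmod_val]
      push_cast
      rw [Units.eq_inv_mul_iff_mul_eq, hv, eq_inv_mul_iff_mul_eq₀ hmq]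
    choose r hr using hr
    have hker : ∀ k, (if ((m * k : ℕ) : ZMod K) = u then resKer q (m * k) else 0) =
        1 / ((q : ℝ) - 1) * ∑ c ∈ Finset.univ.erase (0 : ZMod q),
          ((if k ≡ r 1 [MOD K * q] then (1 : ℝ) else 0) -
            (if k ≡ r c [MOD K * q] then (1 : ℝ) else 0)) := by
      intro k
      simp_rw [← hr]
      by_cases h : ((m * k : ℕ) : ZMod K) = u
      · simp only [h, true_and, if_true, resKer]
        rw [Finset.sum_sub_distrib, Finset.sum_const, Finset.card_erase_of_mem (Finset.mem_univ _),
          Finset.card_univ, ZMod.card, Finset.sum_ite_eq, nsmul_eq_mul, Nat.cast_sub hq.one_le]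
        have : (q : ℝ) - 1 ≠ 0 := by linarith
        generalize ((m * k : ℕ) : ZMod q) = x
        by_cases h0 : x = 0
        · simp only [h0, Finset.mem_erase]
          simp
        · simp only [h0, Finset.mem_erase, Finset.mem_univ, ne_eq, not_false_eq_true, and_self,
            if_true, if_false]
          split_ifs <;> field_simp <;> push_cast <;> ring
      · simp only [h, false_and, if_false, sub_zero, Finset.sum_const_zero, mul_zero]
    simp_rw [hker]
    have e : ∑ k ∈ Finset.range (n + 1), G k * (1 / ((q : ℝ) - 1) *
        ∑ c ∈ Finset.univ.erase (0 : ZMod q),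
          ((if k ≡ r 1 [MOD K * q] then (1 : ℝ) else 0) -
            (if k ≡ r c [MOD K * q] then (1 : ℝ) else 0))) =
        1 / ((q : ℝ) - 1) * ∑ c ∈ Finset.univ.erase (0 : ZMod q), ∑ k ∈ Finset.range (n + 1),
          G k * ((if k ≡ r 1 [MOD K * q] then (1 : ℝ) else 0) -
            (if k ≡ r c [MOD K * q] then (1 : ℝ) else 0)) := by
      rw [Finset.sum_comm, Finset.mul_sum]
      refine Finset.sum_congr rfl fun k _ => ?_
      rw [← Finset.mul_sum]
      ring
    rw [e, abs_mul, abs_of_pos (by apply one_div_pos.mpr; linarith)]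
    have hc : ∀ c ∈ Finset.univ.erase (0 : ZMod q), |∑ k ∈ Finset.range (n + 1),
          G k * ((if k ≡ r 1 [MOD K * q] then (1 : ℝ) else 0) -
            (if k ≡ r c [MOD K * q] then (1 : ℝ) else 0))| ≤
        ∑ k ∈ Finset.range n, |G (k + 1) - G k| := by
      intro c _
      have := abs_sum_mul_le_of_abs_sum_le n (fun j => abs_sum_ite_modEq_sub_le
        (Nat.mul_pos (NeZero.pos K) hq.pos) (r 1) (r c) j) hG
      rwa [one_mul] at this
    have hs := (Finset.abs_sum_le_sum_abs _ _).trans (Finset.sum_le_card_nsmul _ _ _ hc)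
    rw [Finset.card_erase_of_mem (Finset.mem_univ _),
          Finset.card_univ, ZMod.card, nsmul_eq_mul, Nat.cast_sub hq.one_le, Nat.cast_one] at hs
    rw [one_div_mul_eq_div, div_le_iff₀ (by linarith), mul_comm _ ((q : ℝ) - 1)]
    exact hs
  · have : ∀ k : ℕ, ((m * k : ℕ) : ZMod K) ≠ u := by
      intro k h
      push_cast at h
      exact hmK (isUnit_of_mul_isUnit_left (h ▸ hu))
    simp only [this, if_false, mul_zero, Finset.sum_const_zero, abs_zero]
    exact Finset.sum_nonneg fun _ _ => abs_nonneg _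

lemma logTri_zero {z : ℝ} (hz : 2 ≤ z) : logTri z 0 = 0 := by
  have h2 := half_log_two_pos
  have := Real.log_le_log two_pos hz
  apply max_eq_left
  rw [Real.log_zero, sub_nonpos, le_div_iff₀ h2]
  refine le_trans ?_ (neg_le_abs _)
  linarith

lemma logTri_eq_zero {z x : ℝ} (hz : 0 < z) (hx : z ≤ x) : logTri z x = 0 := by
  by_contra h
  have := mem_of_logTri_ne_zero hz (hz.trans_le hx) h
  linarith

lemma sum_abs_logTri_mul_sub_le {z : ℝ} (hz : 2 ≤ z) {m : ℕ} (hm : 1 ≤ m) (n : ℕ) {l : ℝ}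
    {b : ℕ → ℝ} (hb : ∀ k ≤ n, 1 ≤ k → |b k| ≤ l)
    (hb' : ∀ k, 1 ≤ k → |b (k + 1) - b k| ≤ Real.log ((k + 1 : ℕ) : ℝ) - Real.log k) (hn : 1 ≤ n) :
    ∑ k ∈ Finset.range n, |b (k + 1) * logTri z ((m * (k + 1) : ℕ) : ℝ) -
      b k * logTri z ((m * k : ℕ) : ℝ)| ≤ l + (l / (Real.log 2 / 2) + 1) * Real.log n := by
  have h2 := half_log_two_pos
  have hl : 0 ≤ l := (abs_nonneg _).trans (hb n le_rfl hn)
  obtain ⟨n, rfl⟩ : ∃ n', n = n' + 1 := ⟨n - 1, by omega⟩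
  rw [Finset.sum_range_succ', add_comm]
  refine add_le_add ?_ ?_
  · simp only [mul_zero, Nat.cast_zero, logTri_zero hz, sub_zero, abs_mul]
    refine (mul_le_mul ?_ ?_ (abs_nonneg _) hl).trans_eq (mul_one l)
    · exact hb _ (by omega) (by omega)
    · rw [abs_of_nonneg (logTri_nonneg _ _)]
      exact logTri_le_one _ _
  · have e : (l / (Real.log 2 / 2) + 1) * Real.log ((n + 1 : ℕ) : ℝ) = ∑ k ∈ Finset.range n,
        (l / (Real.log 2 / 2) + 1) * (Real.log ((k + 1 + 1 : ℕ) : ℝ) - Real.log ((k + 1 : ℕ) : ℝ)) := by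
      rw [← Finset.mul_sum, Finset.sum_range_sub (fun k => Real.log ((k + 1 : ℕ) : ℝ))]
      simp
    rw [e]
    refine Finset.sum_le_sum fun k hk => ?_
    rw [Finset.mem_range] at hk
    have hd : 0 ≤ Real.log ((k + 1 + 1 : ℕ) : ℝ) - Real.log ((k + 1 : ℕ) : ℝ) := by
      rw [sub_nonneg]
      apply Real.log_le_log (by positivity)
      exact_mod_cast Nat.le_succ _
    have h3 := abs_logTri_sub_le z ((m * (k + 1 + 1) : ℕ) : ℝ) ((m * (k + 1) : ℕ) : ℝ)
    have hm0 : (m : ℝ) ≠ 0 := by positivity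
    rw [Nat.cast_mul, Nat.cast_mul, Real.log_mul hm0 (by positivity),
      Real.log_mul hm0 (by positivity), add_sub_add_left_eq_sub, abs_of_nonneg hd] at h3
    calc _ = |b (k + 1 + 1) * (logTri z ((m * (k + 1 + 1) : ℕ) : ℝ) - logTri z ((m * (k + 1) : ℕ) : ℝ))
          + (b (k + 1 + 1) - b (k + 1)) * logTri z ((m * (k + 1) : ℕ) : ℝ)| := by
          congr 1
          ring
      _ ≤ |b (k + 1 + 1)| * |logTri z ((m * (k + 1 + 1) : ℕ) : ℝ) - logTri z ((m * (k + 1) : ℕ) : ℝ)|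
          + |b (k + 1 + 1) - b (k + 1)| * |logTri z ((m * (k + 1) : ℕ) : ℝ)| := by
          rw [← abs_mul, ← abs_mul]
          exact abs_add_le _ _
      _ ≤ l * ((Real.log ((k + 1 + 1 : ℕ) : ℝ) - Real.log ((k + 1 : ℕ) : ℝ)) / (Real.log 2 / 2)) +
          (Real.log ((k + 1 + 1 : ℕ) : ℝ) - Real.log ((k + 1 : ℕ) : ℝ)) * 1 := by
          push_cast at h3 ⊢
          refine add_le_add (mul_le_mul (hb _ (by omega) (by omega)) h3 (abs_nonneg _) hl) ?_
          have h4 := hb' (k + 1) (by omega)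
          push_cast at h4 hd
          refine mul_le_mul h4 ?_ (abs_nonneg _) hd
          rw [abs_of_nonneg (logTri_nonneg _ _)]
          exact logTri_le_one _ _
      _ = _ := by ring

/-- Sums over short ranges times smooth sequences have small discrepancy for each prime modulus. -/
theorem sum_abs_smooth_logTri_le {P : Finset ℕ} {Q₂ : ℝ}
    (hP : ∀ q ∈ P, q.Prime) (hP₂ : ∀ q ∈ P, (q : ℝ) ≤ Q₂) (hQ₂ : 0 ≤ Q₂)
    {z D Γ l : ℝ} (hz : 2 ≤ z) (hD : 0 ≤ D) (hΓ : 0 ≤ Γ) {K : ℕ} [NeZero K]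
    (hPD : ∀ q ∈ P, D < q) (hPK : ∀ q ∈ P, K < q)
    {a b : ℕ → ℝ} (ha : ∀ m : ℕ, (m : ℝ) ≤ D → |a m| ≤ Γ) (haD : ∀ m : ℕ, D < (m : ℝ) → a m = 0)
    (hb : ∀ k ≤ ⌊z⌋₊ + 1, 1 ≤ k → |b k| ≤ l)
    (hb' : ∀ k, 1 ≤ k → |b (k + 1) - b k| ≤ Real.log ((k + 1 : ℕ) : ℝ) - Real.log k)
    {u : ZMod K} (hu : IsUnit u) :
    ∑ q ∈ P, |∑ m ∈ Finset.Icc 1 ⌊z⌋₊, ∑ k ∈ Finset.Icc 1 ⌊z⌋₊, a m * b k *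
        ((if ((m * k : ℕ) : ZMod K) = u then resKer q (m * k) else 0) *
          logTri z ((m * k : ℕ) : ℝ))| ≤
      Q₂ * (D * (Γ * (l + (l / (Real.log 2 / 2) + 1) * Real.log (⌊z⌋₊ + 1 : ℕ)))) := by
  have hz0 : 0 < z := by linarith
  set N := ⌊z⌋₊ with hN
  have h2 := half_log_two_pos
  have hl : 0 ≤ l := (abs_nonneg _).trans (hb 1 (by omega) le_rfl)
  set T := l + (l / (Real.log 2 / 2) + 1) * Real.log (N + 1 : ℕ) with hT
  have hlN : 0 ≤ Real.log (N + 1 : ℕ) := Real.log_natCast_nonneg _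
  have hT0 : 0 ≤ T := by positivity
  have hin : ∀ q ∈ P, ∀ m ∈ Finset.Icc 1 N, |∑ k ∈ Finset.Icc 1 N, a m * b k *
        ((if ((m * k : ℕ) : ZMod K) = u then resKer q (m * k) else 0) *
          logTri z ((m * k : ℕ) : ℝ))| ≤ if m ∈ Finset.Icc 1 ⌊D⌋₊ then Γ * T else 0 := by
    intro q hq m hm
    rw [Finset.mem_Icc] at hm
    by_cases hmD : D < m
    · have : ∀ k, a m * b k *
        ((if ((m * k : ℕ) : ZMod K) = u then resKer q (m * k) else 0) *
          logTri z ((m * k : ℕ) : ℝ)) = 0 := by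
        intro k
        rw [haD m hmD]
        ring
      simp only [this, Finset.sum_const_zero, abs_zero]
      split_ifs
      · positivity
      · exact le_rfl
    · rw [not_lt] at hmD
      rw [if_pos (Finset.mem_Icc.mpr ⟨hm.1, Nat.le_floor hmD⟩)]
      set G : ℕ → ℝ := fun k => b k * logTri z ((m * k : ℕ) : ℝ) with hG
      have hG0 : G 0 = 0 := by simp [hG, logTri_zero hz]
      have hGN : G (N + 1) = 0 := by
        rw [hG]
        simp only
        rw [logTri_eq_zero hz0, mul_zero]
        have h1 : z ≤ ((N + 1 : ℕ) : ℝ) := by push_cast; exact (Nat.lt_floor_add_one z).le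
        refine h1.trans ?_
        exact_mod_cast Nat.le_mul_of_pos_left _ hm.1
      have e : ∑ k ∈ Finset.Icc 1 N, a m * b k *
        ((if ((m * k : ℕ) : ZMod K) = u then resKer q (m * k) else 0) *
          logTri z ((m * k : ℕ) : ℝ)) = a m * ∑ k ∈ Finset.range (N + 1 + 1), G k *
          (if ((m * k : ℕ) : ZMod K) = u then resKer q (m * k) else 0) := by
        rw [Finset.sum_range_succ, hGN, zero_mul, add_zero, Finset.range_eq_Ico,
          Finset.sum_eq_sum_Ico_succ_bot (Nat.succ_pos N), hG0, zero_mul, zero_add, Finset.mul_sum]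
        refine Finset.sum_congr rfl fun k _ => ?_
        rw [hG]
        ring
      have hmq : m < q := by
        have := hPD q hq
        exact_mod_cast hmD.trans_lt this
      have hm1 : m.Coprime q := (Nat.coprime_of_lt_prime (by omega) hmq (hP q hq)).symm
      have hK1 : K.Coprime q := (Nat.coprime_of_lt_prime (NeZero.ne K) (hPK q hq) (hP q hq)).symm
      rw [e, abs_mul]
      refine mul_le_mul (ha m hmD) ?_ (abs_nonneg _) hΓ
      refine (abs_sum_ite_resKer_le hu (hP q hq) hK1 hm1 (N + 1) hGN).trans ?_
      exact sum_abs_logTri_mul_sub_le hz hm.1 (N + 1) hb hb' (by omega)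
  have hq : ∀ q ∈ P, |∑ m ∈ Finset.Icc 1 N, ∑ k ∈ Finset.Icc 1 N, a m * b k *
        ((if ((m * k : ℕ) : ZMod K) = u then resKer q (m * k) else 0) *
          logTri z ((m * k : ℕ) : ℝ))| ≤ D * (Γ * T) := by
    intro q hq
    refine (Finset.abs_sum_le_sum_abs _ _).trans ((Finset.sum_le_sum (hin q hq)).trans ?_)
    rw [← Finset.sum_filter, Finset.sum_const, nsmul_eq_mul]
    refine mul_le_mul_of_nonneg_right ?_ (by positivity)
    have : ((Finset.Icc 1 N).filter (· ∈ Finset.Icc 1 ⌊D⌋₊)).card ≤ ⌊D⌋₊ := by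
      refine (Finset.card_le_card (t := Finset.Icc 1 ⌊D⌋₊) fun x hx => (Finset.mem_filter.mp hx).2).trans ?_
      simp
    calc _ ≤ (⌊D⌋₊ : ℝ) := by exact_mod_cast this
      _ ≤ D := Nat.floor_le hD
  refine (Finset.sum_le_card_nsmul _ _ _ hq).trans ?_
  rw [nsmul_eq_mul]
  refine mul_le_mul_of_nonneg_right ?_ (by positivity)
  have : P ⊆ Finset.Icc 1 ⌊Q₂⌋₊ := fun q hq =>
    Finset.mem_Icc.mpr ⟨(hP q hq).one_le, Nat.le_floor (hP₂ q hq)⟩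
  have := Finset.card_le_card this
  rw [Nat.card_Icc, Nat.add_sub_cancel] at this
  calc _ ≤ (⌊Q₂⌋₊ : ℝ) := by exact_mod_cast this
    _ ≤ Q₂ := Nat.floor_le hQ₂

end TypeI

section Vaughan

open ArithmeticFunction in
/-- The restriction of an arithmetic function to `[1, X]`. -/
noncomputable def arithTrunc (X : ℝ) (f : ArithmeticFunction ℝ) : ArithmeticFunction ℝ :=
  ⟨fun n => if (n : ℝ) ≤ X then f n else 0, by simp⟩

lemma arithTrunc_apply (X : ℝ) (f : ArithmeticFunction ℝ) (n : ℕ) :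
    arithTrunc X f n = if (n : ℝ) ≤ X then f n else 0 := rfl

lemma arith_sub_apply (f g : ArithmeticFunction ℝ) (n : ℕ) : (f - g) n = f n - g n := rfl

lemma sum_arith_mul (f g : ArithmeticFunction ℝ) (F : ℕ → ℝ) (N : ℕ) (hF : ∀ n, N < n → F n = 0) :
    ∑ n ∈ Finset.Icc 1 N, (f * g) n * F n =
      ∑ m ∈ Finset.Icc 1 N, ∑ k ∈ Finset.Icc 1 N, f m * g k * F (m * k) := by
  rw [← Finset.sum_product']
  have hmap : ∀ x ∈ Finset.Icc 1 N ×ˢ Finset.Icc 1 N, x.1 * x.2 ∈ Finset.Icc 1 (N * N) := by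
    intro x hx
    simp only [Finset.mem_product, Finset.mem_Icc] at hx ⊢
    exact ⟨Nat.mul_pos hx.1.1 hx.2.1, Nat.mul_le_mul hx.1.2 hx.2.2⟩
  rw [← Finset.sum_fiberwise_of_maps_to hmap]
  have hsub : Finset.Icc 1 N ⊆ Finset.Icc 1 (N * N) := by
    refine Finset.Icc_subset_Icc_right ?_
    exact Nat.le_mul_self N
  rw [← Finset.sum_subset hsub]
  · refine Finset.sum_congr rfl fun n hn => ?_
    rw [Finset.mem_Icc] at hn
    rw [ArithmeticFunction.mul_apply, Finset.sum_mul]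
    refine Finset.sum_congr ?_ fun x hx => ?_
    · ext x
      simp only [Nat.mem_divisorsAntidiagonal, Finset.mem_filter, Finset.mem_product,
        Finset.mem_Icc]
      constructor
      · rintro ⟨h, h0⟩
        have h1 : x.1 ≠ 0 := by rintro h1; simp [h1] at h; omega
        have h2 : x.2 ≠ 0 := by rintro h1; simp [h1] at h; omega
        have h3 : x.1 ≤ n := h ▸ Nat.le_mul_of_pos_right _ (Nat.pos_of_ne_zero h2)
        have h4 : x.2 ≤ n := h ▸ Nat.le_mul_of_pos_left _ (Nat.pos_of_ne_zero h1)
        exact ⟨⟨⟨by omega, by omega⟩, by omega, by omega⟩, h⟩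
      · rintro ⟨-, h⟩
        exact ⟨h, by omega⟩
    · rw [(Finset.mem_filter.mp hx).2]
  · intro n _ hn
    refine Finset.sum_eq_zero fun x hx => ?_
    rw [Finset.mem_filter] at hx
    have := hmap x hx.1
    rw [Finset.mem_Icc] at hn this
    rw [hx.2, hF n (by omega), mul_zero]

open ArithmeticFunction in
lemma vonMangoldt_eq_vaughan (W : ℝ) :
    vonMangoldt = arithTrunc W vonMangoldt +
      arithTrunc W (moebius : ArithmeticFunction ℝ) * ArithmeticFunction.log -
      (arithTrunc W (moebius : ArithmeticFunction ℝ) * arithTrunc W vonMangoldt) *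
        (zeta : ArithmeticFunction ℝ) +
      ((moebius : ArithmeticFunction ℝ) - arithTrunc W (moebius : ArithmeticFunction ℝ)) *
        ((zeta : ArithmeticFunction ℝ) * (vonMangoldt - arithTrunc W vonMangoldt)) := by
  have h1 : (moebius : ArithmeticFunction ℝ) * (zeta : ArithmeticFunction ℝ) = 1 :=
    coe_moebius_mul_coe_zeta
  have h2 : vonMangoldt * (zeta : ArithmeticFunction ℝ) = ArithmeticFunction.log :=
    vonMangoldt_mul_zeta
  rw [← h2]
  linear_combination (arithTrunc W vonMangoldt - vonMangoldt) * h1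

lemma abs_moebius_cast_le (n : ℕ) :
    |((ArithmeticFunction.moebius : ArithmeticFunction ℝ) : ArithmeticFunction ℝ) n| ≤ 1 := by
  rw [ArithmeticFunction.intCoe_apply]
  exact_mod_cast ArithmeticFunction.abs_moebius_le_one

lemma abs_arithTrunc_moebius_mul_le (W : ℝ) (n : ℕ) :
    |(arithTrunc W (ArithmeticFunction.moebius : ArithmeticFunction ℝ) *
      arithTrunc W ArithmeticFunction.vonMangoldt) n| ≤ Real.log n := by
  rw [← ArithmeticFunction.log_apply, ← ArithmeticFunction.zeta_mul_vonMangoldt,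
    ArithmeticFunction.mul_apply, ArithmeticFunction.mul_apply]
  refine (Finset.abs_sum_le_sum_abs _ _).trans (Finset.sum_le_sum fun x hx => ?_)
  rw [abs_mul]
  have h1 : x.1 ≠ 0 := (Nat.ne_zero_of_mem_divisorsAntidiagonal hx).1
  have h2 : ((ArithmeticFunction.zeta : ArithmeticFunction ℝ)) x.1 = 1 := by
    rw [ArithmeticFunction.natCoe_apply, ArithmeticFunction.zeta_apply, if_neg h1, Nat.cast_one]
  rw [h2]
  refine mul_le_mul ?_ ?_ (abs_nonneg _) zero_le_one
  · rw [arithTrunc_apply]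
    split_ifs
    · exact abs_moebius_cast_le _
    · simp
  · rw [arithTrunc_apply]
    split_ifs
    · rw [abs_of_nonneg ArithmeticFunction.vonMangoldt_nonneg]
    · simp [ArithmeticFunction.vonMangoldt_nonneg]

lemma arithTrunc_mul_eq_zero {W : ℝ} (hW : 0 ≤ W) (f g : ArithmeticFunction ℝ) {n : ℕ}
    (hn : W ^ 2 < n) : (arithTrunc W f * arithTrunc W g) n = 0 := by
  rw [ArithmeticFunction.mul_apply]
  refine Finset.sum_eq_zero fun x hx => ?_
  rw [arithTrunc_apply, arithTrunc_apply]
  by_cases h1 : (x.1 : ℝ) ≤ W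
  · by_cases h2 : (x.2 : ℝ) ≤ W
    · have h3 := (Nat.mem_divisorsAntidiagonal.mp hx).1
      have : (n : ℝ) = x.1 * x.2 := by exact_mod_cast h3.symm
      rw [this] at hn
      have := mul_le_mul h1 h2 (Nat.cast_nonneg _) hW
      nlinarith
    · rw [if_neg h2, mul_zero]
  · rw [if_neg h1, zero_mul]

lemma abs_zeta_mul_sub_arithTrunc_le (W : ℝ) (n : ℕ) :
    |((ArithmeticFunction.zeta : ArithmeticFunction ℝ) *
      (ArithmeticFunction.vonMangoldt - arithTrunc W ArithmeticFunction.vonMangoldt)) n| ≤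
      Real.log n := by
  rw [← ArithmeticFunction.log_apply, ← ArithmeticFunction.zeta_mul_vonMangoldt,
    ArithmeticFunction.mul_apply, ArithmeticFunction.mul_apply]
  refine (Finset.abs_sum_le_sum_abs _ _).trans (Finset.sum_le_sum fun x hx => ?_)
  have h1 : x.1 ≠ 0 := (Nat.ne_zero_of_mem_divisorsAntidiagonal hx).1
  have h2 : ((ArithmeticFunction.zeta : ArithmeticFunction ℝ)) x.1 = 1 := by
    rw [ArithmeticFunction.natCoe_apply, ArithmeticFunction.zeta_apply, if_neg h1, Nat.cast_one]
  rw [h2, one_mul, one_mul, arith_sub_apply, arithTrunc_apply]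
  split_ifs
  · simp [ArithmeticFunction.vonMangoldt_nonneg]
  · rw [sub_zero, abs_of_nonneg ArithmeticFunction.vonMangoldt_nonneg]

lemma zeta_mul_sub_arithTrunc_eq_zero {W : ℝ} {n : ℕ} (hn : (n : ℝ) ≤ W) :
    ((ArithmeticFunction.zeta : ArithmeticFunction ℝ) *
      (ArithmeticFunction.vonMangoldt - arithTrunc W ArithmeticFunction.vonMangoldt)) n = 0 := by
  rw [ArithmeticFunction.mul_apply]
  refine Finset.sum_eq_zero fun x hx => ?_
  have h2 : (x.2 : ℝ) ≤ W := by
    refine le_trans ?_ hn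
    have := Nat.mem_divisorsAntidiagonal.mp hx
    exact_mod_cast Nat.le_of_dvd (Nat.pos_of_ne_zero this.2) ⟨x.1, by rw [← this.1, mul_comm]⟩
  rw [arith_sub_apply, arithTrunc_apply, if_pos h2, sub_self, mul_zero]

/-- Discrepancy of the von Mangoldt function at the residue `1`, on average over prime moduli in
a short block. -/
lemma sum_abs_vonMangoldt_resKer_le {P : Finset ℕ} {Q₁ Q₂ : ℝ} (hQ₁ : 0 < Q₁)
    (hP : ∀ q ∈ P, q.Prime)
    (hP₁ : ∀ q ∈ P, Q₁ ≤ q) (hP₂ : ∀ q ∈ P, (q : ℝ) ≤ Q₂) (hQ₂ : 2 ≤ Q₂)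
    {z W : ℝ} (hz : 2 ≤ z) (hW : 1 ≤ W) (hWz : W ≤ z / 2) (hWQ : W ^ 2 < Q₁)
    {K : ℕ} [NeZero K] (hK : (K : ℝ) < Q₁) {u : ZMod K} (hu : IsUnit u) :
    ∑ q ∈ P, |∑ n ∈ Finset.Icc 1 ⌊z⌋₊, ArithmeticFunction.vonMangoldt n *
        ((if (n : ZMod K) = u then resKer q n else 0) * logTri z n)| ≤
      Q₂ * (W * (1 * (Real.log (⌊z⌋₊ + 1 : ℕ) + (Real.log (⌊z⌋₊ + 1 : ℕ) / (Real.log 2 / 2) + 1) *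
        Real.log (⌊z⌋₊ + 1 : ℕ)))) +
      Q₂ * (W ^ 2 * (Real.log (W ^ 2) * (1 + (1 / (Real.log 2 / 2) + 1) *
        Real.log (⌊z⌋₊ + 1 : ℕ)))) +
      (Real.log z + 1) / (Real.log 2 / 2) * (K * (largeSieveConst / Q₁ *
        (Real.log z * (z + 2 * (z * Q₂ / √W) + 2 * (√z * Q₂ ^ 2))))) := by
  have hz0 : 0 < z := by linarith
  have hW0 : 0 < W := by linarith
  set F : ℕ → ℕ → ℝ := fun q n => (if (n : ZMod K) = u then resKer q n else 0) * logTri z n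
    with hF
  have hFN : ∀ q n, ⌊z⌋₊ < n → F q n = 0 := by
    intro q n hn
    rw [hF]
    simp only
    rw [logTri_eq_zero hz0 (Nat.lt_of_floor_lt hn).le, mul_zero]
  set M := arithTrunc W (ArithmeticFunction.moebius : ArithmeticFunction ℝ) with hM
  set A := arithTrunc W ArithmeticFunction.vonMangoldt with hA
  set M' := (ArithmeticFunction.moebius : ArithmeticFunction ℝ) - M with hM'
  set B := (ArithmeticFunction.zeta : ArithmeticFunction ℝ) *
    (ArithmeticFunction.vonMangoldt - A) with hB
  have hlam : ∀ n, ArithmeticFunction.vonMangoldt n = A n + (M * ArithmeticFunction.log) n -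
      (M * A * (ArithmeticFunction.zeta : ArithmeticFunction ℝ)) n + (M' * B) n := by
    intro n
    conv_lhs => rw [vonMangoldt_eq_vaughan W]
    rfl
  have hAF : ∀ q n, 1 ≤ n → A n * F q n = 0 := by
    intro q n hn
    rw [hA, arithTrunc_apply]
    split_ifs with h
    · by_cases h0 : logTri z n = 0
      · rw [hF]
        simp only
        rw [h0, mul_zero, mul_zero]
      · have := mem_of_logTri_ne_zero hz0 (by exact_mod_cast hn) h0
        linarith [this.1]
    · rw [zero_mul]
  have hsplit : ∀ q, ∑ n ∈ Finset.Icc 1 ⌊z⌋₊, ArithmeticFunction.vonMangoldt n * F q n =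
      ∑ m ∈ Finset.Icc 1 ⌊z⌋₊, ∑ k ∈ Finset.Icc 1 ⌊z⌋₊, M m * ArithmeticFunction.log k * F q (m * k) -
      ∑ m ∈ Finset.Icc 1 ⌊z⌋₊, ∑ k ∈ Finset.Icc 1 ⌊z⌋₊,
        (M * A) m * (ArithmeticFunction.zeta : ArithmeticFunction ℝ) k * F q (m * k) +
      ∑ m ∈ Finset.Icc 1 ⌊z⌋₊, ∑ k ∈ Finset.Icc 1 ⌊z⌋₊, M' m * B k * F q (m * k) := by
    intro q
    rw [← sum_arith_mul _ _ (F q) _ (hFN q), ← sum_arith_mul _ _ (F q) _ (hFN q),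
      ← sum_arith_mul _ _ (F q) _ (hFN q), ← Finset.sum_sub_distrib, ← Finset.sum_add_distrib]
    refine Finset.sum_congr rfl fun n hn => ?_
    have := hAF q n (Finset.mem_Icc.mp hn).1
    rw [hlam n]
    linear_combination this
  have hPD : ∀ q ∈ P, W ^ 2 < q := fun q hq => hWQ.trans_le (hP₁ q hq)
  have hPW : ∀ q ∈ P, W < q := fun q hq => lt_of_le_of_lt (by nlinarith) (hPD q hq)
  have hPK : ∀ q ∈ P, K < q := fun q hq => by exact_mod_cast hK.trans_le (hP₁ q hq)
  have hMle : ∀ n, |M n| ≤ 1 := by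
    intro n
    rw [hM, arithTrunc_apply]
    split_ifs
    · exact abs_moebius_cast_le _
    · simp
  have t1 := sum_abs_smooth_logTri_le hP hP₂ (by linarith) hz hW0.le zero_le_one hPW hPK
    (a := M) (b := ArithmeticFunction.log) (l := Real.log (⌊z⌋₊ + 1 : ℕ)) (fun m _ => hMle m)
    (fun m hm => by rw [hM, arithTrunc_apply, if_neg (not_le.mpr hm)])
    (fun k hk hk1 => by
      rw [ArithmeticFunction.log_apply, abs_of_nonneg (Real.log_natCast_nonneg _)]
      exact Real.log_le_log (by exact_mod_cast hk1) (by exact_mod_cast hk))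
    (fun k hk1 => by
      rw [ArithmeticFunction.log_apply, ArithmeticFunction.log_apply, abs_of_nonneg]
      rw [sub_nonneg]
      exact Real.log_le_log (by exact_mod_cast hk1) (by exact_mod_cast Nat.le_succ _)) hu
  have hz1 : ∀ k : ℕ, 1 ≤ k → (ArithmeticFunction.zeta : ArithmeticFunction ℝ) k = 1 := by
    intro k hk
    rw [ArithmeticFunction.natCoe_apply, ArithmeticFunction.zeta_apply, if_neg (by omega),
      Nat.cast_one]
  have t2 := sum_abs_smooth_logTri_le hP hP₂ (by linarith) hz (sq_nonneg W)
    (Γ := Real.log (W ^ 2)) (Real.log_nonneg (by nlinarith)) hPD hPK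
    (a := fun n => (M * A) n) (b := (ArithmeticFunction.zeta : ArithmeticFunction ℝ)) (l := 1) (fun m hm => by
      refine (abs_arithTrunc_moebius_mul_le W m).trans ?_
      rcases Nat.eq_zero_or_pos m with rfl | h0
      · simpa using Real.log_nonneg (by nlinarith)
      · exact Real.log_le_log (by exact_mod_cast h0) hm)
    (fun m hm => arithTrunc_mul_eq_zero hW0.le _ _ hm)
    (fun k hk hk1 => by rw [hz1 k hk1, abs_one])
    (fun k hk1 => by
      rw [hz1 k hk1, hz1 (k + 1) (by omega), sub_self, abs_zero, sub_nonneg]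
      exact Real.log_le_log (by exact_mod_cast hk1) (by exact_mod_cast Nat.le_succ _)) hu
  have t3 := sum_abs_bilinear_logTri_le hQ₁ hP hP₁ hP₂ hQ₂ hz hW
    (Real.log_nonneg (by linarith : (1:ℝ) ≤ z)) (a := M') (b := B) (fun m => by
      rw [hM', arith_sub_apply, hM, arithTrunc_apply]
      split_ifs
      · simp
      · rw [sub_zero]; exact abs_moebius_cast_le _)
    (fun m hm => by
      rw [hM', arith_sub_apply, hM, arithTrunc_apply, if_pos hm, sub_self])
    (fun k hk => by
      refine (abs_zeta_mul_sub_arithTrunc_le W k).trans ?_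
      rcases Nat.eq_zero_or_pos k with rfl | h0
      · simpa using Real.log_nonneg (by linarith)
      · exact Real.log_le_log (by exact_mod_cast h0) hk)
    (fun k hk => zeta_mul_sub_arithTrunc_eq_zero hk) K u
  refine le_trans ?_ (add_le_add (add_le_add t1 t2) t3)
  rw [← Finset.sum_add_distrib, ← Finset.sum_add_distrib]
  refine Finset.sum_le_sum fun q _ => ?_
  have hs := hsplit q
  rw [hF] at hs
  simp only at hs
  rw [hs]
  refine (abs_add_le _ _).trans (add_le_add (abs_sub _ _) le_rfl)

end Vaughan

section VaughanAsymptotic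

set_option maxHeartbeats 800000 in
lemma exists_block_const {K : ℕ} [NeZero K] {u : ZMod K} (hu : IsUnit u) {δ α : ℝ} (hδ : 0 < δ)
    (hδ' : δ ≤ 1 / 100) (hα : 2 / 5 ≤ α) (hα' : α ≤ 1 / 2 - 3 * δ / 2) :
    ∃ C : ℝ, ∀ᶠ z : ℝ in Filter.atTop, ∀ P : Finset ℕ,
      (∀ q ∈ P, q.Prime ∧ z ^ α ≤ (q : ℝ) ∧ (q : ℝ) ≤ z ^ (α + δ / 2)) →
      ∑ q ∈ P, |∑ n ∈ Finset.Icc 1 ⌊z⌋₊, ArithmeticFunction.vonMangoldt n *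
        ((if (n : ZMod K) = u then resKer q n else 0) * logTri z n)| ≤
        C * (Real.log z ^ 2 * z ^ (1 - δ / 2)) := by
  set h := Real.log 2 / 2 with hh
  have hh0 : 0 < h := half_log_two_pos
  have hc := largeSieveConst_nonneg
  refine ⟨(4 + 4 / h) + (3 + 2 / h) + 10 * K * largeSieveConst / h, ?_⟩
  have hα0 : 0 < α := by linarith
  filter_upwards [Filter.eventually_ge_atTop 4, Filter.eventually_ge_atTop (Real.exp 1),
    (tendsto_rpow_atTop hα0).eventually_ge_atTop 2,
    (tendsto_rpow_atTop hα0).eventually_gt_atTop (K : ℝ)] with z hz4 hze hz2 hzK P hP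
  have hz0 : 0 < z := by linarith
  have hz1 : 1 ≤ z := by linarith
  set l := Real.log z with hl
  have hl1 : 1 ≤ l := by
    rw [hl, Real.le_log_iff_exp_le hz0]
    exact hze
  have hexp : ∀ {x y : ℝ}, x ≤ y → z ^ x ≤ z ^ y := fun h => Real.rpow_le_rpow_of_exponent_le hz1 h
  set Q₁ := z ^ α with hQ₁
  set Q₂ := z ^ (α + δ / 2) with hQ₂
  set W := z ^ (1 / 10 : ℝ) with hW
  set Y := z ^ (1 - δ / 2) with hY
  have hQ₁0 : 0 < Q₁ := by positivity
  have hQ₂0 : 0 < Q₂ := by positivity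
  have hW0 : 0 < W := by positivity
  have hY0 : 0 < Y := by positivity
  have hW1 : 1 ≤ W := Real.one_le_rpow hz1 (by norm_num)
  have hW2 : W ^ 2 = z ^ (1 / 5 : ℝ) := by
    rw [hW, ← Real.rpow_natCast, ← Real.rpow_mul hz0.le]
    norm_num
  have hWz : W ≤ z / 2 := by
    have h1 : W ≤ √z := by
      rw [Real.sqrt_eq_rpow]
      exact hexp (by norm_num)
    have h2 : √z ^ 2 = z := Real.sq_sqrt hz0.le
    have h3 : 2 ≤ √z := Real.le_sqrt_of_sq_le (by linarith)
    nlinarith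
  have hWQ : W ^ 2 < Q₁ := by
    rw [hW2]
    exact Real.rpow_lt_rpow_of_exponent_lt (by linarith) (by linarith)
  have main := sum_abs_vonMangoldt_resKer_le hQ₁0 (fun q hq => (hP q hq).1)
    (fun q hq => (hP q hq).2.1) (fun q hq => (hP q hq).2.2) (hz2.trans (hexp (by linarith)))
    (by linarith) hW1 hWz hWQ hzK hu
  refine main.trans ?_
  rw [← hh, ← hl]
  set ℓ := Real.log (⌊z⌋₊ + 1 : ℕ) with hℓ
  have hℓ0 : 0 ≤ ℓ := Real.log_natCast_nonneg _
  have hℓ2 : ℓ ≤ 2 * l := by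
    rw [hℓ, hl, ← Real.log_rpow hz0]
    refine Real.log_le_log (by positivity) ?_
    push_cast
    have := Nat.floor_le hz0.le
    have h2 : z ^ (2 : ℝ) = z ^ 2 := by exact_mod_cast Real.rpow_natCast z 2
    rw [h2]
    nlinarith
  have b1 : Q₂ * W ≤ Y := by
    rw [hQ₂, hW, ← Real.rpow_add hz0]
    exact hexp (by linarith)
  have b2 : Q₂ * W ^ 2 ≤ Y := by
    rw [hQ₂, hW2, ← Real.rpow_add hz0]
    exact hexp (by linarith)
  have b3 : z / Q₁ ≤ Y := by
    rw [hQ₁]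
    nth_rewrite 1 [← Real.rpow_one z]
    rw [← Real.rpow_sub hz0]
    exact hexp (by linarith)
  have b4 : z * Q₂ / √W / Q₁ ≤ Y := by
    rw [hQ₁, Real.sqrt_eq_rpow, hW, hQ₂, ← Real.rpow_mul hz0.le]
    nth_rewrite 1 [← Real.rpow_one z]
    rw [← Real.rpow_add hz0, ← Real.rpow_sub hz0, ← Real.rpow_sub hz0]
    exact hexp (by linarith)
  have b5 : √z * Q₂ ^ 2 / Q₁ ≤ Y := by
    rw [hQ₁, Real.sqrt_eq_rpow, hQ₂, ← Real.rpow_natCast (z ^ (α + δ / 2)), ← Real.rpow_mul hz0.le,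
      ← Real.rpow_add hz0, ← Real.rpow_sub hz0]
    exact hexp (by push_cast; linarith)
  have hll : l ≤ l ^ 2 := le_self_pow₀ hl1 two_ne_zero
  have hℓℓ : ℓ ^ 2 ≤ 4 * l ^ 2 := (pow_le_pow_left₀ hℓ0 hℓ2 2).trans_eq (by ring)
  have T1 : Q₂ * (W * (1 * (ℓ + (ℓ / h + 1) * ℓ))) ≤ Y * ((4 + 4 / h) * l ^ 2) := by
    rw [one_mul, ← mul_assoc]
    refine mul_le_mul b1 ?_ (by positivity) hY0.le
    have e1 : ℓ + (ℓ / h + 1) * ℓ = 2 * ℓ + ℓ ^ 2 / h := by ring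
    have e2 : (4 + 4 / h) * l ^ 2 = 4 * l ^ 2 + 4 * l ^ 2 / h := by ring
    rw [e1, e2]
    refine add_le_add (by linarith) (by gcongr)
  have T2 : Q₂ * (W ^ 2 * (Real.log (W ^ 2) * (1 + (1 / h + 1) * ℓ))) ≤
      Y * ((3 + 2 / h) * l ^ 2) := by
    rw [← mul_assoc]
    have e0 : Real.log (W ^ 2) = 1 / 5 * l := by rw [hW2, Real.log_rpow hz0]
    refine mul_le_mul b2 ?_ (by rw [e0]; positivity) hY0.le
    rw [e0]
    calc 1 / 5 * l * (1 + (1 / h + 1) * ℓ) ≤ l * (l + (1 / h + 1) * (2 * l)) := by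
          have : 1 / 5 * l ≤ l := by linarith
          gcongr
      _ = _ := by ring
  have T3 : (l + 1) / h * (K * (largeSieveConst / Q₁ *
        (l * (z + 2 * (z * Q₂ / √W) + 2 * (√z * Q₂ ^ 2))))) ≤
      Y * (10 * K * largeSieveConst / h * l ^ 2) := by
    have e1 : (l + 1) / h * (K * (largeSieveConst / Q₁ *
        (l * (z + 2 * (z * Q₂ / √W) + 2 * (√z * Q₂ ^ 2))))) =
        (K * largeSieveConst / h) * ((l + 1) * l) * (z / Q₁ + 2 * (z * Q₂ / √W / Q₁) +
          2 * (√z * Q₂ ^ 2 / Q₁)) := by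
      ring
    rw [e1]
    calc _ ≤ (K * largeSieveConst / h) * ((l + l) * l) * (Y + 2 * Y + 2 * Y) := by gcongr
      _ = _ := by ring
  calc _ ≤ _ := add_le_add (add_le_add T1 T2) T3
    _ = _ := by ring

/-- A Bombieri–Vinogradov type estimate for the residue `1` modulo primes slightly below
`z ^ (1 / 2)`. -/
theorem eventually_sum_abs_vonMangoldt_resKer_le {K : ℕ} [NeZero K] {u : ZMod K} (hu : IsUnit u)
    {δ ε : ℝ} (hδ : 0 < δ) (hδ' : δ ≤ 1 / 100) (hε : 0 < ε) :
    ∀ᶠ z : ℝ in Filter.atTop, ∀ P : Finset ℕ,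
      (∀ q ∈ P, q.Prime ∧ z ^ ((1 : ℝ) / 2 - 2 * δ) ≤ (q : ℝ) ∧
        (q : ℝ) ≤ z ^ ((1 : ℝ) / 2 - δ)) →
      ∑ q ∈ P, |∑ n ∈ Finset.Icc 1 ⌊z⌋₊, ArithmeticFunction.vonMangoldt n *
        ((if (n : ZMod K) = u then resKer q n else 0) * logTri z n)| ≤ ε * z := by
  obtain ⟨C₁, h₁⟩ := exists_block_const hu hδ hδ' (α := 1 / 2 - 2 * δ) (by linarith) (by linarith)
  obtain ⟨C₂, h₂⟩ := exists_block_const hu hδ hδ' (α := 1 / 2 - 3 * δ / 2) (by linarith) le_rfl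
  have hlo := isLittleO_log_rpow_rpow_atTop 2 (show 0 < δ / 2 by linarith)
  have hlo2 := hlo.def (show 0 < ε / (|C₁| + |C₂| + 1) by positivity)
  filter_upwards [h₁, h₂, hlo2, Filter.eventually_gt_atTop 1] with z h₁ h₂ hl hz1 P hP
  have hz0 : 0 < z := by linarith
  rw [← Finset.sum_filter_add_sum_filter_not P (fun q : ℕ => (q : ℝ) ≤ z ^ (1 / 2 - 2 * δ + δ / 2))]
  have g₁ := h₁ (P.filter (fun q : ℕ => (q : ℝ) ≤ z ^ (1 / 2 - 2 * δ + δ / 2))) (by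
    intro q hq
    rw [Finset.mem_filter] at hq
    exact ⟨(hP q hq.1).1, (hP q hq.1).2.1, hq.2⟩)
  have g₂ := h₂ (P.filter (fun q : ℕ => ¬ (q : ℝ) ≤ z ^ (1 / 2 - 2 * δ + δ / 2))) (by
    intro q hq
    rw [Finset.mem_filter] at hq
    refine ⟨(hP q hq.1).1, ?_, ?_⟩
    · rw [show (1 : ℝ) / 2 - 3 * δ / 2 = 1 / 2 - 2 * δ + δ / 2 by ring]
      exact (not_le.mp hq.2).le
    · rw [show (1 : ℝ) / 2 - 3 * δ / 2 + δ / 2 = 1 / 2 - δ by ring]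
      exact (hP q hq.1).2.2)
  refine (add_le_add g₁ g₂).trans ?_
  have hl2 : Real.log z ^ 2 ≤ ε / (|C₁| + |C₂| + 1) * z ^ (δ / 2) := by
    rw [Real.norm_of_nonneg (Real.rpow_nonneg (Real.log_nonneg hz1.le) _),
      Real.norm_of_nonneg (by positivity)] at hl
    calc _ = Real.log z ^ (2 : ℝ) := by exact_mod_cast (Real.rpow_natCast _ 2).symm
      _ ≤ _ := hl
  have hzz : z ^ (δ / 2) * z ^ (1 - δ / 2) = z := by
    rw [← Real.rpow_add hz0, add_sub_cancel, Real.rpow_one]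
  have hX : Real.log z ^ 2 * z ^ (1 - δ / 2) ≤ ε / (|C₁| + |C₂| + 1) * z := by
    calc _ ≤ ε / (|C₁| + |C₂| + 1) * z ^ (δ / 2) * z ^ (1 - δ / 2) := by gcongr
      _ = _ := by rw [mul_assoc, hzz]
  have hX0 : 0 ≤ Real.log z ^ 2 * z ^ (1 - δ / 2) := by positivity
  calc _ ≤ (|C₁| + |C₂| + 1) * (Real.log z ^ 2 * z ^ (1 - δ / 2)) := by
        nlinarith [le_abs_self C₁, le_abs_self C₂]
    _ ≤ (|C₁| + |C₂| + 1) * (ε / (|C₁| + |C₂| + 1) * z) := by gcongr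
    _ = ε * z := by field_simp

end VaughanAsymptotic

section Mertens

lemma exists_abs_sum_vonMangoldt_div_sub_log_le :
    ∃ C : ℝ, ∀ N : ℕ, 1 ≤ N →
      |∑ n ∈ Finset.Ioc 0 N, ArithmeticFunction.vonMangoldt n / n - Real.log N| ≤ C := by
  refine ⟨Real.log 4 + 4, fun N hN => ?_⟩
  have hN0 : (0 : ℝ) < N := by exact_mod_cast hN
  have hfac : ∑ n ∈ Finset.Ioc 0 N, Real.log n = Real.log (N.factorial : ℝ) := by
    clear hN hN0
    induction N with
    | zero => simp
    | succ k ih =>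
      rw [Finset.sum_Ioc_succ_top (Nat.zero_le k), ih, Nat.factorial_succ, Nat.cast_mul,
        Real.log_mul (by positivity) (by positivity), add_comm]
  have hid := ArithmeticFunction.sum_Ioc_mul_zeta_eq_sum ArithmeticFunction.vonMangoldt N
  rw [ArithmeticFunction.vonMangoldt_mul_zeta] at hid
  simp only [ArithmeticFunction.log_apply] at hid
  rw [hfac] at hid
  have hpsi : ∑ n ∈ Finset.Ioc 0 N, ArithmeticFunction.vonMangoldt n ≤ (Real.log 4 + 4) * N := by
    have := Chebyshev.psi_le_const_mul_self (x := N) (Nat.cast_nonneg _)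
    rwa [Chebyshev.psi, Nat.floor_natCast] at this
  have h1 : Real.log (N.factorial : ℝ) ≤ N * Real.log N := by
    rw [← Real.log_pow]
    refine Real.log_le_log (by positivity) ?_
    exact_mod_cast Nat.factorial_le_pow N
  have h2 : N * Real.log N - N ≤ Real.log (N.factorial : ℝ) := by
    have h3 := Real.pow_div_factorial_le_exp (x := N) (Nat.cast_nonneg _) N
    have h4 := Real.log_le_log (by positivity) h3
    rw [Real.log_exp, Real.log_div (by positivity) (by positivity), Real.log_pow] at h4
    linarith
  have e : ∀ n ∈ Finset.Ioc 0 N, (ArithmeticFunction.vonMangoldt n * ((N / n : ℕ) : ℝ) ≤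
      N * (ArithmeticFunction.vonMangoldt n / n)) ∧
      N * (ArithmeticFunction.vonMangoldt n / n) ≤
      ArithmeticFunction.vonMangoldt n * ((N / n : ℕ) : ℝ) + ArithmeticFunction.vonMangoldt n := by
    intro n hn
    have hn0 : (0 : ℝ) < n := by exact_mod_cast (Finset.mem_Ioc.mp hn).1
    have hL := ArithmeticFunction.vonMangoldt_nonneg (n := n)
    have q1 : ((N / n : ℕ) : ℝ) ≤ N / n := Nat.cast_div_le
    have q2 : (N : ℝ) / n ≤ ((N / n : ℕ) : ℝ) + 1 := by
      rw [div_le_iff₀ hn0]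
      have := Nat.lt_div_mul_add (a := N) (Finset.mem_Ioc.mp hn).1
      have h : (N : ℝ) < (N / n : ℕ) * n + n := by exact_mod_cast this
      linarith
    have e1 : N * (ArithmeticFunction.vonMangoldt n / n) =
      ArithmeticFunction.vonMangoldt n * ((N : ℝ) / n) := by ring
    rw [e1]
    constructor
    · gcongr
    · nlinarith
  have s1 := Finset.sum_le_sum fun n hn => (e n hn).1
  have s2 := Finset.sum_le_sum fun n hn => (e n hn).2
  rw [Finset.sum_add_distrib, ← hid, ← Finset.mul_sum] at s2
  rw [← hid, ← Finset.mul_sum] at s1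
  have hl4 : 0 ≤ Real.log 4 := Real.log_nonneg (by norm_num)
  rw [abs_le]
  constructor
  · have : N * (-(Real.log 4 + 4)) ≤ N * (∑ n ∈ Finset.Ioc 0 N,
      ArithmeticFunction.vonMangoldt n / n - Real.log N) := by nlinarith
    exact le_of_mul_le_mul_left this hN0
  · have : N * (∑ n ∈ Finset.Ioc 0 N,
      ArithmeticFunction.vonMangoldt n / n - Real.log N) ≤ N * (Real.log 4 + 4) := by nlinarith
    exact le_of_mul_le_mul_left this hN0

/-- Mertens' first theorem. -/
lemma exists_abs_sum_prime_log_div_sub_log_le :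
    ∃ C : ℝ, ∀ x : ℝ, 1 ≤ x →
      |∑ q ∈ (Finset.Ioc 0 ⌊x⌋₊).filter Nat.Prime, Real.log q / q - Real.log x| ≤ C := by
  obtain ⟨C, hC⟩ := exists_abs_sum_vonMangoldt_div_sub_log_le
  have hsum := ArithmeticFunction.vonMangoldt.summable_residueClass_non_primes_div (q := 1) 0
  set f : ℕ → ℝ := fun n => (if n.Prime then 0 else
    ArithmeticFunction.vonMangoldt.residueClass (0 : ZMod 1) n) / n with hf
  have hf0 : ∀ n, 0 ≤ f n := by
    intro n
    rw [hf]
    simp only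
    split_ifs
    · simp
    · exact div_nonneg (ArithmeticFunction.vonMangoldt.residueClass_nonneg _ _) (Nat.cast_nonneg _)
  have hr : ∀ n, ArithmeticFunction.vonMangoldt.residueClass (0 : ZMod 1) n =
      ArithmeticFunction.vonMangoldt n := by
    intro n
    simp [ArithmeticFunction.vonMangoldt.residueClass, Set.indicator, Subsingleton.elim (n : ZMod 1) 0]
  refine ⟨C + ∑' n, f n + Real.log 2, fun x hx => ?_⟩
  have hN : 1 ≤ ⌊x⌋₊ := Nat.floor_pos.mpr hx
  have h1 := hC ⌊x⌋₊ hN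
  have h2 : ∑ n ∈ Finset.Ioc 0 ⌊x⌋₊, ArithmeticFunction.vonMangoldt n / n =
      ∑ q ∈ (Finset.Ioc 0 ⌊x⌋₊).filter Nat.Prime, Real.log q / q +
      ∑ n ∈ Finset.Ioc 0 ⌊x⌋₊, f n := by
    rw [Finset.sum_filter, ← Finset.sum_add_distrib]
    refine Finset.sum_congr rfl fun n _ => ?_
    rw [hf]
    simp only [hr]
    split_ifs with h
    · rw [ArithmeticFunction.vonMangoldt_apply_prime h]; simp
    · simp
  have h3 : ∑ n ∈ Finset.Ioc 0 ⌊x⌋₊, f n ≤ ∑' n, f n := hsum.sum_le_tsum _ fun n _ => hf0 n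
  have h4 : 0 ≤ ∑ n ∈ Finset.Ioc 0 ⌊x⌋₊, f n := Finset.sum_nonneg fun n _ => hf0 n
  have hF : (1 : ℝ) ≤ ⌊x⌋₊ := by exact_mod_cast hN
  have h5 : Real.log ⌊x⌋₊ ≤ Real.log x := Real.log_le_log (by linarith) (Nat.floor_le (by linarith))
  have h6 : Real.log x ≤ Real.log ⌊x⌋₊ + Real.log 2 := by
    rw [← Real.log_mul (by linarith) two_ne_zero]
    refine Real.log_le_log (by linarith) ?_
    have := Nat.lt_floor_add_one x
    linarith
  rw [h2, abs_le] at h1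
  have hlog2 := Real.log_pos one_lt_two
  have hC0 := (abs_nonneg _).trans (hC 1 le_rfl)
  rw [abs_le]
  constructor <;> linarith [h1.1, h1.2]

/-- The primes between `z ^ (1 / 2 - 2 δ)` and `z ^ (1 / 2 - δ)`. -/
noncomputable def primeBlock (δ z : ℝ) : Finset ℕ :=
  (Finset.Ioc 0 ⌊z ^ ((1 : ℝ) / 2 - δ)⌋₊).filter fun q =>
    q.Prime ∧ z ^ ((1 : ℝ) / 2 - 2 * δ) ≤ (q : ℝ)

lemma mem_primeBlock {δ z : ℝ} (hz : 0 ≤ z) {q : ℕ} :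
    q ∈ primeBlock δ z ↔ q.Prime ∧ z ^ ((1 : ℝ) / 2 - 2 * δ) ≤ (q : ℝ) ∧
      (q : ℝ) ≤ z ^ ((1 : ℝ) / 2 - δ) := by
  rw [primeBlock, Finset.mem_filter, Finset.mem_Ioc, Nat.le_floor_iff (Real.rpow_nonneg hz _)]
  constructor
  · rintro ⟨⟨_, h1⟩, h2, h3⟩
    exact ⟨h2, h3, h1⟩
  · rintro ⟨h1, h2, h3⟩
    exact ⟨⟨h1.pos, h3⟩, h1, h2⟩

lemma eventually_sum_primeBlock_inv {δ ε : ℝ} (hδ : 0 < δ) (hδ' : δ ≤ 1 / 100) (hε : 0 < ε) :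
    ∀ᶠ z : ℝ in Filter.atTop,
      2 * δ / (1 - 2 * δ) - ε ≤ ∑ q ∈ primeBlock δ z, 1 / (q : ℝ) ∧
      ∑ q ∈ primeBlock δ z, 1 / (q : ℝ) ≤ 4 * δ := by
  obtain ⟨C, hC⟩ := exists_abs_sum_prime_log_div_sub_log_le
  have hC0 : 0 ≤ C := (abs_nonneg _).trans (hC 1 le_rfl)
  filter_upwards [Filter.eventually_gt_atTop 1,
    Real.tendsto_log_atTop.eventually_ge_atTop ((2 * C + 1) * 3 / ε),
    Real.tendsto_log_atTop.eventually_ge_atTop ((2 * C + 1) * 3 / δ)] with z hz1 hl1 hl2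
  have hz0 : 0 < z := by linarith
  set l := Real.log z with hl
  have hl0 : 0 < l := Real.log_pos hz1
  rw [div_le_iff₀ hε] at hl1
  rw [div_le_iff₀ hδ] at hl2
  set y1 := z ^ ((1 : ℝ) / 2 - 2 * δ) with hy1
  set y2 := z ^ ((1 : ℝ) / 2 - δ) with hy2
  have ly1 : Real.log y1 = (1 / 2 - 2 * δ) * l := Real.log_rpow hz0 _
  have ly2 : Real.log y2 = (1 / 2 - δ) * l := Real.log_rpow hz0 _
  have y1p : 1 ≤ y1 := Real.one_le_rpow hz1.le (by linarith)
  have y12 : y1 ≤ y2 := Real.rpow_le_rpow_of_exponent_le hz1.le (by linarith)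
  have h1 := abs_le.mp (hC y1 y1p)
  have h2 := abs_le.mp (hC y2 (y1p.trans y12))
  set S1 := (Finset.Ioc 0 ⌊y1⌋₊).filter Nat.Prime with hS1
  set S2 := (Finset.Ioc 0 ⌊y2⌋₊).filter Nat.Prime with hS2
  have hsub : S1 ⊆ S2 := by
    refine Finset.filter_subset_filter _ (Finset.Ioc_subset_Ioc_right (Nat.floor_le_floor y12))
  have hdiff := Finset.sum_sdiff (f := fun q : ℕ => Real.log q / (q : ℝ)) hsub
  have hd1 : S2 \ S1 ⊆ primeBlock δ z := by
    intro q hq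
    rw [Finset.mem_sdiff, hS2, hS1, Finset.mem_filter, Finset.mem_filter, Finset.mem_Ioc,
      Finset.mem_Ioc] at hq
    rw [primeBlock, Finset.mem_filter, Finset.mem_Ioc]
    refine ⟨hq.1.1, hq.1.2, ?_⟩
    by_contra! hc
    exact hq.2 ⟨⟨hq.1.1.1, Nat.le_floor hc.le⟩, hq.1.2⟩
  have hd2 : primeBlock δ z ⊆ insert ⌊y1⌋₊ (S2 \ S1) := by
    intro q hq
    rw [primeBlock, Finset.mem_filter, Finset.mem_Ioc] at hq
    rw [Finset.mem_insert]
    by_cases h : q ≤ ⌊y1⌋₊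
    · left
      have : (q : ℝ) ≤ y1 := (Nat.le_floor_iff (by linarith)).mp h
      have h3 : (q : ℝ) = y1 := le_antisymm this hq.2.2
      rw [← h3, Nat.floor_natCast]
    · right
      rw [Finset.mem_sdiff, hS2, hS1, Finset.mem_filter, Finset.mem_filter, Finset.mem_Ioc,
        Finset.mem_Ioc]
      exact ⟨⟨hq.1, hq.2.1⟩, fun h' => h h'.1.2⟩
  have hnn : ∀ q : ℕ, 0 ≤ Real.log q / (q : ℝ) := fun q =>
    div_nonneg (Real.log_natCast_nonneg _) (Nat.cast_nonneg _)
  have hle1 : ∀ q : ℕ, Real.log q / (q : ℝ) ≤ 1 := fun q =>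
    div_le_one_of_le₀ (Real.log_le_self (Nat.cast_nonneg _)) (Nat.cast_nonneg _)
  have hB1 : ∑ q ∈ S2 \ S1, Real.log q / (q : ℝ) ≤ ∑ q ∈ primeBlock δ z, Real.log q / (q : ℝ) :=
    Finset.sum_le_sum_of_subset_of_nonneg hd1 fun q _ _ => hnn q
  have hB2 : ∑ q ∈ primeBlock δ z, Real.log q / (q : ℝ) ≤ 1 + ∑ q ∈ S2 \ S1, Real.log q / (q : ℝ) := by
    refine (Finset.sum_le_sum_of_subset_of_nonneg hd2 fun q _ _ => hnn q).trans ?_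
    by_cases hmem : ⌊y1⌋₊ ∈ S2 \ S1
    · rw [Finset.insert_eq_of_mem hmem]
      linarith
    · rw [Finset.sum_insert hmem]
      linarith [hle1 ⌊y1⌋₊]
  have hq : ∀ q ∈ primeBlock δ z, Real.log q / (q : ℝ) ≤ ((1 / 2 - δ) * l) * (1 / q) ∧
      ((1 / 2 - 2 * δ) * l) * (1 / q) ≤ Real.log q / (q : ℝ) := by
    intro q hq
    rw [mem_primeBlock hz0.le] at hq
    have q0 : (0 : ℝ) < q := by exact_mod_cast hq.1.pos
    rw [← ly1, ← ly2, mul_one_div, mul_one_div]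
    constructor
    · refine div_le_div_of_nonneg_right (Real.log_le_log q0 hq.2.2) q0.le
    · refine div_le_div_of_nonneg_right (Real.log_le_log (by linarith) hq.2.1) q0.le
  have s1 := Finset.sum_le_sum fun q h => (hq q h).1
  have s2 := Finset.sum_le_sum fun q h => (hq q h).2
  rw [← Finset.mul_sum] at s1 s2
  rw [ly1] at h1
  rw [ly2] at h2
  set E := ∑ q ∈ primeBlock δ z, 1 / (q : ℝ) with hE
  have k1 : δ * l - 2 * C ≤ ((1 / 2 - δ) * l) * E := by linarith
  have k2 : ((1 / 2 - 2 * δ) * l) * E ≤ δ * l + 2 * C + 1 := by linarith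
  constructor
  · rw [sub_le_iff_le_add, div_le_iff₀ (by linarith)]
    have : l * (2 * δ) ≤ l * ((E + ε) * (1 - 2 * δ)) := by
      have : 0 ≤ l * ε * (1 / 100 - δ) := mul_nonneg (by positivity) (by linarith)
      nlinarith
    exact le_of_mul_le_mul_left this hl0
  · by_contra! hc
    have : ((1 / 2 - 2 * δ) * l) * (4 * δ) < ((1 / 2 - 2 * δ) * l) * E :=
      mul_lt_mul_of_pos_left hc (mul_pos (by linarith) hl0)
    have : 0 ≤ l * δ * (1 / 100 - δ) := mul_nonneg (by positivity) (by linarith)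
    nlinarith

end Mertens

section UpperBoundSieve

lemma sum_range_mul_coprime_periodic {a b : ℕ} (hab : a.Coprime b) (ha : 0 < a) (hb : 0 < b)
    {G H : ℕ → ℝ} (hG : Function.Periodic G a) (hH : Function.Periodic H b) :
    ∑ j ∈ Finset.range (a * b), G j * H j =
      (∑ j ∈ Finset.range a, G j) * ∑ j ∈ Finset.range b, H j := by
  rw [Finset.sum_mul_sum, ← Finset.sum_product']
  refine Finset.sum_bij' (fun j _ => (j % a, j % b))
    (fun x _ => (Nat.chineseRemainder hab x.1 x.2 : ℕ)) ?_ ?_ ?_ ?_ ?_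
  · intro j _
    simp [Nat.mod_lt _ ha, Nat.mod_lt _ hb]
  · intro x _
    simpa using Nat.chineseRemainder_lt_mul hab x.1 x.2 ha.ne' hb.ne'
  · intro j hj
    have h := Nat.chineseRemainder_modEq_unique hab (a := j % a) (b := j % b) (z := j)
      (Nat.mod_modEq j a).symm (Nat.mod_modEq j b).symm
    exact (Nat.ModEq.eq_of_lt_of_lt h (Finset.mem_range.mp hj)
      (Nat.chineseRemainder_lt_mul hab _ _ ha.ne' hb.ne')).symm
  · rintro ⟨x, y⟩ hx
    simp only [Finset.mem_product, Finset.mem_range] at hx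
    have h := (Nat.chineseRemainder hab x y).2
    ext
    · exact (Nat.ModEq.eq_of_lt_of_lt ((Nat.mod_modEq _ a).trans h.1) (Nat.mod_lt _ ha) hx.1)
    · exact (Nat.ModEq.eq_of_lt_of_lt ((Nat.mod_modEq _ b).trans h.2) (Nat.mod_lt _ hb) hx.2)
  · intro j _
    rw [hG.map_mod_nat, hH.map_mod_nat]

lemma prod_periodic {s : Finset ℕ} {P : ℕ} {g : ℕ → ℕ → ℝ}
    (hg : ∀ l ∈ s, Function.Periodic (g l) P) :
    Function.Periodic (fun j => ∏ l ∈ s, g l j) P := fun j =>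
  Finset.prod_congr rfl fun l hl => hg l hl j

lemma periodic_of_dvd {f : ℕ → ℝ} {a b : ℕ} (hf : Function.Periodic f a) (h : a ∣ b) :
    Function.Periodic f b := by
  obtain ⟨c, rfl⟩ := h
  rw [mul_comm]
  exact hf.nat_mul c

lemma prod_periodic_prod {s : Finset ℕ} {g : ℕ → ℕ → ℝ}
    (hg : ∀ l ∈ s, Function.Periodic (g l) l) :
    Function.Periodic (fun j => ∏ l ∈ s, g l j) (∏ l ∈ s, l) :=
  prod_periodic fun l hl => periodic_of_dvd (hg l hl) (Finset.dvd_prod_of_mem _ hl)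

lemma sum_range_prod_periodic {s : Finset ℕ} (hs : ∀ l ∈ s, l.Prime) {g : ℕ → ℕ → ℝ}
    (hg : ∀ l ∈ s, Function.Periodic (g l) l) :
    ∑ j ∈ Finset.range (∏ l ∈ s, l), ∏ l ∈ s, g l j =
      ∏ l ∈ s, ∑ j ∈ Finset.range l, g l j := by
  induction s using Finset.induction_on with
  | empty => simp
  | insert l s hl ih =>
    rw [Finset.forall_mem_insert] at hs hg
    rw [Finset.prod_insert hl, Finset.prod_insert hl, ← ih hs.2 hg.2,
      ← sum_range_mul_coprime_periodic (Nat.Coprime.prod_right fun m hm =>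
        (Nat.coprime_primes hs.1 (hs.2 m hm)).mpr fun h => hl (h ▸ hm)) hs.1.pos
        (Finset.prod_pos fun m hm => (hs.2 m hm).pos) hg.1 (prod_periodic_prod hg.2)]
    exact Finset.sum_congr rfl fun j _ => Finset.prod_insert hl

lemma sum_range_periodic_le {f : ℕ → ℝ} {P : ℕ} (hP : 0 < P) (hf : Function.Periodic f P)
    {B : ℝ} (hB : ∀ j, |f j| ≤ B) (N : ℕ) :
    ∑ j ∈ Finset.range N, f j ≤ N * ((∑ j ∈ Finset.range P, f j) / P) + 2 * P * B := by
  have h1 : ∀ a : ℕ, ∑ j ∈ Finset.range (P * a), f j = a * ∑ j ∈ Finset.range P, f j := by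
    intro a
    induction a with
    | zero => simp
    | succ a ih =>
      rw [mul_add, mul_one, Finset.sum_range_add, ih]
      have : ∀ x, f (P * a + x) = f x := fun x => by
        rw [add_comm, mul_comm]; exact (hf.nat_mul a) x
      simp only [this]
      push_cast
      ring
  have hB0 : 0 ≤ B := (abs_nonneg _).trans (hB 0)
  have h2 : ∀ M : ℕ, |∑ j ∈ Finset.range M, f j| ≤ M * B := fun M =>
    (Finset.abs_sum_le_sum_abs _ _).trans <| by
      simpa using Finset.sum_le_card_nsmul (Finset.range M) (fun j => |f j|) B fun j _ => hB j
  have hP' : (0 : ℝ) < P := by exact_mod_cast hP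
  set M := ∑ j ∈ Finset.range P, f j with hM
  have hr : N % P ≤ P := (Nat.mod_lt _ hP).le
  have hr' : ((N % P : ℕ) : ℝ) ≤ P := by exact_mod_cast hr
  have h3 : ∑ j ∈ Finset.range N, f j =
      (N / P : ℕ) * M + ∑ j ∈ Finset.range (N % P), f j := by
    conv_lhs => rw [← Nat.div_add_mod N P]
    rw [Finset.sum_range_add, h1]
    congr 1
    refine Finset.sum_congr rfl fun x _ => ?_
    rw [add_comm, mul_comm]; exact (hf.nat_mul _) x
  have h4 : (N : ℝ) * (M / P) = (N / P : ℕ) * M + (N % P : ℕ) * (M / P) := by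
    have : (N : ℝ) = P * (N / P : ℕ) + (N % P : ℕ) := by exact_mod_cast (Nat.div_add_mod N P).symm
    conv_lhs => rw [this]
    field_simp
  have h5 : |M / P| ≤ B := by
    rw [abs_div, abs_of_pos hP', div_le_iff₀ hP', mul_comm]
    exact h2 P
  have h6 : -((N % P : ℕ) * (M / P)) ≤ (P : ℝ) * B := by
    rw [← mul_neg]
    calc ((N % P : ℕ) : ℝ) * (-(M / P)) ≤ (N % P : ℕ) * B :=
          mul_le_mul_of_nonneg_left ((neg_le_abs _).trans h5) (Nat.cast_nonneg _)
      _ ≤ P * B := mul_le_mul_of_nonneg_right hr' hB0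
  have h7 := (le_abs_self _).trans (h2 (N % P))
  have h8 : ((N % P : ℕ) : ℝ) * B ≤ P * B := by gcongr
  rw [h3, h4]
  linarith

/-- The local sieve function at `l`: `1` outside two given residue classes and of mean `0`. -/
noncomputable def sieveFun (α β : (l : ℕ) → ZMod l) (l j : ℕ) : ℝ :=
  if (j : ZMod l) = α l ∨ (j : ZMod l) = β l then -((l : ℝ) - 2) / 2 else 1

lemma sieveFun_periodic (α β : (l : ℕ) → ZMod l) (l : ℕ) :
    Function.Periodic (sieveFun α β l) l := fun j => by simp [sieveFun]

lemma sum_range_zmod {l : ℕ} (hl : 0 < l) (f : ZMod l → ℝ) :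
    ∑ j ∈ Finset.range l, f (j : ZMod l) = ∑ x ∈ (@Finset.univ (ZMod l)
      (@ZMod.fintype l ⟨hl.ne'⟩)), f x := by
  have : NeZero l := ⟨hl.ne'⟩
  refine Finset.sum_bij' (fun j _ => (j : ZMod l)) (fun x _ => x.val) ?_ ?_ ?_ ?_ ?_
  · simp
  · intro x _; simpa using ZMod.val_lt x
  · intro j hj; exact ZMod.val_cast_of_lt (Finset.mem_range.mp hj)
  · intro x _; simp
  · simp

lemma sum_range_two_values {l : ℕ} (hl : 0 < l) {a b : ZMod l} (hab : a ≠ b) (x y : ℝ) :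
    ∑ j ∈ Finset.range l, (if (j : ZMod l) = a ∨ (j : ZMod l) = b then x else y) =
      2 * x + (l - 2) * y := by
  have : NeZero l := ⟨hl.ne'⟩
  have : ∀ c : ZMod l, (if c = a ∨ c = b then x else y) =
      y + ((if c = a then x - y else 0) + if c = b then x - y else 0) := by
    intro c
    by_cases h1 : c = a
    · have h2 : c ≠ b := fun h => hab (h1 ▸ h)
      simp [h1, hab]
    · by_cases h2 : c = b
      · simp [h2, hab.symm]
      · simp [h1, h2]
  rw [sum_range_zmod hl (fun c => if c = a ∨ c = b then x else y)]
  simp only [this, Finset.sum_add_distrib, Finset.sum_ite_eq', Finset.mem_univ, if_true,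
    Finset.sum_const, Finset.card_univ, ZMod.card, nsmul_eq_mul]
  ring

lemma sum_range_sieveFun {α β : (l : ℕ) → ZMod l} {l : ℕ} (hl : 0 < l) (h : α l ≠ β l) :
    ∑ j ∈ Finset.range l, sieveFun α β l j = 0 := by
  simp only [sieveFun]
  rw [sum_range_two_values hl h]
  ring

lemma sum_range_sieveFun_sq {α β : (l : ℕ) → ZMod l} {l : ℕ} (hl : 0 < l) (h : α l ≠ β l) :
    ∑ j ∈ Finset.range l, sieveFun α β l j * sieveFun α β l j = l * ((l - 2) / 2) := by
  have : ∀ j, sieveFun α β l j * sieveFun α β l j =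
      if (j : ZMod l) = α l ∨ (j : ZMod l) = β l then (((l : ℝ) - 2) / 2) ^ 2 else 1 := by
    intro j
    simp only [sieveFun]
    split_ifs <;> ring
  simp only [this]
  rw [sum_range_two_values hl h]
  ring

lemma abs_sieveFun_le {α β : (l : ℕ) → ZMod l} {l : ℕ} (hl : 5 ≤ l) (j : ℕ) :
    |sieveFun α β l j| ≤ (l - 2) / 2 := by
  have hl' : (5 : ℝ) ≤ l := by exact_mod_cast hl
  simp only [sieveFun]
  split_ifs
  · rw [neg_div, abs_neg, abs_of_nonneg (by linarith)]
  · rw [abs_one]; linarith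

/-- The subsets of `S` with product at most `D`. -/
noncomputable def smallSubsets (S : Finset ℕ) (D : ℕ) : Finset (Finset ℕ) :=
  S.powerset.filter fun t => ∏ l ∈ t, l ≤ D

lemma mem_smallSubsets {S t : Finset ℕ} {D : ℕ} :
    t ∈ smallSubsets S D ↔ t ⊆ S ∧ ∏ l ∈ t, l ≤ D := by
  simp [smallSubsets]

lemma prod_id_injOn_primes {S : Finset ℕ} (hS : ∀ l ∈ S, l.Prime) :
    Set.InjOn (fun t : Finset ℕ => ∏ l ∈ t, l) {t | t ⊆ S} := by
  intro t ht t' ht' h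
  have h1 : ∀ t : Finset ℕ, t ⊆ S → (∏ l ∈ t, l).primeFactors = t := fun t ht =>
    Nat.primeFactors_prod fun l hl => hS l (ht hl)
  rw [← h1 t ht, ← h1 t' ht']
  exact congrArg _ h

lemma card_smallSubsets_le {S : Finset ℕ} (hS : ∀ l ∈ S, l.Prime) (D : ℕ) :
    (smallSubsets S D).card ≤ D := by
  have : (smallSubsets S D).card ≤ (Finset.Icc 1 D).card := by
    refine Finset.card_le_card_of_injOn (fun t => ∏ l ∈ t, l) ?_ ?_
    · intro t ht
      have ht := mem_smallSubsets.mp ht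
      simp only [Finset.coe_Icc, Set.mem_Icc]
      exact ⟨Finset.prod_pos fun l hl => (hS l (ht.1 hl)).pos, ht.2⟩
    · intro t ht t' ht' h
      exact prod_id_injOn_primes hS (mem_smallSubsets.mp ht).1 (mem_smallSubsets.mp ht').1 h
  simpa using this

lemma sum_range_sieveFun_prod_le {α β : (l : ℕ) → ZMod l} {S : Finset ℕ}
    (hS : ∀ l ∈ S, l.Prime ∧ 5 ≤ l ∧ α l ≠ β l) {D : ℕ} {t t' : Finset ℕ}
    (ht : t ∈ smallSubsets S D) (ht' : t' ∈ smallSubsets S D) (N : ℕ) :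
    ∑ j ∈ Finset.range N, (∏ l ∈ t, sieveFun α β l j) * (∏ l ∈ t', sieveFun α β l j) ≤
      (if t = t' then N * ∏ l ∈ t, ((l : ℝ) - 2) / 2 else 0) +
      2 * D ^ 2 * ((∏ l ∈ t, ((l : ℝ) - 2) / 2) * ∏ l ∈ t', ((l : ℝ) - 2) / 2) := by
  obtain ⟨hts, htD⟩ := mem_smallSubsets.mp ht
  obtain ⟨hts', htD'⟩ := mem_smallSubsets.mp ht'
  set g : ℕ → ℕ → ℝ := fun l j => (if l ∈ t then sieveFun α β l j else 1) *
    (if l ∈ t' then sieveFun α β l j else 1) with hg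
  have hU : t ∪ t' ⊆ S := Finset.union_subset hts hts'
  have hprod : ∀ j, (∏ l ∈ t, sieveFun α β l j) * (∏ l ∈ t', sieveFun α β l j) =
      ∏ l ∈ t ∪ t', g l j := by
    intro j
    simp only [hg]
    rw [Finset.prod_mul_distrib, Finset.prod_ite_mem, Finset.prod_ite_mem,
      Finset.inter_eq_right.mpr Finset.subset_union_left,
      Finset.inter_eq_right.mpr Finset.subset_union_right]
  have hgp : ∀ l ∈ t ∪ t', Function.Periodic (g l) l := by
    intro l _ j
    simp only [hg, sieveFun_periodic α β l j]
  have hP0 : 0 < ∏ l ∈ t ∪ t', l := Finset.prod_pos fun l hl => (hS l (hU hl)).1.pos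
  have hPle : ∏ l ∈ t ∪ t', l ≤ D ^ 2 := by
    calc ∏ l ∈ t ∪ t', l ≤ (∏ l ∈ t ∪ t', l) * ∏ l ∈ t ∩ t', l :=
          Nat.le_mul_of_pos_right _ (Finset.prod_pos fun l hl =>
            (hS l (hts (Finset.mem_of_mem_inter_left hl))).1.pos)
      _ = (∏ l ∈ t, l) * ∏ l ∈ t', l := Finset.prod_union_inter
      _ ≤ D ^ 2 := by rw [sq]; exact Nat.mul_le_mul htD htD'
  have hb : ∀ t ⊆ S, ∀ j, |∏ l ∈ t, sieveFun α β l j| ≤ ∏ l ∈ t, ((l : ℝ) - 2) / 2 := by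
    intro t ht j
    rw [Finset.abs_prod]
    exact Finset.prod_le_prod (fun _ _ => abs_nonneg _) fun l hl =>
      abs_sieveFun_le (hS l (ht hl)).2.1 j
  have hb0 : ∀ t ⊆ S, 0 ≤ ∏ l ∈ t, ((l : ℝ) - 2) / 2 := fun t ht => (abs_nonneg _).trans (hb t ht 0)
  have hmain := sum_range_periodic_le hP0 (prod_periodic_prod hgp)
    (B := (∏ l ∈ t, ((l : ℝ) - 2) / 2) * ∏ l ∈ t', ((l : ℝ) - 2) / 2) (fun j => by
      rw [← hprod, abs_mul]
      exact mul_le_mul (hb t hts j) (hb t' hts' j) (abs_nonneg _) (hb0 t hts)) N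
  simp only [hprod]
  refine hmain.trans (add_le_add ?_ ?_)
  · rw [sum_range_prod_periodic (fun l hl => (hS l (hU hl)).1) hgp]
    split_ifs with h
    · subst h
      refine mul_le_mul_of_nonneg_left (le_of_eq ?_) (Nat.cast_nonneg _)
      rw [div_eq_iff (by exact_mod_cast hP0.ne')]
      push_cast
      rw [Finset.union_idempotent, mul_comm, ← Finset.prod_mul_distrib]
      refine Finset.prod_congr rfl fun l hl => ?_
      simp only [hg, hl, if_true]
      exact sum_range_sieveFun_sq (hS l (hts hl)).1.pos (hS l (hts hl)).2.2
    · have : ∃ l ∈ t ∪ t', ∑ j ∈ Finset.range l, g l j = 0 := by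
        by_contra! hne
        apply h
        ext l
        constructor
        · intro hl
          by_contra hl'
          apply hne l (Finset.mem_union_left _ hl)
          simp only [hg, hl, hl', if_true, if_false, mul_one]
          exact sum_range_sieveFun (hS l (hts hl)).1.pos (hS l (hts hl)).2.2
        · intro hl
          by_contra hl'
          apply hne l (Finset.mem_union_right _ hl)
          simp only [hg, hl, hl', if_true, if_false, one_mul]
          exact sum_range_sieveFun (hS l (hts' hl)).1.pos (hS l (hts' hl)).2.2
      obtain ⟨l, hl, hl0⟩ := this
      rw [Finset.prod_eq_zero hl hl0]
      simp
  · have h1 : ((∏ l ∈ t ∪ t', l : ℕ) : ℝ) ≤ D ^ 2 := by exact_mod_cast hPle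
    have h2 := mul_nonneg (hb0 t hts) (hb0 t' hts')
    gcongr

/-- The main sum of the two-dimensional sieve. -/
noncomputable def sieveSum (S : Finset ℕ) (D : ℕ) : ℝ :=
  ∑ t ∈ smallSubsets S D, ∏ l ∈ t, 2 / ((l : ℝ) - 2)

lemma one_le_sieveSum {S : Finset ℕ} (hS : ∀ l ∈ S, 5 ≤ l) {D : ℕ} (hD : 1 ≤ D) :
    1 ≤ sieveSum S D := by
  have h0 : ∅ ∈ smallSubsets S D := by simp [mem_smallSubsets, hD]
  have := Finset.single_le_sum (f := fun t : Finset ℕ => ∏ l ∈ t, 2 / ((l : ℝ) - 2))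
    (fun t ht => Finset.prod_nonneg fun l hl => ?_) h0
  · simpa [sieveSum] using this
  · have : (5 : ℝ) ≤ l := by exact_mod_cast hS l ((mem_smallSubsets.mp ht).1 hl)
    exact div_nonneg zero_le_two (by linarith)

theorem card_sifted_le {α β : (l : ℕ) → ZMod l} {S : Finset ℕ}
    (hS : ∀ l ∈ S, l.Prime ∧ 5 ≤ l ∧ α l ≠ β l) {D : ℕ} (hD : 1 ≤ D) (N : ℕ) :
    (((Finset.range N).filter fun j : ℕ =>
      ∀ l ∈ S, (j : ZMod l) ≠ α l ∧ (j : ZMod l) ≠ β l).card : ℝ) ≤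
      N / sieveSum S D + 2 * D ^ 4 := by
  set T := smallSubsets S D with hT
  set h : Finset ℕ → ℝ := fun t => ∏ l ∈ t, 2 / ((l : ℝ) - 2) with hh
  set L := sieveSum S D with hL
  have hL1 : 1 ≤ L := one_le_sieveSum (fun l hl => (hS l hl).2.1) hD
  set A := (Finset.range N).filter fun j : ℕ =>
      ∀ l ∈ S, (j : ZMod l) ≠ α l ∧ (j : ZMod l) ≠ β l with hA
  set F : ℕ → ℝ := fun j => ∑ t ∈ T, h t * ∏ l ∈ t, sieveFun α β l j with hF
  have hFA : ∀ j ∈ A, F j = L := by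
    intro j hj
    rw [hF, hL, sieveSum]
    refine Finset.sum_congr rfl fun t ht => ?_
    rw [Finset.prod_eq_one, mul_one]
    intro l hl
    have := (Finset.mem_filter.mp hj).2 l ((mem_smallSubsets.mp ht).1 hl)
    simp [sieveFun, this.1, this.2]
  have hlow : A.card * L ^ 2 ≤ ∑ j ∈ Finset.range N, F j ^ 2 := by
    calc A.card * L ^ 2 = ∑ j ∈ A, F j ^ 2 := by
          rw [Finset.sum_congr rfl fun j hj => by rw [hFA j hj]]
          simp
      _ ≤ _ := Finset.sum_le_sum_of_subset_of_nonneg (Finset.filter_subset _ _)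
          fun _ _ _ => sq_nonneg _
  have hh0 : ∀ t ∈ T, 0 ≤ h t := fun t ht => Finset.prod_nonneg fun l hl => by
    have : (5 : ℝ) ≤ l := by exact_mod_cast (hS l ((mem_smallSubsets.mp ht).1 hl)).2.1
    exact div_nonneg zero_le_two (by linarith)
  have hinv : ∀ t ∈ T, h t * ∏ l ∈ t, ((l : ℝ) - 2) / 2 = 1 := by
    intro t ht
    rw [hh, ← Finset.prod_mul_distrib]
    refine Finset.prod_eq_one fun l hl => ?_
    have : (5 : ℝ) ≤ l := by exact_mod_cast (hS l ((mem_smallSubsets.mp ht).1 hl)).2.1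
    have : (l : ℝ) - 2 ≠ 0 := by linarith
    field_simp
  have hup : ∑ j ∈ Finset.range N, F j ^ 2 ≤ N * L + 2 * D ^ 4 := by
    calc ∑ j ∈ Finset.range N, F j ^ 2
        = ∑ t ∈ T, ∑ t' ∈ T, h t * h t' * ∑ j ∈ Finset.range N,
            (∏ l ∈ t, sieveFun α β l j) * (∏ l ∈ t', sieveFun α β l j) := by
          have e : ∀ j, F j ^ 2 = ∑ t ∈ T, ∑ t' ∈ T, h t * h t' *
              ((∏ l ∈ t, sieveFun α β l j) * (∏ l ∈ t', sieveFun α β l j)) := by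
            intro j
            rw [sq, hF, Finset.sum_mul_sum]
            exact Finset.sum_congr rfl fun t _ => Finset.sum_congr rfl fun t' _ => by ring
          simp only [e]
          rw [Finset.sum_comm]
          refine Finset.sum_congr rfl fun t _ => ?_
          rw [Finset.sum_comm]
          simp only [Finset.mul_sum]
      _ ≤ ∑ t ∈ T, ∑ t' ∈ T, ((if t = t' then N * h t else 0) + 2 * D ^ 2) := by
          refine Finset.sum_le_sum fun t ht => Finset.sum_le_sum fun t' ht' => ?_
          refine (mul_le_mul_of_nonneg_left (sum_range_sieveFun_prod_le hS ht ht' N)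
            (mul_nonneg (hh0 t ht) (hh0 t' ht'))).trans (le_of_eq ?_)
          have e1 := hinv t ht
          have e2 := hinv t' ht'
          rw [mul_add]
          congr 1
          · split_ifs with he
            · subst he
              linear_combination (N * h t) * e1
            · simp
          · linear_combination 2 * (D : ℝ) ^ 2 * (h t' * ∏ l ∈ t', ((l : ℝ) - 2) / 2) * e1 +
              2 * (D : ℝ) ^ 2 * e2
      _ = N * L + 2 * D ^ 2 * (T.card * T.card) := by
          simp only [Finset.sum_add_distrib, Finset.sum_const, nsmul_eq_mul]
          congr 1
          · rw [hL, sieveSum, Finset.mul_sum]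
            refine Finset.sum_congr rfl fun t ht => ?_
            rw [Finset.sum_ite_eq, if_pos ht]
          · ring
      _ ≤ N * L + 2 * D ^ 4 := by
          have : (T.card : ℝ) ≤ D := by
            exact_mod_cast card_smallSubsets_le (fun l hl => (hS l hl).1) D
          have h2 : (T.card : ℝ) * T.card ≤ D * D := by gcongr
          nlinarith [sq_nonneg (D : ℝ)]
  have hL0 : 0 < L := by linarith
  have hD4 : (0 : ℝ) ≤ 2 * D ^ 4 := by positivity
  have hfin := hlow.trans hup
  have e : A.card * L ^ 2 ≤ (N / L + 2 * D ^ 4) * L ^ 2 := by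
    refine hfin.trans ?_
    rw [add_mul]
    have : N / L * L ^ 2 = N * L := by field_simp
    have h1 : 2 * (D : ℝ) ^ 4 * 1 ≤ 2 * D ^ 4 * L ^ 2 :=
      mul_le_mul_of_nonneg_left (by nlinarith) hD4
    rw [this]
    linarith
  exact le_of_mul_le_mul_right e (by positivity)

lemma sum_le_sum_of_injOn {ι κ : Type*} {s : Finset ι} {t : Finset κ} {f : ι → ℝ} {g : κ → ℝ}
    (i : ι → κ) (hi : ∀ a ∈ s, i a ∈ t) (hinj : Set.InjOn i s) (hfg : ∀ a ∈ s, f a ≤ g (i a))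
    (hg : ∀ b ∈ t, 0 ≤ g b) : ∑ a ∈ s, f a ≤ ∑ b ∈ t, g b := by
  calc ∑ a ∈ s, f a ≤ ∑ a ∈ s, g (i a) := Finset.sum_le_sum hfg
    _ = ∑ b ∈ s.image i, g b := (Finset.sum_image hinj).symm
    _ ≤ _ := Finset.sum_le_sum_of_subset_of_nonneg (Finset.image_subset_iff.mpr hi)
        fun b hb _ => hg b hb

lemma sum_inv_le_prod_of_primeFactors_eq {s : Finset ℕ} (hs : ∀ l ∈ s, l.Prime)
    {A : Finset ℕ} (hA : ∀ n ∈ A, n ≠ 0 ∧ n.primeFactors = s) :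
    ∑ n ∈ A, (n : ℝ)⁻¹ ≤ ∏ l ∈ s, 1 / ((l : ℝ) - 1) := by
  let f : ℕ →* ℝ := ⟨⟨fun n => (n : ℝ)⁻¹, by simp⟩, fun m n => by simp [mul_comm]⟩
  have hE := (EulerProduct.summable_and_hasSum_factoredNumbers_prod_filter_prime_geometric
    (f := f) (fun {p} hp => by
      have : (1 : ℝ) < p := by exact_mod_cast hp.one_lt
      simp only [f, MonoidHom.coe_mk, OneHom.coe_mk, norm_inv, Real.norm_natCast]
      exact inv_lt_one_of_one_lt₀ this) s).2
  rw [Finset.filter_true_of_mem hs] at hE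
  have hQ0 : 0 < ∏ l ∈ s, l := Finset.prod_pos fun l hl => (hs l hl).pos
  have hdvd : ∀ n ∈ A, ∏ l ∈ s, l ∣ n := fun n hn => by
    rw [← (hA n hn).2]; exact Nat.prod_primeFactors_dvd n
  have hmem : ∀ n ∈ A, n / ∏ l ∈ s, l ∈ Nat.factoredNumbers s := fun n hn =>
    Nat.mem_factoredNumbers_of_dvd
      (Nat.mem_factoredNumbers_of_primeFactors_subset (hA n hn).1 (hA n hn).2.le)
      (Nat.div_dvd_of_dvd (hdvd n hn))
  have h1 : ∑ n ∈ A.attach, f (n.1 / ∏ l ∈ s, l) ≤ ∏ l ∈ s, (1 - f l)⁻¹ := by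
    rw [← Finset.sum_image (s := A.attach) (f := fun m : Nat.factoredNumbers s => f m)
      (g := fun n => ⟨n.1 / ∏ l ∈ s, l, hmem n.1 n.2⟩)]
    · exact sum_le_hasSum _ (fun i _ => by simp [f]) hE
    · intro a _ b _ hab
      have h := congrArg Subtype.val hab
      simp only at h
      exact Subtype.ext ((Nat.div_left_inj (hdvd _ a.2) (hdvd _ b.2)).mp h)
  rw [Finset.sum_attach A (fun n => f (n / ∏ l ∈ s, l))] at h1
  have h2 : ∑ n ∈ A, (n : ℝ)⁻¹ = (∏ l ∈ s, (l : ℝ)⁻¹) * ∑ n ∈ A, f (n / ∏ l ∈ s, l) := by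
    rw [Finset.mul_sum]
    refine Finset.sum_congr rfl fun n hn => ?_
    obtain ⟨c, hc⟩ := hdvd n hn
    simp only [f, MonoidHom.coe_mk, OneHom.coe_mk]
    rw [hc, Nat.mul_div_cancel_left _ hQ0]
    push_cast
    rw [mul_inv, Finset.prod_inv_distrib]
  rw [h2]
  refine (mul_le_mul_of_nonneg_left h1 (Finset.prod_nonneg fun l _ => by positivity)).trans ?_
  rw [← Finset.prod_mul_distrib]
  refine Finset.prod_le_prod (fun l hl => ?_) fun l hl => ?_
  · have : (1 : ℝ) < l := by exact_mod_cast (hs l hl).one_lt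
    simp only [f, MonoidHom.coe_mk, OneHom.coe_mk]
    have : (l : ℝ)⁻¹ < 1 := inv_lt_one_of_one_lt₀ this
    exact mul_nonneg (by positivity) (inv_nonneg.mpr (by linarith))
  · have : (1 : ℝ) < l := by exact_mod_cast (hs l hl).one_lt
    have h3 : (l : ℝ) - 1 ≠ 0 := by linarith
    simp only [f, MonoidHom.coe_mk, OneHom.coe_mk]
    refine le_of_eq ?_
    have h4 : 1 - (l : ℝ)⁻¹ ≠ 0 := by
      rw [sub_ne_zero]; intro h; apply h3; field_simp at h; linarith
    field_simp

/-- The primes up to `D` that do not divide `K`. -/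
noncomputable def sievePrimes (K D : ℕ) : Finset ℕ :=
  (Finset.Icc 1 D).filter fun l => l.Prime ∧ ¬ l ∣ K

lemma mem_sievePrimes {K D l : ℕ} : l ∈ sievePrimes K D ↔ l ≤ D ∧ l.Prime ∧ ¬ l ∣ K := by
  simp only [sievePrimes, Finset.mem_filter, Finset.mem_Icc]
  exact ⟨fun h => ⟨h.1.2, h.2⟩, fun h => ⟨⟨h.2.1.pos, h.1⟩, h.2⟩⟩

lemma prod_one_div_sub_one_nonneg {s : Finset ℕ} (hs : ∀ l ∈ s, l.Prime) :
    0 ≤ ∏ l ∈ s, 1 / ((l : ℝ) - 1) := Finset.prod_nonneg fun l hl => by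
  have : (1 : ℝ) < l := by exact_mod_cast (hs l hl).one_lt
  exact div_nonneg zero_le_one (by linarith)

lemma div_totient_eq_sum_powerset {K : ℕ} (hK : K ≠ 0) :
    (K : ℝ) / K.totient = ∑ s ∈ K.primeFactors.powerset, ∏ l ∈ s, 1 / ((l : ℝ) - 1) := by
  rw [← Finset.prod_one_add]
  have h := Nat.totient_eq_mul_prod_factors K
  have h' : (K.totient : ℝ) = K * ∏ p ∈ K.primeFactors, (1 - (p : ℝ)⁻¹) := by
    have := congrArg (fun x : ℚ => (x : ℝ)) h
    push_cast at this
    exact this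
  have hK' : (K : ℝ) ≠ 0 := by exact_mod_cast hK
  rw [h', ← div_div, div_self hK', one_div, ← Finset.prod_inv_distrib]
  refine Finset.prod_congr rfl fun l hl => ?_
  have : (1 : ℝ) < l := by exact_mod_cast (Nat.prime_of_mem_primeFactors hl).one_lt
  have h3 : (l : ℝ) - 1 ≠ 0 := by linarith
  have h4 : 1 - (l : ℝ)⁻¹ ≠ 0 := by
      rw [sub_ne_zero]; intro h; apply h3; field_simp at h; linarith
  field_simp
  ring

lemma log_le_mul_sum_smallSubsets {K y D : ℕ} (hK : K ≠ 0) (hyD : y ≤ D) :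
    Real.log (y + 1) ≤ (K : ℝ) / K.totient *
      ∑ t ∈ smallSubsets (sievePrimes K D) y, ∏ l ∈ t, 1 / ((l : ℝ) - 1) := by
  set W : Finset ℕ → ℝ := fun t => ∏ l ∈ t, 1 / ((l : ℝ) - 1) with hW
  have hT : ∀ s ∈ (Finset.Icc 1 y).image Nat.primeFactors, ∀ l ∈ s, l.Prime := by
    intro s hs l hl
    obtain ⟨n, _, rfl⟩ := Finset.mem_image.mp hs
    exact Nat.prime_of_mem_primeFactors hl
  have h1 : Real.log (y + 1) ≤ ∑ n ∈ Finset.Icc 1 y, (n : ℝ)⁻¹ := by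
    have := log_add_one_le_harmonic y
    rw [harmonic_eq_sum_Icc] at this
    push_cast at this
    exact this
  have h2 : ∑ n ∈ Finset.Icc 1 y, (n : ℝ)⁻¹ ≤
      ∑ s ∈ (Finset.Icc 1 y).image Nat.primeFactors, W s := by
    rw [← Finset.sum_fiberwise_of_maps_to (g := Nat.primeFactors)
      (t := (Finset.Icc 1 y).image Nat.primeFactors) fun i hi => Finset.mem_image_of_mem _ hi]
    refine Finset.sum_le_sum fun s hs => sum_inv_le_prod_of_primeFactors_eq (hT s hs) ?_
    intro n hn
    simp only [Finset.mem_filter, Finset.mem_Icc] at hn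
    exact ⟨by omega, hn.2⟩
  refine h1.trans (h2.trans ?_)
  rw [div_totient_eq_sum_powerset hK, Finset.sum_mul_sum, ← Finset.sum_product']
  refine sum_le_sum_of_injOn (fun s => (s.filter (· ∣ K), s.filter fun l => ¬ l ∣ K)) ?_ ?_ ?_ ?_
  · intro s hs
    obtain ⟨n, hn, rfl⟩ := Finset.mem_image.mp hs
    simp only [Finset.mem_product, Finset.mem_powerset, mem_smallSubsets]
    have hn := Finset.mem_Icc.mp hn
    have hle : ∏ l ∈ n.primeFactors, l ≤ y :=
      (Nat.le_of_dvd (by omega) (Nat.prod_primeFactors_dvd n)).trans hn.2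
    refine ⟨?_, ?_, ?_⟩
    · intro l hl
      rw [Finset.mem_filter] at hl
      exact Nat.mem_primeFactors.mpr ⟨Nat.prime_of_mem_primeFactors hl.1, hl.2, hK⟩
    · intro l hl
      rw [Finset.mem_filter] at hl
      exact mem_sievePrimes.mpr ⟨((Nat.le_of_mem_primeFactors hl.1).trans hn.2).trans hyD,
        Nat.prime_of_mem_primeFactors hl.1, hl.2⟩
    · refine le_trans ?_ hle
      exact Finset.prod_le_prod_of_subset_of_one_le' (Finset.filter_subset _ _)
        fun l hl _ => (Nat.prime_of_mem_primeFactors hl).pos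
  · intro s _ s' _ h
    have h := Prod.mk.inj h
    rw [← Finset.filter_union_filter_not_eq (· ∣ K) s,
      ← Finset.filter_union_filter_not_eq (· ∣ K) s', h.1, h.2]
  · intro s _
    simp only [hW]
    rw [Finset.prod_filter_mul_prod_filter_not]
  · rintro ⟨s, t⟩ hst
    simp only [Finset.mem_product, Finset.mem_powerset, mem_smallSubsets] at hst
    exact mul_nonneg (prod_one_div_sub_one_nonneg fun l hl =>
      Nat.prime_of_mem_primeFactors (hst.1 hl)) (prod_one_div_sub_one_nonneg fun l hl =>
      (mem_sievePrimes.mp (hst.2.1 hl)).2.1)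

lemma sq_sum_smallSubsets_le {S : Finset ℕ} (hS : ∀ l ∈ S, l.Prime ∧ 5 ≤ l) {y D : ℕ}
    (hy : y * y ≤ D) :
    (∑ t ∈ smallSubsets S y, ∏ l ∈ t, 1 / ((l : ℝ) - 1)) ^ 2 ≤ sieveSum S D := by
  set W : Finset ℕ → ℝ := fun t => ∏ l ∈ t, 1 / ((l : ℝ) - 1) with hW
  have hW0 : ∀ t ⊆ S, 0 ≤ W t := fun t ht =>
    prod_one_div_sub_one_nonneg fun l hl => (hS l (ht hl)).1
  have h1 : ∑ s ∈ smallSubsets S D, ∑ t ∈ s.powerset, ∑ r ∈ t.powerset, W t * W (s \ t) * W r ≤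
      sieveSum S D := by
    refine Finset.sum_le_sum fun s hs => ?_
    have hsS := (mem_smallSubsets.mp hs).1
    have e : ∑ t ∈ s.powerset, ∑ r ∈ t.powerset, W t * W (s \ t) * W r =
        ∏ l ∈ s, ((1 / ((l : ℝ) - 1)) * (1 + 1 / ((l : ℝ) - 1)) + 1 / ((l : ℝ) - 1)) := by
      rw [Finset.prod_add]
      refine Finset.sum_congr rfl fun t _ => ?_
      rw [← Finset.mul_sum, Finset.prod_mul_distrib, Finset.prod_one_add]
      ring
    rw [e]
    refine Finset.prod_le_prod (fun l hl => ?_) fun l hl => ?_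
    · have : (5 : ℝ) ≤ l := by exact_mod_cast (hS l (hsS hl)).2
      have : 0 < (l : ℝ) - 1 := by linarith
      positivity
    · have : (5 : ℝ) ≤ l := by exact_mod_cast (hS l (hsS hl)).2
      have h1 : 0 < (l : ℝ) - 1 := by linarith
      have h2 : 0 < (l : ℝ) - 2 := by linarith
      have h5 : 0 ≤ (l : ℝ) / (((l : ℝ) - 2) * ((l : ℝ) - 1) ^ 2) := by positivity
      have h6 : 2 / ((l : ℝ) - 2) = (1 / ((l : ℝ) - 1)) * (1 + 1 / ((l : ℝ) - 1)) +
          1 / ((l : ℝ) - 1) + (l : ℝ) / (((l : ℝ) - 2) * ((l : ℝ) - 1) ^ 2) := by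
        have h1' := h1.ne'
        have h2' := h2.ne'
        field_simp
        ring
      rw [h6]
      linarith
  refine le_trans ?_ h1
  rw [sq, Finset.sum_mul_sum, ← Finset.sum_product']
  simp only [Finset.sum_sigma']
  refine sum_le_sum_of_injOn (fun x => ⟨x.1 ∪ x.2, ⟨x.1, x.1 ∩ x.2⟩⟩) ?_ ?_ ?_ ?_
  · rintro ⟨t, t'⟩ h
    simp only [Finset.mem_product, mem_smallSubsets] at h
    simp only [Finset.mem_sigma, mem_smallSubsets, Finset.mem_powerset]
    refine ⟨⟨Finset.union_subset h.1.1 h.2.1, ?_⟩, Finset.subset_union_left,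
      Finset.inter_subset_left⟩
    calc ∏ l ∈ t ∪ t', l ≤ (∏ l ∈ t ∪ t', l) * ∏ l ∈ t ∩ t', l :=
          Nat.le_mul_of_pos_right _ (Finset.prod_pos fun l hl =>
            (hS l (h.1.1 (Finset.mem_of_mem_inter_left hl))).1.pos)
      _ = (∏ l ∈ t, l) * ∏ l ∈ t', l := Finset.prod_union_inter
      _ ≤ D := (Nat.mul_le_mul h.1.2 h.2.2).trans hy
  · rintro ⟨t, t'⟩ _ ⟨u, u'⟩ _ h
    simp only [Sigma.mk.injEq, heq_eq_eq] at h
    obtain ⟨h1, h2, h3⟩ := h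
    subst h2
    congr 1
    ext l
    have e1 := Finset.ext_iff.mp h1 l
    have e3 := Finset.ext_iff.mp h3 l
    simp only [Finset.mem_union, Finset.mem_inter] at e1 e3
    tauto
  · rintro ⟨t, t'⟩ h
    simp only [Finset.mem_product, mem_smallSubsets] at h
    simp only
    have e : (t ∪ t') \ t = t' \ t := by
      ext l; simp only [Finset.mem_sdiff, Finset.mem_union]; tauto
    rw [e, mul_assoc]
    refine le_of_eq ?_
    congr 1
    have : t' = (t' \ t) ∪ (t ∩ t') := by
      ext l; simp only [Finset.mem_sdiff, Finset.mem_union, Finset.mem_inter]; tauto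
    conv_lhs => rw [this]
    simp only [hW]
    rw [Finset.prod_union]
    rw [Finset.disjoint_left]
    intro l hl hl'
    simp only [Finset.mem_sdiff, Finset.mem_inter] at hl hl'
    exact hl.2 hl'.1
  · rintro ⟨s, t, r⟩ h
    simp only [Finset.mem_sigma, mem_smallSubsets, Finset.mem_powerset] at h
    exact mul_nonneg (mul_nonneg (hW0 t (h.2.1.trans h.1.1))
      (hW0 _ (Finset.sdiff_subset.trans h.1.1))) (hW0 r (h.2.2.trans (h.2.1.trans h.1.1)))

theorem sq_log_le_mul_sieveSum {K D : ℕ} (hK : K ≠ 0) (h6 : 6 ∣ K) (hD : 1 ≤ D) :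
    (Real.log D) ^ 2 ≤ 4 * ((K : ℝ) / K.totient) ^ 2 * sieveSum (sievePrimes K D) D := by
  have hS : ∀ l ∈ sievePrimes K D, l.Prime ∧ 5 ≤ l := by
    intro l hl
    obtain ⟨_, hp, hdvd⟩ := mem_sievePrimes.mp hl
    refine ⟨hp, ?_⟩
    by_contra! h
    interval_cases l
    · exact absurd hp (by norm_num)
    · exact absurd hp (by norm_num)
    · exact hdvd ((by norm_num : 2 ∣ 6).trans h6)
    · exact hdvd ((by norm_num : 3 ∣ 6).trans h6)
    · exact absurd hp (by norm_num)
  set y := Nat.sqrt D with hy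
  have h1 := log_le_mul_sum_smallSubsets hK (Nat.sqrt_le_self D) (K := K)
  have h2 := sq_sum_smallSubsets_le hS (Nat.sqrt_le D)
  have hD' : (1 : ℝ) ≤ D := by exact_mod_cast hD
  have h3 : Real.log D ≤ 2 * Real.log (y + 1) := by
    have : (D : ℝ) ≤ ((y : ℝ) + 1) ^ 2 := by
      have := (Nat.lt_succ_sqrt D).le
      rw [sq]
      exact_mod_cast this
    have h4 := Real.log_le_log (by linarith) this
    rw [Real.log_pow] at h4
    exact_mod_cast h4
  have h0 : 0 ≤ Real.log D := Real.log_nonneg hD'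
  have h5 := h3.trans (mul_le_mul_of_nonneg_left h1 zero_le_two)
  refine (pow_le_pow_left₀ h0 h5 2).trans ?_
  rw [mul_pow, mul_pow, ← mul_assoc]
  norm_num
  exact mul_le_mul_of_nonneg_left (by simpa using h2) (by positivity)

lemma div_totient_eq_prod {m : ℕ} (hm : m ≠ 0) :
    (m : ℝ) / m.totient = ∏ l ∈ m.primeFactors, (1 + 1 / ((l : ℝ) - 1)) := by
  rw [div_totient_eq_sum_powerset hm, Finset.prod_one_add]

lemma one_add_sq_le {l : ℕ} (hl : 7 ≤ l) :
    (1 + 1 / ((l : ℝ) - 1)) ^ 2 ≤ 1 + 1 / √(l : ℝ) := by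
  have h7 : (7 : ℝ) ≤ l := by exact_mod_cast hl
  set s := √(l : ℝ) with hs
  have hs2 : s ^ 2 = l := Real.sq_sqrt (by linarith)
  have hs0 : 0 ≤ s := Real.sqrt_nonneg _
  have hs1 : (2.6 : ℝ) ≤ s := by
    refine Real.le_sqrt_of_sq_le ?_
    linarith
  rw [← hs2]
  have h1 : 0 < s ^ 2 - 1 := by nlinarith
  have e : 1 + 1 / (s ^ 2 - 1) = s ^ 2 / (s ^ 2 - 1) := by field_simp; ring
  have e' : 1 + 1 / s = (s + 1) / s := by field_simp
  rw [e, e', div_pow, div_le_div_iff₀ (by positivity) (by linarith)]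
  have h2 : s ^ 4 ≤ (s + 1) * (s ^ 2 - 1) ^ 2 / s := by
    rw [le_div_iff₀ (by linarith)]
    have h3 : s ^ 4 * s ≤ (s + 1) * (s ^ 2 - 1) ^ 2 ↔
        0 ≤ s ^ 4 - 2 * s ^ 3 - 2 * s ^ 2 + s + 1 := by
      constructor <;> intro h <;> nlinarith
    rw [h3]
    have h4 : 0 ≤ s ^ 2 - 2 * s - 1.5 := by nlinarith
    nlinarith [mul_nonneg h4 (sq_nonneg s), mul_nonneg hs0 (by linarith : 0 ≤ s - 2.6)]
  rw [le_div_iff₀ (by linarith)] at h2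
  nlinarith

lemma sq_div_totient_le {m : ℕ} (hm : m ≠ 0) :
    ((m : ℝ) / m.totient) ^ 2 ≤ 4 ^ 7 * ∑ d ∈ m.divisors, 1 / √(d : ℝ) := by
  rw [div_totient_eq_prod hm, ← Finset.prod_pow]
  calc ∏ l ∈ m.primeFactors, (1 + 1 / ((l : ℝ) - 1)) ^ 2
      ≤ ∏ l ∈ m.primeFactors, (if l < 7 then 4 else 1) * (1 + 1 / √(l : ℝ)) := by
        refine Finset.prod_le_prod (fun _ _ => sq_nonneg _) fun l hl => ?_
        have h2 : (2 : ℝ) ≤ l := by exact_mod_cast (Nat.prime_of_mem_primeFactors hl).two_le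
        split_ifs with h7
        · have h1 : 1 / ((l : ℝ) - 1) ≤ 1 := by
            rw [div_le_one (by linarith)]; linarith
          have h0 : 0 ≤ 1 / ((l : ℝ) - 1) := div_nonneg zero_le_one (by linarith)
          have h3 : 0 ≤ 1 / √(l : ℝ) := by positivity
          nlinarith
        · rw [one_mul]
          exact one_add_sq_le (by omega)
    _ = (∏ l ∈ m.primeFactors, if l < 7 then (4 : ℝ) else 1) *
          ∏ l ∈ m.primeFactors, (1 + 1 / √(l : ℝ)) := Finset.prod_mul_distrib
    _ ≤ 4 ^ 7 * ∑ d ∈ m.divisors, 1 / √(d : ℝ) := by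
        refine mul_le_mul ?_ ?_ (Finset.prod_nonneg fun _ _ => by positivity) (by positivity)
        · rw [← Finset.prod_filter, Finset.prod_const]
          refine pow_le_pow_right₀ (by norm_num) ?_
          calc _ ≤ (Finset.range 7).card := Finset.card_le_card fun l hl => by
                simpa using (Finset.mem_filter.mp hl).2
            _ = 7 := Finset.card_range 7
        · rw [Finset.prod_one_add]
          refine sum_le_sum_of_injOn (fun t => ∏ l ∈ t, l) ?_ ?_ ?_ fun _ _ => by positivity
          · intro t ht
            rw [Finset.mem_powerset] at ht
            exact Nat.mem_divisors.mpr ⟨(Finset.prod_dvd_prod_of_subset _ _ _ ht).trans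
              (Nat.prod_primeFactors_dvd m), hm⟩
          · intro t ht t' ht' h
            exact prod_id_injOn_primes (S := m.primeFactors)
              (fun l hl => Nat.prime_of_mem_primeFactors hl)
              (Finset.mem_powerset.mp ht) (Finset.mem_powerset.mp ht') h
          · intro t _
            push_cast
            rw [Real.sqrt_prod _ fun _ _ => Nat.cast_nonneg _]
            simp

lemma exists_sum_sq_div_totient_le :
    ∃ C : ℝ, 0 < C ∧ ∀ M : ℕ,
      ∑ m ∈ Finset.Icc 1 M, ((m : ℝ) / m.totient) ^ 2 / m ≤ C * (1 + Real.log M) := by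
  have hsum : Summable fun d : ℕ => 1 / (d : ℝ) ^ ((3 : ℝ) / 2) :=
    Real.summable_one_div_nat_rpow.mpr (by norm_num)
  set Z := ∑' d : ℕ, 1 / (d : ℝ) ^ ((3 : ℝ) / 2) with hZ
  have hZ0 : 0 ≤ Z := tsum_nonneg fun d => by positivity
  refine ⟨4 ^ 7 * (Z + 1), by positivity, fun M => ?_⟩
  have h1 : ∑ m ∈ Finset.Icc 1 M, ((m : ℝ) / m.totient) ^ 2 / m ≤
      4 ^ 7 * ∑ m ∈ Finset.Icc 1 M, ∑ d ∈ m.divisors, 1 / √(d : ℝ) / m := by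
    rw [Finset.mul_sum]
    refine Finset.sum_le_sum fun m hm => ?_
    rw [← Finset.sum_div, ← mul_div_assoc]
    exact div_le_div_of_nonneg_right (sq_div_totient_le (by
      have := (Finset.mem_Icc.mp hm).1; omega)) (Nat.cast_nonneg _)
  have h2 : ∑ m ∈ Finset.Icc 1 M, ∑ d ∈ m.divisors, 1 / √(d : ℝ) / m ≤
      (∑ d ∈ Finset.Icc 1 M, 1 / (d : ℝ) ^ ((3 : ℝ) / 2)) * ∑ k ∈ Finset.Icc 1 M, (k : ℝ)⁻¹ := by
    rw [Finset.sum_mul_sum, ← Finset.sum_product', Finset.sum_sigma']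
    refine sum_le_sum_of_injOn (fun x => (x.2, x.1 / x.2)) ?_ ?_ ?_ fun _ _ => by positivity
    · rintro ⟨m, d⟩ h
      simp only [Finset.mem_sigma, Finset.mem_Icc, Nat.mem_divisors] at h
      have hd0 : 0 < d := Nat.pos_of_dvd_of_pos h.2.1 h.1.1
      have hdm : d ≤ m := Nat.le_of_dvd h.1.1 h.2.1
      simp only [Finset.mem_product, Finset.mem_Icc]
      exact ⟨⟨hd0, hdm.trans h.1.2⟩, Nat.div_pos hdm hd0, (Nat.div_le_self _ _).trans h.1.2⟩
    · rintro ⟨m, d⟩ h ⟨m', d'⟩ h' he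
      simp only [Finset.coe_sigma, Set.mem_sigma_iff, Finset.mem_coe, Nat.mem_divisors] at h h'
      simp only [Prod.mk.injEq] at he
      obtain ⟨rfl, he⟩ := he
      have := (Nat.div_left_inj h.2.1 h'.2.1).mp he
      subst this
      rfl
    · rintro ⟨m, d⟩ h
      simp only [Finset.mem_sigma, Finset.mem_Icc, Nat.mem_divisors] at h
      obtain ⟨c, rfl⟩ := h.2.1
      have hd0 : 0 < d := Nat.pos_of_dvd_of_pos h.2.1 h.1.1
      have hd0' : (0 : ℝ) < d := by exact_mod_cast hd0
      simp only
      rw [Nat.mul_div_cancel_left _ hd0]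
      have e : (d : ℝ) ^ ((3 : ℝ) / 2) = √(d : ℝ) * d := by
        rw [Real.sqrt_eq_rpow]
        nth_rewrite 3 [← Real.rpow_one (d : ℝ)]
        rw [← Real.rpow_add hd0']
        norm_num
      rw [e]
      push_cast
      refine le_of_eq ?_
      rw [div_div, ← one_div, div_mul_div_comm, mul_assoc, one_mul]
  have h3 : ∑ d ∈ Finset.Icc 1 M, 1 / (d : ℝ) ^ ((3 : ℝ) / 2) ≤ Z :=
    hsum.sum_le_tsum _ fun _ _ => by positivity
  have h4 : ∑ k ∈ Finset.Icc 1 M, (k : ℝ)⁻¹ ≤ 1 + Real.log M := by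
    have := harmonic_le_one_add_log M
    rw [harmonic_eq_sum_Icc] at this
    push_cast at this
    exact this
  have h5 : 0 ≤ ∑ k ∈ Finset.Icc 1 M, (k : ℝ)⁻¹ := Finset.sum_nonneg fun _ _ => by positivity
  calc _ ≤ 4 ^ 7 * (Z * (1 + Real.log M)) := h1.trans (by
          refine mul_le_mul_of_nonneg_left (h2.trans ?_) (by positivity)
          exact mul_le_mul h3 h4 h5 hZ0)
    _ ≤ _ := by
      rw [mul_assoc]
      refine mul_le_mul_of_nonneg_left ?_ (by positivity)
      exact mul_le_mul_of_nonneg_right (by linarith) (h5.trans h4)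

/-- Upper bound for the number of primes `n` in a residue class modulo `k` such that
`a * n + 1` is prime as well. -/
theorem card_prime_pairs_le {a k K D N c : ℕ} (hK : K ≠ 0) (h6 : 6 ∣ K) (hD : 2 ≤ D)
    (ha : a ≠ 0) (hak : ∀ l : ℕ, l.Prime → ¬ l ∣ K → ¬ l ∣ a ∧ ¬ l ∣ k) {B : Finset ℕ}
    (hB : ∀ n ∈ B, n % k = c ∧ n.Prime ∧ (a * n + 1).Prime ∧ D < n ∧ n / k < N) :
    (B.card : ℝ) ≤ 4 * ((K : ℝ) / K.totient) ^ 2 * N / (Real.log D) ^ 2 + 2 * D ^ 4 := by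
  set S := sievePrimes K D with hSdef
  set α : (l : ℕ) → ZMod l := fun l => -c * (k : ZMod l)⁻¹ with hα
  set β : (l : ℕ) → ZMod l := fun l => (-(a : ZMod l)⁻¹ - c) * (k : ZMod l)⁻¹ with hβ
  have hne : ∀ l ∈ S, (a : ZMod l) ≠ 0 ∧ (k : ZMod l) ≠ 0 := by
    intro l hl
    obtain ⟨_, hp, hd⟩ := mem_sievePrimes.mp hl
    rw [Ne, Ne, ZMod.natCast_eq_zero_iff, ZMod.natCast_eq_zero_iff]
    exact hak l hp hd
  have hS : ∀ l ∈ S, l.Prime ∧ 5 ≤ l ∧ α l ≠ β l := by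
    intro l hl
    obtain ⟨ha', hk'⟩ := hne l hl
    obtain ⟨_, hp, hdvd⟩ := mem_sievePrimes.mp hl
    refine ⟨hp, ?_, ?_⟩
    · by_contra! h
      interval_cases l
      · exact absurd hp (by norm_num)
      · exact absurd hp (by norm_num)
      · exact hdvd ((by norm_num : 2 ∣ 6).trans h6)
      · exact hdvd ((by norm_num : 3 ∣ 6).trans h6)
      · exact absurd hp (by norm_num)
    · have : Fact l.Prime := ⟨hp⟩
      intro h
      have h1 := mul_right_cancel₀ (inv_ne_zero hk') h
      have : (a : ZMod l)⁻¹ = 0 := by linear_combination h1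
      exact inv_ne_zero ha' this
  have h1 := card_sifted_le hS (by omega : 1 ≤ D) N
  have h2 : B.card ≤ ((Finset.range N).filter fun j : ℕ =>
      ∀ l ∈ S, (j : ZMod l) ≠ α l ∧ (j : ZMod l) ≠ β l).card := by
    refine Finset.card_le_card_of_injOn (fun n => n / k) ?_ ?_
    · intro n hn
      obtain ⟨hc, hn1, hn2, hn3, hn4⟩ := hB n hn
      simp only [Finset.coe_filter, Finset.mem_range, Set.mem_ofPred_eq]
      refine ⟨hn4, fun l hl => ?_⟩
      obtain ⟨ha', hk'⟩ := hne l hl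
      obtain ⟨hlD, hp, _⟩ := mem_sievePrimes.mp hl
      have : Fact l.Prime := ⟨hp⟩
      have hnk : (n : ZMod l) = k * (n / k : ℕ) + c := by
        rw [← hc]
        exact_mod_cast congrArg (Nat.cast : ℕ → ZMod l) (Nat.div_add_mod n k).symm
      have hl1 : ¬ l ∣ n := fun h => by
        have := (Nat.prime_dvd_prime_iff_eq hp hn1).mp h
        omega
      have hl2 : ¬ l ∣ a * n + 1 := fun h => by
        have := (Nat.prime_dvd_prime_iff_eq hp hn2).mp h
        have : 1 * n ≤ a * n := Nat.mul_le_mul_right n (by omega)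
        omega
      constructor
      · intro h
        apply hl1
        rw [← ZMod.natCast_eq_zero_iff, hnk, h, hα]
        simp only
        field_simp
        ring
      · intro h
        apply hl2
        rw [← ZMod.natCast_eq_zero_iff]
        push_cast
        rw [hnk, h, hβ]
        simp only
        field_simp
        ring
    · intro n hn n' hn' h
      have e1 := (hB n hn).1
      have e2 := (hB n' hn').1
      simp only at h
      rw [← Nat.div_add_mod n k, ← Nat.div_add_mod n' k, e1, e2, h]
  have hD' : (2 : ℝ) ≤ D := by exact_mod_cast hD
  have hlog : 0 < Real.log D := Real.log_pos (by linarith)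
  have h3 := sq_log_le_mul_sieveSum hK h6 (by omega : 1 ≤ D)
  have hL : 1 ≤ sieveSum S D := one_le_sieveSum (fun l hl => (hS l hl).2.1) (by omega)
  have h4 : (N : ℝ) / sieveSum S D ≤
      4 * ((K : ℝ) / K.totient) ^ 2 * N / (Real.log D) ^ 2 := by
    rw [div_le_div_iff₀ (by linarith) (by positivity)]
    calc (N : ℝ) * Real.log D ^ 2 ≤ N * (4 * ((K : ℝ) / K.totient) ^ 2 * sieveSum S D) := by gcongr
      _ = _ := by ring
  calc (B.card : ℝ) ≤ _ := by exact_mod_cast h2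
    _ ≤ _ := h1
    _ ≤ _ := by linarith

end UpperBoundSieve

section BadPairs

/-- The primes `n` for which `g * m * q * n + 1` is a prime at most `z` congruent to `u`
modulo `4 * p`, where `g` is the greatest common divisor of `u - 1` and `4 * p`. -/
noncomputable def primeCofactors (p : ℕ) (u : ℤ) (z : ℝ) (q m : ℕ) : Finset ℕ :=
  (Finset.range (⌊z⌋₊ + 1)).filter fun n => n.Prime ∧ z ^ ((1 : ℝ) / 100) < n ∧ 4 * p < n ∧
    (Int.gcd (u - 1) (4 * p) * m * q * n + 1).Prime ∧
    ((Int.gcd (u - 1) (4 * p) * m * q * n + 1 : ℕ) : ZMod (4 * p)) = (u : ZMod (4 * p)) ∧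
    ((Int.gcd (u - 1) (4 * p) * m * q * n + 1 : ℕ) : ℝ) ≤ z

lemma gcd_sub_one_eq {p r : ℕ} {u : ℤ} (hr : 1 ≤ r) (h : (r : ZMod (4 * p)) = (u : ZMod (4 * p))) :
    Int.gcd (u - 1) (4 * p) = Nat.gcd (r - 1) (4 * p) := by
  have h1 : ((r : ℤ) : ZMod (4 * p)) = (u : ZMod (4 * p)) := by simpa using h
  rw [ZMod.intCast_eq_intCast_iff] at h1
  have h2 : ((r : ℤ) - 1) % ((4 * p : ℕ) : ℤ) = (u - 1) % ((4 * p : ℕ) : ℤ) := h1.sub_right 1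
  have h3 : Int.gcd (u - 1) ((4 * p : ℕ) : ℤ) = Int.gcd ((r : ℤ) - 1) ((4 * p : ℕ) : ℤ) := by
    rw [← Int.gcd_emod, ← h2, Int.gcd_emod]
  have h4 : (r : ℤ) - 1 = ((r - 1 : ℕ) : ℤ) := by omega
  rw [h4, Int.gcd_natCast_natCast] at h3
  exact_mod_cast h3

lemma coprime_four_mul_of_lt {p n : ℕ} (hp : 0 < p) (hn : n.Prime) (h : 4 * p < n) :
    n.Coprime (4 * p) :=
  (Nat.Prime.coprime_iff_not_dvd hn).mpr fun hd => by
    have := Nat.le_of_dvd (by omega) hd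
    omega

lemma div_totient_le_two {q : ℕ} (hq : q.Prime) : (q : ℝ) / q.totient ≤ 2 := by
  have h2 : (2 : ℝ) ≤ q := by exact_mod_cast hq.two_le
  rw [Nat.totient_prime hq, Nat.cast_sub hq.one_le, div_le_iff₀ (by push_cast; linarith)]
  push_cast
  linarith

lemma div_totient_mul_le (a b : ℕ) :
    ((a * b : ℕ) : ℝ) / (a * b).totient ≤ (a / a.totient) * (b / b.totient) := by
  rcases Nat.eq_zero_or_pos a with rfl | ha
  · simp
  rcases Nat.eq_zero_or_pos b with rfl | hb
  · simp
  have h1 : (0 : ℝ) < a.totient := by exact_mod_cast Nat.totient_pos.mpr ha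
  have h2 : (0 : ℝ) < b.totient := by exact_mod_cast Nat.totient_pos.mpr hb
  rw [div_mul_div_comm, Nat.cast_mul]
  refine div_le_div_of_nonneg_left (by positivity) (by positivity) ?_
  exact_mod_cast Nat.totient_super_multiplicative a b

lemma div_totient_six_mul_le {p q m : ℕ} (hp : p.Prime) (hq : q.Prime) :
    ((6 * p * q * m : ℕ) : ℝ) / (6 * p * q * m).totient ≤ 12 * (m / m.totient) := by
  have h6 : ((6 : ℕ) : ℝ) / (6 : ℕ).totient = 3 := by
    have : (6 : ℕ).totient = 2 := by decide
    rw [this]; norm_num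
  have h0 : ∀ a : ℕ, 0 ≤ (a : ℝ) / a.totient := fun a => by positivity
  calc _ ≤ _ := div_totient_mul_le _ _
    _ ≤ 12 * (m / m.totient) := by
      refine mul_le_mul_of_nonneg_right ?_ (h0 m)
      calc _ ≤ _ := div_totient_mul_le _ _
        _ ≤ (3 * 2) * 2 := mul_le_mul ((div_totient_mul_le _ _).trans (by
            rw [h6]
            exact mul_le_mul_of_nonneg_left (div_totient_le_two hp) (by norm_num)))
            (div_totient_le_two hq) (h0 _) (by norm_num)
        _ = 12 := by norm_num

lemma card_primeCofactors_le {p : ℕ} (hp : p.Prime) {u : ℤ} {z : ℝ} (hz0 : 0 ≤ z)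
    (hz : 2 ≤ z ^ ((1 : ℝ) / 200)) {q m : ℕ} (hq : q.Prime) (hm : 1 ≤ m) :
    ((primeCofactors p u z q m).card : ℝ) ≤
      576 * 40000 * (m / m.totient) ^ 2 * (z / (4 * p * m * q) + 1) / (Real.log z) ^ 2 +
        2 * z ^ ((1 : ℝ) / 25) := by
  have hz1 : 1 < z := by
    by_contra! h
    have := Real.rpow_le_one hz0 h (by norm_num : (0 : ℝ) ≤ 1 / 200)
    linarith
  have hlogz : 0 < Real.log z := Real.log_pos hz1
  have hR : 0 ≤ 576 * 40000 * ((m : ℝ) / m.totient) ^ 2 * (z / (4 * p * m * q) + 1) /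
      (Real.log z) ^ 2 + 2 * z ^ ((1 : ℝ) / 25) := by positivity
  rcases (primeCofactors p u z q m).eq_empty_or_nonempty with he | ⟨n₀, hn₀⟩
  · rw [he]; simpa using hR
  set g := Int.gcd (u - 1) (4 * p) with hg
  have hp0 := hp.pos
  have hq0 := hq.pos
  have hg0 : 0 < g := Int.gcd_pos_of_ne_zero_right _ (by positivity)
  have hg4 : g ∣ 4 * p := by
    have := Int.gcd_dvd_right (u - 1) (4 * p)
    exact_mod_cast this
  obtain ⟨k, hk⟩ := hg4
  have hk0 : 0 < k := Nat.pos_of_ne_zero fun h => by subst h; omega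
  have hgcd : Nat.gcd (4 * p) (g * m * q) = g := by
    obtain ⟨_, h1, _, h3, _, h5, _⟩ := Finset.mem_filter.mp hn₀
    have e := gcd_sub_one_eq (by omega) h5
    rw [Nat.add_sub_cancel, Nat.Coprime.gcd_mul_right_cancel _
      (coprime_four_mul_of_lt hp0 h1 h3), ← hg] at e
    rw [Nat.gcd_comm, ← e]
  have hkdiv : 4 * p / g = k := by rw [hk, Nat.mul_div_cancel_left _ hg0]
  set D := ⌊z ^ ((1 : ℝ) / 100)⌋₊ with hD
  have hx2 : z ^ ((1 : ℝ) / 100) = (z ^ ((1 : ℝ) / 200)) ^ 2 := by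
    rw [← Real.rpow_natCast, ← Real.rpow_mul hz0]; norm_num
  have hDlow : z ^ ((1 : ℝ) / 200) ≤ D := by
    have := (Nat.lt_floor_add_one (z ^ ((1 : ℝ) / 100))).le
    rw [← hD] at this
    nlinarith
  have hD2 : 2 ≤ D := by exact_mod_cast hz.trans hDlow
  have hDlog : Real.log z / 200 ≤ Real.log D := by
    have := Real.log_le_log (by linarith) hDlow
    rw [Real.log_rpow (by linarith)] at this
    linarith
  have hDup : (D : ℝ) ^ 4 ≤ z ^ ((1 : ℝ) / 25) := by
    have : (D : ℝ) ≤ z ^ ((1 : ℝ) / 100) := Nat.floor_le (by positivity)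
    calc (D : ℝ) ^ 4 ≤ (z ^ ((1 : ℝ) / 100)) ^ 4 := by gcongr
      _ = _ := by rw [← Real.rpow_natCast, ← Real.rpow_mul hz0]; norm_num
  set N := ⌊z / (4 * p * m * q)⌋₊ + 1 with hN
  have hNle : (N : ℝ) ≤ z / (4 * p * m * q) + 1 := by
    rw [hN]; push_cast
    have : (⌊z / (4 * p * m * q)⌋₊ : ℝ) ≤ z / (4 * p * m * q) := Nat.floor_le (by positivity)
    linarith
  have hmain := card_prime_pairs_le (a := g * m * q) (k := k) (K := 6 * p * q * m) (D := D)
    (N := N) (c := n₀ % k) (B := primeCofactors p u z q m) (by positivity)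
    ⟨p * q * m, by ring⟩ hD2 (by positivity) ?_ ?_
  · refine hmain.trans (add_le_add ?_ (by linarith))
    have h12 := div_totient_six_mul_le (m := m) hp hq
    have h12' : (((6 * p * q * m : ℕ) : ℝ) / (6 * p * q * m).totient) ^ 2 ≤
        (12 * (m / m.totient)) ^ 2 := by
      refine pow_le_pow_left₀ (by positivity) h12 2
    have hl2 : (Real.log z / 200) ^ 2 ≤ (Real.log D) ^ 2 := by gcongr
    calc _ ≤ 4 * (12 * ((m : ℝ) / m.totient)) ^ 2 * (z / (4 * p * m * q) + 1) /
          (Real.log z / 200) ^ 2 := by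
          gcongr
      _ = _ := by field_simp; ring
  · intro l hl hlK
    have h4p : ¬ l ∣ 4 * p := fun h => hlK <| by
      rcases (Nat.Prime.dvd_mul hl).mp h with h | h
      · have : l ∣ 2 := hl.dvd_of_dvd_pow (n := 2) (by simpa using h)
        exact (this.trans ⟨3, by norm_num⟩ : l ∣ 6).trans ⟨p * q * m, by ring⟩
      · exact h.trans ⟨6 * q * m, by ring⟩
    refine ⟨fun h => ?_, fun h => h4p (h.trans ⟨g, by rw [hk]; ring⟩)⟩
    rcases (Nat.Prime.dvd_mul hl).mp h with h | h
    · rcases (Nat.Prime.dvd_mul hl).mp h with h | h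
      · exact h4p (h.trans ⟨k, hk⟩)
      · exact hlK (h.trans ⟨6 * p * q, by ring⟩)
    · exact hlK (h.trans ⟨6 * p * m, by ring⟩)
  · intro n hn
    obtain ⟨hnz, h1, h2, h3, h4, h5, h6⟩ := Finset.mem_filter.mp hn
    obtain ⟨_, _, _, _, _, h5', _⟩ := Finset.mem_filter.mp hn₀
    rw [← hg] at h4 h5 h6 h5'
    refine ⟨?_, h1, h4, ?_, ?_⟩
    · rw [← h5', ZMod.natCast_eq_natCast_iff] at h5
      have := Nat.ModEq.cancel_left_div_gcd (by positivity) (Nat.ModEq.add_right_cancel' 1 h5)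
      rw [hgcd, hkdiv] at this
      exact this
    · exact (Nat.floor_lt (by positivity)).mpr h2
    · rw [hN, Nat.lt_add_one_iff]
      refine Nat.le_floor ?_
      have hk' : (4 : ℝ) * p = g * k := by exact_mod_cast hk
      have h7 : ((n / k : ℕ) : ℝ) ≤ n / k := Nat.cast_div_le
      refine h7.trans ?_
      rw [hk', div_le_div_iff₀ (by positivity) (by positivity)]
      push_cast at h6
      calc (n : ℝ) * (g * k * m * q) = (g * m * q * n) * k := by ring
        _ ≤ z * k := by gcongr; linarith

/-- The pairs `(r, q)` of a prime `r ≡ u` modulo `4 * p` and a prime `q ∣ r - 1` in the given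
block such that `r - 1` has a second large prime factor. -/
noncomputable def badPairs (p : ℕ) (u : ℤ) (δ z : ℝ) : Finset (ℕ × ℕ) :=
  (Finset.range (⌊z⌋₊ + 1) ×ˢ primeBlock δ z).filter fun x => x.1.Prime ∧
    (x.1 : ZMod (4 * p)) = (u : ZMod (4 * p)) ∧ x.2 ∣ x.1 - 1 ∧
    ∃ n : ℕ, n.Prime ∧ n ≠ x.2 ∧ z ^ ((1 : ℝ) / 2 - 2 * δ) ≤ n ∧ n ∣ x.1 - 1

lemma card_badPairs_le_sum {p : ℕ} (hp : p.Prime) {u : ℤ} {δ z : ℝ} (hz : 1 ≤ z)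
    (h1 : z ^ ((1 : ℝ) / 100) < z ^ ((1 : ℝ) / 2 - 2 * δ))
    (h2 : 4 * (p : ℝ) < z ^ ((1 : ℝ) / 2 - 2 * δ)) :
    (badPairs p u δ z).card ≤ ∑ q ∈ primeBlock δ z, ∑ m ∈ Finset.Icc 1 ⌊z ^ (4 * δ)⌋₊,
      (primeCofactors p u z q m).card := by
  have hsub : badPairs p u δ z ⊆ (((primeBlock δ z).sigma fun q =>
      (Finset.Icc 1 ⌊z ^ (4 * δ)⌋₊).sigma fun m => primeCofactors p u z q m)).image
      fun x => (Int.gcd (u - 1) (4 * p) * x.2.1 * x.1 * x.2.2 + 1, x.1) := by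
    rintro ⟨r, q⟩ hr
    simp only [badPairs, Finset.mem_filter, Finset.mem_product, Finset.mem_range] at hr
    obtain ⟨⟨hrz, hq⟩, hrp, hru, hqr, n, hn, hnq, hnz, hnr⟩ := hr
    obtain ⟨hqp, hq1, hq2⟩ := (mem_primeBlock (by linarith)).mp hq
    have hqn : q * n ∣ r - 1 := Nat.Coprime.mul_dvd_of_dvd_of_dvd
      ((Nat.coprime_primes hqp hn).mpr (Ne.symm hnq)) hqr hnr
    obtain ⟨m, hm⟩ := hqn
    have hr2 := hrp.two_le
    have h4n : 4 * p < n := by exact_mod_cast h2.trans_le hnz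
    have h4q : 4 * p < q := by exact_mod_cast h2.trans_le hq1
    have hgm : Int.gcd (u - 1) (4 * p) ∣ m := by
      rw [gcd_sub_one_eq (by omega) hru, hm]
      refine Nat.Coprime.dvd_of_dvd_mul_left (k := Nat.gcd (q * n * m) (4 * p)) (m := q * n) ?_
        (Nat.gcd_dvd_left _ _)
      exact (Nat.Coprime.mul_left (coprime_four_mul_of_lt hp.pos hqp h4q)
        (coprime_four_mul_of_lt hp.pos hn h4n)).symm.coprime_dvd_left (Nat.gcd_dvd_right _ _)
    obtain ⟨m', hm'⟩ := hgm
    set g := Int.gcd (u - 1) (4 * p) with hg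
    have hrz' : (r : ℝ) ≤ z := (Nat.le_floor_iff (by linarith)).mp (by omega)
    have hreq : g * m' * q * n + 1 = r := by
      have : q * n * m = g * m' * q * n := by rw [hm']; ring
      omega
    have hm0 : 0 < m := Nat.pos_of_ne_zero fun h => by subst h; simp at hm; omega
    have hm'0 : 0 < m' := Nat.pos_of_ne_zero fun h => by subst h; simp at hm'; omega
    have hm'm : m' ≤ m := Nat.le_of_dvd hm0 ⟨g, by rw [hm']; ring⟩
    rw [Finset.mem_image]
    refine ⟨⟨q, m', n⟩, ?_, by simp [hreq]⟩
    simp only [Finset.mem_sigma, primeCofactors, Finset.mem_filter, Finset.mem_range,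
      Finset.mem_Icc, ← hg]
    refine ⟨hq, ⟨hm'0, Nat.le_floor ?_⟩, ?_, hn, h1.trans_le hnz, h4n, ?_, ?_, ?_⟩
    · have e1 : z ^ ((1 : ℝ) / 2 - 2 * δ) * z ^ ((1 : ℝ) / 2 - 2 * δ) * m ≤ z := by
        calc _ ≤ (q : ℝ) * n * m := by gcongr
          _ = ((r - 1 : ℕ) : ℝ) := by rw [hm]; push_cast; ring
          _ ≤ r := by exact_mod_cast Nat.sub_le _ _
          _ ≤ z := hrz'
      have hz0 : 0 < z := by linarith
      have e2 : z ^ ((1 : ℝ) / 2 - 2 * δ) * z ^ ((1 : ℝ) / 2 - 2 * δ) * z ^ (4 * δ) = z := by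
        rw [← Real.rpow_add hz0, ← Real.rpow_add hz0]
        ring_nf
        exact Real.rpow_one z
      have e3 : (m : ℝ) ≤ z ^ (4 * δ) := by
        refine le_of_mul_le_mul_left (e1.trans e2.ge) ?_
        positivity
      exact (by exact_mod_cast hm'm : (m' : ℝ) ≤ m).trans e3
    · have : n ≤ r - 1 := Nat.le_of_dvd (by omega) hnr
      omega
    · rw [hreq]; exact hrp
    · rw [hreq]; exact hru
    · rw [hreq]; exact hrz'
  refine (Finset.card_le_card hsub).trans (Finset.card_image_le.trans ?_)
  rw [Finset.card_sigma]
  simp only [Finset.card_sigma]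
  exact le_rfl

open Filter Topology in
theorem exists_card_badPairs_le : ∃ C : ℝ, 0 < C ∧ ∀ δ : ℝ, 0 < δ → δ ≤ 1 / 100 →
    ∀ p : ℕ, p.Prime → ∀ u : ℤ, ∀ᶠ z : ℝ in atTop,
      ((badPairs p u δ z).card : ℝ) ≤ C * δ ^ 2 * (z / (Nat.totient (4 * p) * Real.log z)) := by
  obtain ⟨C₁, hC₁, hsum⟩ := exists_sum_sq_div_totient_le
  set C₀ : ℝ := 576 * 40000 * 2 with hC₀
  refine ⟨C₀ * (4 * (C₁ * 5)) + 1, by positivity, fun δ hδ hδ' p hp u => ?_⟩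
  have hp0 : (0 : ℝ) < p := by exact_mod_cast hp.pos
  have hφ0 : (0 : ℝ) < Nat.totient (4 * p) := by
    exact_mod_cast Nat.totient_pos.mpr (by have := hp.pos; omega)
  have hφ : (Nat.totient (4 * p) : ℝ) ≤ 4 * p := by
    exact_mod_cast Nat.totient_le (4 * p)
  have hlo := isLittleO_log_rpow_atTop (show (0 : ℝ) < 4 / 10 by norm_num)
  have hlo' := hlo.bound (show (0 : ℝ) < δ ^ 2 / (2 * Nat.totient (4 * p)) by positivity)
  filter_upwards [eventually_gt_atTop 1,
    (tendsto_rpow_atTop (show (0 : ℝ) < 1 / 200 by norm_num)).eventually_ge_atTop 2,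
    (tendsto_rpow_atTop (show (0 : ℝ) < 1 / 10 by norm_num)).eventually_ge_atTop (4 * (p : ℝ)),
    Real.tendsto_log_atTop.eventually_ge_atTop (1 / δ), hlo',
    eventually_sum_primeBlock_inv hδ hδ' one_pos] with z hz1 hz2 hz3 hz4 hz5 hz6
  have hz0 : 0 < z := by linarith
  have hlogz : 0 < Real.log z := Real.log_pos hz1
  have hδlog : 1 ≤ δ * Real.log z := by
    rw [div_le_iff₀ hδ] at hz4; linarith
  have hM : Real.log ⌊z ^ (4 * δ)⌋₊ ≤ 4 * δ * Real.log z := by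
    rw [← Real.log_rpow hz0]
    refine Real.log_le_log ?_ (Nat.floor_le (by positivity))
    exact_mod_cast Nat.floor_pos.mpr (Real.one_le_rpow hz1.le (by positivity))
  have hbad := card_badPairs_le_sum (u := u) (δ := δ) hp hz1.le
    (Real.rpow_lt_rpow_of_exponent_lt hz1 (by linarith))
    (hz3.trans_lt (Real.rpow_lt_rpow_of_exponent_lt hz1 (by linarith)))
  have hbad' : ((badPairs p u δ z).card : ℝ) ≤ ∑ q ∈ primeBlock δ z,
      ∑ m ∈ Finset.Icc 1 ⌊z ^ (4 * δ)⌋₊, ((primeCofactors p u z q m).card : ℝ) := by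
    exact_mod_cast hbad
  have hterm : ∀ q ∈ primeBlock δ z, ∀ m ∈ Finset.Icc 1 ⌊z ^ (4 * δ)⌋₊,
      ((primeCofactors p u z q m).card : ℝ) ≤
        C₀ * (z / (4 * p * (Real.log z) ^ 2)) * (1 / q) * (((m : ℝ) / m.totient) ^ 2 / m) +
          2 * z ^ ((1 : ℝ) / 25) := by
    intro q hq m hm
    obtain ⟨hqp, _, hq2⟩ := (mem_primeBlock hz0.le).mp hq
    obtain ⟨hm1, hm2⟩ := Finset.mem_Icc.mp hm
    have hm0 : (0 : ℝ) < m := by exact_mod_cast hm1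
    have hq0 : (0 : ℝ) < q := by exact_mod_cast hqp.pos
    have hm3 : (m : ℝ) ≤ z ^ (4 * δ) := (Nat.le_floor_iff (by positivity)).mp hm2
    refine (card_primeCofactors_le hp hz0.le hz2 hqp hm1).trans ?_
    gcongr ?_ + _
    have hle : 4 * p * m * q ≤ z := by
      calc 4 * p * m * q ≤ z ^ ((1 : ℝ) / 10) * z ^ (4 * δ) * z ^ ((1 : ℝ) / 2 - δ) := by gcongr
        _ = z ^ ((1 : ℝ) / 10 + 4 * δ + (1 / 2 - δ)) := by
            rw [Real.rpow_add hz0, Real.rpow_add hz0]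
        _ ≤ z ^ (1 : ℝ) := Real.rpow_le_rpow_of_exponent_le hz1.le (by linarith)
        _ = z := Real.rpow_one z
    have h1 : 1 ≤ z / (4 * p * m * q) := by rwa [le_div_iff₀ (by positivity), one_mul]
    calc 576 * 40000 * ((m : ℝ) / m.totient) ^ 2 * (z / (4 * p * m * q) + 1) / (Real.log z) ^ 2
        ≤ 576 * 40000 * ((m : ℝ) / m.totient) ^ 2 * (2 * (z / (4 * p * m * q))) /
          (Real.log z) ^ 2 := by gcongr; linarith
      _ = _ := by
        rw [hC₀]
        generalize ((m : ℝ) / m.totient) ^ 2 = X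
        field_simp
  have hcard : ((primeBlock δ z).card : ℝ) ≤ z ^ ((1 : ℝ) / 2 - δ) := by
    have : primeBlock δ z ⊆ Finset.Icc 1 ⌊z ^ ((1 : ℝ) / 2 - δ)⌋₊ := by
      intro q hq
      obtain ⟨hqp, _, hq2⟩ := (mem_primeBlock hz0.le).mp hq
      exact Finset.mem_Icc.mpr ⟨hqp.pos, Nat.le_floor hq2⟩
    have h := Finset.card_le_card this
    rw [Nat.card_Icc, Nat.add_sub_cancel] at h
    exact (Nat.cast_le.mpr h).trans (Nat.floor_le (by positivity))
  have hMf : (⌊z ^ (4 * δ)⌋₊ : ℝ) ≤ z ^ (4 * δ) := Nat.floor_le (by positivity)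
  have hS := hsum ⌊z ^ (4 * δ)⌋₊
  have hmain : ∑ q ∈ primeBlock δ z, ∑ m ∈ Finset.Icc 1 ⌊z ^ (4 * δ)⌋₊,
      (C₀ * (z / (4 * p * (Real.log z) ^ 2)) * (1 / q) * (((m : ℝ) / m.totient) ^ 2 / m)) ≤
      C₀ * (z / (4 * p * (Real.log z) ^ 2)) * (4 * δ) * (C₁ * (5 * δ * Real.log z)) := by
    have e : ∑ q ∈ primeBlock δ z, ∑ m ∈ Finset.Icc 1 ⌊z ^ (4 * δ)⌋₊,
      (C₀ * (z / (4 * p * (Real.log z) ^ 2)) * (1 / q) * (((m : ℝ) / m.totient) ^ 2 / m)) =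
      C₀ * (z / (4 * p * (Real.log z) ^ 2)) * ((∑ q ∈ primeBlock δ z, 1 / (q : ℝ)) *
        ∑ m ∈ Finset.Icc 1 ⌊z ^ (4 * δ)⌋₊, (((m : ℝ) / m.totient) ^ 2 / m)) := by
      rw [Finset.sum_mul_sum, Finset.mul_sum]
      refine Finset.sum_congr rfl fun q _ => ?_
      rw [Finset.mul_sum]
      exact Finset.sum_congr rfl fun m _ => mul_assoc _ _ _
    rw [e, mul_assoc _ (4 * δ)]
    have hS' : C₁ * (1 + Real.log ⌊z ^ (4 * δ)⌋₊) ≤ C₁ * (5 * δ * Real.log z) :=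
      mul_le_mul_of_nonneg_left (by linarith) hC₁.le
    exact mul_le_mul_of_nonneg_left (mul_le_mul hz6.2 (hS.trans hS')
      (Finset.sum_nonneg fun _ _ => by positivity) (by positivity)) (by positivity)
  have herr : z ^ ((1 : ℝ) / 2 - δ) * (z ^ (4 * δ) * (2 * z ^ ((1 : ℝ) / 25))) ≤
      δ ^ 2 * (z / (Nat.totient (4 * p) * Real.log z)) := by
    have h1 : z ^ ((1 : ℝ) / 2 - δ) * (z ^ (4 * δ) * (2 * z ^ ((1 : ℝ) / 25))) ≤
        2 * z ^ ((6 : ℝ) / 10) := by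
      calc _ = 2 * z ^ ((1 : ℝ) / 2 - δ + (4 * δ + 1 / 25)) := by
            rw [Real.rpow_add hz0, Real.rpow_add hz0]; ring
        _ ≤ _ := by
          gcongr
          · exact hz1.le
          · linarith
    have h2 : z = z ^ ((6 : ℝ) / 10) * z ^ ((4 : ℝ) / 10) := by
      rw [← Real.rpow_add hz0]; norm_num
    rw [Real.norm_of_nonneg hlogz.le, Real.norm_of_nonneg (by positivity)] at hz5
    have h3 : 2 * (Nat.totient (4 * p) * Real.log z) ≤ δ ^ 2 * z ^ ((4 : ℝ) / 10) := by
      calc _ ≤ 2 * (Nat.totient (4 * p) * (δ ^ 2 / (2 * Nat.totient (4 * p)) *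
            z ^ ((4 : ℝ) / 10))) := by gcongr
        _ = _ := by field_simp
    refine h1.trans ?_
    rw [← mul_div_assoc, le_div_iff₀ (by positivity)]
    calc 2 * z ^ ((6 : ℝ) / 10) * (Nat.totient (4 * p) * Real.log z)
        = z ^ ((6 : ℝ) / 10) * (2 * (Nat.totient (4 * p) * Real.log z)) := by ring
      _ ≤ z ^ ((6 : ℝ) / 10) * (δ ^ 2 * z ^ ((4 : ℝ) / 10)) := by gcongr
      _ = δ ^ 2 * (z ^ ((6 : ℝ) / 10) * z ^ ((4 : ℝ) / 10)) := by ring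
      _ = δ ^ 2 * z := by rw [← h2]
  calc ((badPairs p u δ z).card : ℝ) ≤ _ := hbad'
    _ ≤ ∑ q ∈ primeBlock δ z, ∑ m ∈ Finset.Icc 1 ⌊z ^ (4 * δ)⌋₊,
        (C₀ * (z / (4 * p * (Real.log z) ^ 2)) * (1 / q) * (((m : ℝ) / m.totient) ^ 2 / m) +
          2 * z ^ ((1 : ℝ) / 25)) :=
        Finset.sum_le_sum fun q hq => Finset.sum_le_sum fun m hm => hterm q hq m hm
    _ ≤ C₀ * (z / (4 * p * (Real.log z) ^ 2)) * (4 * δ) * (C₁ * (5 * δ * Real.log z)) +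
        z ^ ((1 : ℝ) / 2 - δ) * (z ^ (4 * δ) * (2 * z ^ ((1 : ℝ) / 25))) := by
        simp only [Finset.sum_add_distrib, Finset.sum_const, nsmul_eq_mul, Nat.card_Icc,
          Nat.add_sub_cancel]
        refine add_le_add hmain ?_
        gcongr
    _ ≤ C₀ * (4 * (C₁ * 5)) * δ ^ 2 * (z / (Nat.totient (4 * p) * Real.log z)) +
        δ ^ 2 * (z / (Nat.totient (4 * p) * Real.log z)) := by
        refine add_le_add ?_ herr
        calc _ = C₀ * (4 * (C₁ * 5)) * δ ^ 2 * (z / (4 * p * Real.log z)) := by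
              field_simp
          _ ≤ _ := by gcongr
    _ = _ := by ring

end BadPairs

section TriangleSum

lemma sum_Icc_sub_psiRes {q : ℕ} (a : ZMod q) {x y z : ℝ} (hxy : x ≤ y) (hy : y ≤ z) :
    ∑ n ∈ Finset.Icc 1 ⌊z⌋₊, ArithmeticFunction.vonMangoldt.residueClass a n *
      (if x < n ∧ (n : ℝ) ≤ y then 1 else 0) = psiRes a y - psiRes a x := by
  have h : ∀ x : ℝ, x ≤ z → psiRes a x = ∑ n ∈ Finset.Icc 1 ⌊z⌋₊,
      ArithmeticFunction.vonMangoldt.residueClass a n * (if (n : ℝ) ≤ x then 1 else 0) := by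
    intro x hx
    simp only [mul_ite, mul_one, mul_zero]
    rw [psiRes, ← Finset.sum_filter]
    refine Finset.sum_congr ?_ fun _ _ => rfl
    ext n
    simp only [Finset.mem_Icc, Finset.mem_filter]
    constructor
    · rintro ⟨h1, h2⟩
      have h3 : (n : ℝ) ≤ x := (Nat.le_floor_iff' (by omega)).mp h2
      exact ⟨⟨h1, Nat.le_floor (h3.trans hx)⟩, h3⟩
    · rintro ⟨⟨h1, _⟩, h3⟩
      exact ⟨h1, Nat.le_floor h3⟩
  rw [h y hy, h x (hxy.trans hy), ← Finset.sum_sub_distrib]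
  refine Finset.sum_congr rfl fun n _ => ?_
  rw [← mul_sub]
  congr 1
  by_cases h1 : (n : ℝ) ≤ x
  · simp [h1, h1.trans hxy]
  · simp [h1, not_le.mp h1]

lemma le_logTri {z x : ℝ} (hz : 0 < z) (hx : 0 < x) {j : ℕ}
    (h1 : z * (2 : ℝ) ^ (-((20 - j : ℝ) / 20)) < x) (h2 : x ≤ z * (2 : ℝ) ^ (-(j / 20 : ℝ))) :
    (j : ℝ) / 10 ≤ logTri z x := by
  have hl := Real.log_pos one_lt_two
  have h1' := Real.log_lt_log (by positivity) h1
  have h2' := Real.log_le_log hx h2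
  rw [Real.log_mul hz.ne' (by positivity), Real.log_rpow two_pos] at h1' h2'
  refine le_max_of_le_right ?_
  rw [le_sub_comm, div_le_iff₀ (by positivity), abs_le]
  constructor <;> nlinarith

lemma sum_indicator_le_logTri {z x : ℝ} (hz : 0 < z) (hx : 0 < x) :
    ∑ j ∈ Finset.Icc 1 10, (if z * (2 : ℝ) ^ (-((20 - (j : ℕ) : ℝ) / 20)) < x ∧
      x ≤ z * (2 : ℝ) ^ (-((j : ℕ) / 20 : ℝ)) then (1 : ℝ) else 0) ≤ 10 * logTri z x := by
  rw [← Finset.sum_filter, Finset.sum_const, nsmul_eq_mul, mul_one]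
  have hsub : (Finset.Icc 1 10).filter (fun j : ℕ =>
      z * (2 : ℝ) ^ (-((20 - (j : ℕ) : ℝ) / 20)) < x ∧ x ≤ z * (2 : ℝ) ^ (-((j : ℕ) / 20 : ℝ))) ⊆
      Finset.Icc 1 ⌊10 * logTri z x⌋₊ := by
    intro j hj
    obtain ⟨hj1, hj2, hj3⟩ := Finset.mem_filter.mp hj
    refine Finset.mem_Icc.mpr ⟨(Finset.mem_Icc.mp hj1).1, Nat.le_floor ?_⟩
    linarith [le_logTri hz hx hj2 hj3]
  have h := Finset.card_le_card hsub
  rw [Nat.card_Icc, Nat.add_sub_cancel] at h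
  exact (Nat.cast_le.mpr h).trans
    (Nat.floor_le (mul_nonneg (by norm_num) (logTri_nonneg _ _)))

lemma sum_two_rpow_ge : (2.1 : ℝ) < ∑ j ∈ Finset.Icc 1 10,
    ((2 : ℝ) ^ (-((j : ℕ) / 20 : ℝ)) - (2 : ℝ) ^ (-((20 - (j : ℕ) : ℝ) / 20))) := by
  set y : ℝ := (2 : ℝ) ^ (1 / 20 : ℝ) with hy
  have hy0 : 0 < y := by positivity
  have hy20 : y ^ 20 = 2 := by
    rw [hy, ← Real.rpow_natCast, ← Real.rpow_mul two_pos.le]; norm_num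
  have hyle : y ≤ 1.0353 := by
    by_contra! h
    have := pow_lt_pow_left₀ h (by norm_num) (n := 20) (by norm_num)
    norm_num [hy20] at this
  have hterm : ∀ j ∈ Finset.Icc 1 10, (1.0353 : ℝ)⁻¹ ^ (j : ℕ) - 1.0353 ^ (j : ℕ) / 2 ≤
      (2 : ℝ) ^ (-((j : ℕ) / 20 : ℝ)) - (2 : ℝ) ^ (-((20 - (j : ℕ) : ℝ) / 20)) := by
    intro j _
    have e1 : (2 : ℝ) ^ (-((j : ℕ) / 20 : ℝ)) = y⁻¹ ^ j := by
      rw [hy, ← Real.rpow_neg two_pos.le, ← Real.rpow_natCast, ← Real.rpow_mul two_pos.le]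
      congr 1; ring
    have e2 : (2 : ℝ) ^ (-((20 - (j : ℕ) : ℝ) / 20)) = y ^ j / 2 := by
      rw [hy, ← Real.rpow_natCast, ← Real.rpow_mul two_pos.le, eq_div_iff two_ne_zero]
      nth_rewrite 2 [← Real.rpow_one 2]
      rw [← Real.rpow_add two_pos]
      congr 1; ring
    rw [e1, e2]
    gcongr
  refine lt_of_lt_of_le ?_ (Finset.sum_le_sum hterm)
  norm_num [Finset.sum_Icc_succ_top]

open Filter Topology in
theorem eventually_le_sum_residueClass_logTri {q : ℕ} [NeZero q] {a : ZMod q} (ha : IsUnit a) :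
    ∀ᶠ z : ℝ in atTop, 21 / 100 * z * (q.totient : ℝ)⁻¹ ≤
      ∑ n ∈ Finset.Icc 1 ⌊z⌋₊, ArithmeticFunction.vonMangoldt.residueClass a n * logTri z n := by
  have hφ : (0 : ℝ) < (q.totient : ℝ)⁻¹ :=
    inv_pos.mpr (by exact_mod_cast Nat.totient_pos.mpr (NeZero.pos q))
  have hc : ∀ c : ℝ, 0 < c → Tendsto (fun z : ℝ => psiRes a (z * c) / z) atTop
      (𝓝 (c * (q.totient : ℝ)⁻¹)) := by
    intro c hc
    have h := ((tendsto_psiRes_div ha).comp (tendsto_id.atTop_mul_const hc)).const_mul c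
    refine h.congr fun z => ?_
    simp only [Function.comp, id]
    rcases eq_or_ne z 0 with rfl | hz
    · simp
    · field_simp
  have hT : Tendsto (fun z : ℝ => ∑ j ∈ Finset.Icc 1 10,
      (psiRes a (z * (2 : ℝ) ^ (-((j : ℕ) / 20 : ℝ))) / z -
        psiRes a (z * (2 : ℝ) ^ (-((20 - (j : ℕ) : ℝ) / 20))) / z)) atTop
      (𝓝 (∑ j ∈ Finset.Icc 1 10, ((2 : ℝ) ^ (-((j : ℕ) / 20 : ℝ)) * (q.totient : ℝ)⁻¹ -
        (2 : ℝ) ^ (-((20 - (j : ℕ) : ℝ) / 20)) * (q.totient : ℝ)⁻¹))) :=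
    tendsto_finsetSum _ fun j _ => (hc _ (by positivity)).sub (hc _ (by positivity))
  have hlim : 2.1 * (q.totient : ℝ)⁻¹ < ∑ j ∈ Finset.Icc 1 10,
      ((2 : ℝ) ^ (-((j : ℕ) / 20 : ℝ)) * (q.totient : ℝ)⁻¹ -
        (2 : ℝ) ^ (-((20 - (j : ℕ) : ℝ) / 20)) * (q.totient : ℝ)⁻¹) := by
    simp only [← sub_mul, ← Finset.sum_mul]
    exact mul_lt_mul_of_pos_right sum_two_rpow_ge hφ
  filter_upwards [hT.eventually_const_lt hlim, eventually_gt_atTop 2] with z hz hz2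
  have hz0 : 0 < z := by linarith
  have hstep : ∑ j ∈ Finset.Icc 1 10, (psiRes a (z * (2 : ℝ) ^ (-((j : ℕ) / 20 : ℝ))) -
        psiRes a (z * (2 : ℝ) ^ (-((20 - (j : ℕ) : ℝ) / 20)))) ≤
      10 * ∑ n ∈ Finset.Icc 1 ⌊z⌋₊,
        ArithmeticFunction.vonMangoldt.residueClass a n * logTri z n := by
    have e : ∀ j ∈ Finset.Icc 1 10, psiRes a (z * (2 : ℝ) ^ (-((j : ℕ) / 20 : ℝ))) -
        psiRes a (z * (2 : ℝ) ^ (-((20 - (j : ℕ) : ℝ) / 20))) =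
        ∑ n ∈ Finset.Icc 1 ⌊z⌋₊, ArithmeticFunction.vonMangoldt.residueClass a n *
          (if z * (2 : ℝ) ^ (-((20 - (j : ℕ) : ℝ) / 20)) < n ∧
            (n : ℝ) ≤ z * (2 : ℝ) ^ (-((j : ℕ) / 20 : ℝ)) then 1 else 0) := by
      intro j hj
      have hj' : (j : ℝ) ≤ 10 := by exact_mod_cast (Finset.mem_Icc.mp hj).2
      have hj1 : (1 : ℝ) ≤ j := by exact_mod_cast (Finset.mem_Icc.mp hj).1
      refine (sum_Icc_sub_psiRes a ?_ ?_).symm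
      · gcongr
        · norm_num
        · linarith
      · refine mul_le_of_le_one_right hz0.le
          (Real.rpow_le_one_of_one_le_of_nonpos one_le_two ?_)
        have : (0 : ℝ) ≤ (j : ℝ) / 20 := by positivity
        linarith
    rw [Finset.sum_congr rfl e, Finset.sum_comm, Finset.mul_sum]
    refine Finset.sum_le_sum fun n hn => ?_
    rw [← Finset.mul_sum, mul_left_comm]
    refine mul_le_mul_of_nonneg_left (sum_indicator_le_logTri hz0 ?_)
      (ArithmeticFunction.vonMangoldt.residueClass_nonneg a n)
    exact_mod_cast (Finset.mem_Icc.mp hn).1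
  simp only [← sub_div, ← Finset.sum_div] at hz
  rw [lt_div_iff₀ hz0] at hz
  linarith

end TriangleSum

section WeightedSum

lemma sum_residueClass_dvd_le {K q : ℕ} (a : ZMod K) {z : ℝ} (hz : 1 ≤ z) :
    ∑ n ∈ (Finset.Icc 1 ⌊z⌋₊).filter (fun n : ℕ => (n : ZMod q) = 0),
      ArithmeticFunction.vonMangoldt.residueClass a n * logTri z n ≤ z / q * Real.log z := by
  have hz0 : 0 ≤ z := by linarith
  have hcard : (((Finset.Icc 1 ⌊z⌋₊).filter fun n : ℕ => (n : ZMod q) = 0).card : ℝ) ≤ z / q := by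
    have e : ((Finset.Icc 1 ⌊z⌋₊).filter fun n : ℕ => (n : ZMod q) = 0) =
        (Finset.Ioc 0 ⌊z⌋₊).filter fun n : ℕ => q ∣ n := by
      ext n
      simp only [Finset.mem_filter, Finset.mem_Icc, Finset.mem_Ioc, ZMod.natCast_eq_zero_iff]
      rfl
    rw [e, Nat.Ioc_filter_dvd_card_eq_div]
    refine Nat.cast_div_le.trans ?_
    gcongr
    exact Nat.floor_le hz0
  refine (Finset.sum_le_card_nsmul _ _ (Real.log z) fun n hn => ?_).trans ?_
  · obtain ⟨h1, h2⟩ := Finset.mem_Icc.mp (Finset.mem_filter.mp hn).1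
    have hn0 : (0 : ℝ) < n := by exact_mod_cast h1
    calc _ ≤ ArithmeticFunction.vonMangoldt.residueClass a n * 1 := by
          gcongr
          · exact ArithmeticFunction.vonMangoldt.residueClass_nonneg a n
          · exact logTri_le_one _ _
      _ ≤ ArithmeticFunction.vonMangoldt n := by
          rw [mul_one]; exact ArithmeticFunction.vonMangoldt.residueClass_le a n
      _ ≤ Real.log n := ArithmeticFunction.vonMangoldt_le_log
      _ ≤ Real.log z := Real.log_le_log hn0 ((Nat.le_floor_iff hz0).mp h2)
  · rw [nsmul_eq_mul]
    exact mul_le_mul_of_nonneg_right hcard (Real.log_nonneg hz)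

lemma sum_residueClass_modEq_one_ge {K q : ℕ} (a : ZMod K) (hq : q.Prime) {z : ℝ} (hz : 1 ≤ z) :
    (∑ n ∈ Finset.Icc 1 ⌊z⌋₊, ArithmeticFunction.vonMangoldt.residueClass a n * logTri z n) *
        (1 / q) - z / q * Real.log z * (1 / q) -
      |∑ n ∈ Finset.Icc 1 ⌊z⌋₊, ArithmeticFunction.vonMangoldt n *
        ((if (n : ZMod K) = a then resKer q n else 0) * logTri z n)| ≤
      ∑ n ∈ (Finset.Icc 1 ⌊z⌋₊).filter (fun n : ℕ => (n : ZMod q) = 1),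
        ArithmeticFunction.vonMangoldt.residueClass a n * logTri z n := by
  set c : ℕ → ℝ := fun n => ArithmeticFunction.vonMangoldt.residueClass a n * logTri z n with hc
  have hc0 : ∀ n, 0 ≤ c n := fun n =>
    mul_nonneg (ArithmeticFunction.vonMangoldt.residueClass_nonneg a n) (logTri_nonneg _ _)
  have hq1 : (1 : ℝ) < q := by exact_mod_cast hq.one_lt
  have hdvd := sum_residueClass_dvd_le (q := q) a hz
  have hsplit := Finset.sum_filter_add_sum_filter_not (Finset.Icc 1 ⌊z⌋₊)
    (fun n : ℕ => (n : ZMod q) = 0) c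
  have e : ∑ n ∈ Finset.Icc 1 ⌊z⌋₊, ArithmeticFunction.vonMangoldt n *
        ((if (n : ZMod K) = a then resKer q n else 0) * logTri z n) =
      ∑ n ∈ (Finset.Icc 1 ⌊z⌋₊).filter (fun n : ℕ => (n : ZMod q) = 1), c n -
        1 / ((q : ℝ) - 1) * ∑ n ∈ (Finset.Icc 1 ⌊z⌋₊).filter (fun n : ℕ => ¬ (n : ZMod q) = 0), c n := by
    rw [Finset.mul_sum, Finset.sum_filter, Finset.sum_filter, ← Finset.sum_sub_distrib]
    refine Finset.sum_congr rfl fun n _ => ?_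
    simp only [hc, ArithmeticFunction.vonMangoldt.residueClass, Set.indicator, Set.mem_ofPred_eq,
      resKer]
    split_ifs <;> ring
  have hB : 0 ≤ ∑ n ∈ (Finset.Icc 1 ⌊z⌋₊).filter (fun n : ℕ => ¬ (n : ZMod q) = 0), c n :=
    Finset.sum_nonneg fun n _ => hc0 n
  have h1 : (1 : ℝ) / q * ∑ n ∈ (Finset.Icc 1 ⌊z⌋₊).filter (fun n : ℕ => ¬ (n : ZMod q) = 0), c n ≤
      1 / ((q : ℝ) - 1) * ∑ n ∈ (Finset.Icc 1 ⌊z⌋₊).filter (fun n : ℕ => ¬ (n : ZMod q) = 0), c n := by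
    gcongr
    linarith
  have h2 := neg_abs_le (∑ n ∈ Finset.Icc 1 ⌊z⌋₊, ArithmeticFunction.vonMangoldt n *
        ((if (n : ZMod K) = a then resKer q n else 0) * logTri z n))
  have h3 : (∑ n ∈ (Finset.Icc 1 ⌊z⌋₊).filter (fun n : ℕ => (n : ZMod q) = 0), c n) * (1 / q) ≤
      z / q * Real.log z * (1 / q) := mul_le_mul_of_nonneg_right hdvd (by positivity)
  rw [← hsplit, add_mul]
  rw [mul_comm] at h1
  linarith

open Filter Topology Asymptotics in
theorem eventually_le_sum_sum_residueClass {K : ℕ} [NeZero K] {a : ZMod K} (ha : IsUnit a)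
    {δ ε : ℝ} (hδ : 0 < δ) (hδ' : δ ≤ 1 / 100) (hε : 0 < ε) :
    ∀ᶠ z : ℝ in atTop,
      (21 / 100 * (K.totient : ℝ)⁻¹ * (2 * δ / (1 - 2 * δ) - ε) - 2 * ε) * z ≤
      ∑ q ∈ primeBlock δ z, ∑ n ∈ (Finset.Icc 1 ⌊z⌋₊).filter (fun n : ℕ => (n : ZMod q) = 1),
        ArithmeticFunction.vonMangoldt.residueClass a n * logTri z n := by
  filter_upwards [eventually_le_sum_residueClass_logTri ha,
    eventually_sum_abs_vonMangoldt_resKer_le ha hδ hδ' hε,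
    eventually_sum_primeBlock_inv hδ hδ' hε, eventually_ge_atTop 1,
    (isLittleO_log_rpow_atTop (show (0 : ℝ) < 4 / 10 by norm_num)).bound hε]
    with z hA hBV hE hz1 hlog
  have hz0 : 0 < z := by linarith
  have hlog0 := Real.log_nonneg hz1
  rw [Real.norm_of_nonneg hlog0, Real.norm_of_nonneg (by positivity)] at hlog
  have hBV' := hBV (primeBlock δ z) fun q hq => (mem_primeBlock hz0.le).mp hq
  set A := ∑ n ∈ Finset.Icc 1 ⌊z⌋₊, ArithmeticFunction.vonMangoldt.residueClass a n * logTri z n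
  have hS0 : 0 ≤ ∑ q ∈ primeBlock δ z, 1 / (q : ℝ) := Finset.sum_nonneg fun _ _ => by positivity
  have hφ : (0 : ℝ) ≤ (K.totient : ℝ)⁻¹ := by positivity
  have hsq : ∑ q ∈ primeBlock δ z, z / q * Real.log z * (1 / q) ≤ ε * z := by
    have : ∀ q ∈ primeBlock δ z, z / q * Real.log z * (1 / q) ≤ ε * z * (1 / q) := by
      intro q hq
      obtain ⟨hqp, h1, _⟩ := (mem_primeBlock hz0.le).mp hq
      have hq0 : (0 : ℝ) < q := by exact_mod_cast hqp.pos
      have h2 : z ^ ((4 : ℝ) / 10) ≤ q :=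
        (Real.rpow_le_rpow_of_exponent_le hz1 (by linarith)).trans h1
      refine mul_le_mul_of_nonneg_right ?_ (by positivity)
      rw [div_mul_eq_mul_div, div_le_iff₀ hq0]
      calc z * Real.log z ≤ z * (ε * q) := by gcongr; exact hlog.trans (by gcongr)
        _ = _ := by ring
    refine (Finset.sum_le_sum this).trans ?_
    rw [← Finset.mul_sum]
    exact mul_le_of_le_one_right (by positivity) (by linarith [hE.2])
  have hmain : 21 / 100 * (K.totient : ℝ)⁻¹ * (2 * δ / (1 - 2 * δ) - ε) * z ≤
      A * ∑ q ∈ primeBlock δ z, 1 / (q : ℝ) := by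
    calc _ = 21 / 100 * z * (K.totient : ℝ)⁻¹ * (2 * δ / (1 - 2 * δ) - ε) := by ring
      _ ≤ 21 / 100 * z * (K.totient : ℝ)⁻¹ * ∑ q ∈ primeBlock δ z, 1 / (q : ℝ) := by
        gcongr
        exact hE.1
      _ ≤ _ := by gcongr
  have hsum := Finset.sum_le_sum fun q (hq : q ∈ primeBlock δ z) =>
    sum_residueClass_modEq_one_ge a ((mem_primeBlock hz0.le).mp hq).1 hz1
  rw [Finset.sum_sub_distrib, Finset.sum_sub_distrib, ← Finset.mul_sum] at hsum
  linarith

end WeightedSum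

section PrimesInBlock

lemma two_pow_card_le_of_forall_prime_dvd {s : Finset ℕ} {n : ℕ} (hn : n ≠ 0)
    (h : ∀ q ∈ s, q.Prime ∧ q ∣ n) : 2 ^ s.card ≤ n := by
  have h1 : ∏ q ∈ s, q ∣ n :=
    Finset.prod_primes_dvd n (fun q hq => (h q hq).1.prime) fun q hq => (h q hq).2
  refine le_trans ?_ (Nat.le_of_dvd (by omega) h1)
  rw [← Finset.prod_const]
  exact Finset.prod_le_prod' fun q hq => (h q hq).1.two_le

lemma dvd_sub_one_iff_cast_eq_one {q n : ℕ} (hn : 1 ≤ n) : q ∣ n - 1 ↔ (n : ZMod q) = 1 := by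
  rw [← ZMod.natCast_eq_zero_iff, Nat.cast_sub hn, Nat.cast_one, sub_eq_zero]

lemma card_filter_cast_eq_one_le {s : Finset ℕ} (hs : ∀ q ∈ s, q.Prime) {n : ℕ} (hn : 2 ≤ n) :
    ((s.filter fun q => (n : ZMod q) = 1).card : ℝ) ≤ 2 * Real.log n := by
  have h := two_pow_card_le_of_forall_prime_dvd (s := s.filter fun q => (n : ZMod q) = 1)
    (n := n - 1) (by omega) fun q hq => by
      obtain ⟨h1, h2⟩ := Finset.mem_filter.mp hq
      exact ⟨hs q h1, (dvd_sub_one_iff_cast_eq_one (by omega)).mpr h2⟩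
  have h' : (2 : ℝ) ^ (s.filter fun q => (n : ZMod q) = 1).card ≤ n := by
    exact_mod_cast h.trans (Nat.sub_le n 1)
  have h2 := Real.log_le_log (by positivity) h'
  rw [Real.log_pow] at h2
  have h3 := Real.log_two_gt_d9
  have h4 : (0 : ℝ) ≤ ((s.filter fun q => (n : ZMod q) = 1).card : ℝ) := Nat.cast_nonneg _
  nlinarith

lemma sum_sum_nonprime_le {K : ℕ} (a : ZMod K) {s : Finset ℕ} (hs : ∀ q ∈ s, q.Prime) {z : ℝ}
    (hz : 0 ≤ z) :
    ∑ q ∈ s, ∑ n ∈ (Finset.Icc 1 ⌊z⌋₊).filter (fun n : ℕ => (n : ZMod q) = 1 ∧ ¬ n.Prime),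
        ArithmeticFunction.vonMangoldt.residueClass a n * logTri z n ≤
      2 * Real.log z * (Chebyshev.psi z - Chebyshev.theta z) := by
  simp only [Finset.sum_filter]
  rw [Finset.sum_comm, Chebyshev.psi_sub_theta_eq_sum_not_prime, Finset.sum_filter,
    Finset.mul_sum]
  refine Finset.sum_le_sum fun n hn => ?_
  obtain ⟨h1, h2⟩ := Finset.mem_Icc.mp hn
  have hlog : Real.log n ≤ Real.log z := Real.log_le_log (by exact_mod_cast h1)
    ((Nat.le_floor_iff hz).mp h2)
  by_cases hp : n.Prime
  · simp [hp]
  simp only [hp, not_false_eq_true, and_true, if_true]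
  rw [← Finset.sum_filter, Finset.sum_const, nsmul_eq_mul]
  have hc : ArithmeticFunction.vonMangoldt.residueClass a n * logTri z n ≤
      ArithmeticFunction.vonMangoldt n :=
    (mul_le_of_le_one_right (ArithmeticFunction.vonMangoldt.residueClass_nonneg a n)
      (logTri_le_one _ _)).trans (ArithmeticFunction.vonMangoldt.residueClass_le a n)
  rcases h1.eq_or_lt with rfl | h1
  · have : ArithmeticFunction.vonMangoldt.residueClass a 1 = 0 := le_antisymm
      ((ArithmeticFunction.vonMangoldt.residueClass_le a 1).trans (by simp))
      (ArithmeticFunction.vonMangoldt.residueClass_nonneg a 1)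
    simp [this]
  have hcard := card_filter_cast_eq_one_le hs h1
  have hv : 0 ≤ ArithmeticFunction.vonMangoldt n := ArithmeticFunction.vonMangoldt_nonneg
  calc _ ≤ ((s.filter fun q => (n : ZMod q) = 1).card : ℝ) *
        ArithmeticFunction.vonMangoldt n := by gcongr
    _ ≤ 2 * Real.log z * ArithmeticFunction.vonMangoldt n := by gcongr; linarith

/-- The pairs `(r, q)` of a prime `r ≡ u` modulo `4 * p` in `[z / 2, z]` and a prime `q ∣ r - 1`
in the given block. -/
noncomputable def blockPairs (p : ℕ) (u : ℤ) (δ z : ℝ) : Finset (ℕ × ℕ) :=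
  (Finset.range (⌊z⌋₊ + 1) ×ˢ primeBlock δ z).filter fun x => x.1.Prime ∧ z / 2 ≤ x.1 ∧
    (x.1 : ZMod (4 * p)) = (u : ZMod (4 * p)) ∧ x.2 ∣ x.1 - 1

lemma sum_sum_prime_le {p : ℕ} {u : ℤ} {δ z : ℝ} (hz : 1 ≤ z) :
    ∑ q ∈ primeBlock δ z, ∑ n ∈ (Finset.Icc 1 ⌊z⌋₊).filter
        (fun n : ℕ => (n : ZMod q) = 1 ∧ n.Prime),
      ArithmeticFunction.vonMangoldt.residueClass (u : ZMod (4 * p)) n * logTri z n ≤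
      (blockPairs p u δ z).card * Real.log z := by
  have hz0 : 0 < z := by linarith
  rw [blockPairs, Finset.card_filter, Nat.cast_sum, Finset.sum_mul, Finset.sum_product_right]
  refine Finset.sum_le_sum fun q _ => ?_
  rw [Finset.sum_filter]
  have hlog := Real.log_nonneg hz
  calc _ ≤ ∑ n ∈ Finset.Icc 1 ⌊z⌋₊, (((if n.Prime ∧ z / 2 ≤ n ∧
        (n : ZMod (4 * p)) = (u : ZMod (4 * p)) ∧ q ∣ n - 1 then 1 else 0 : ℕ) : ℝ)) *
          Real.log z := by
        refine Finset.sum_le_sum fun n hn => ?_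
        obtain ⟨h1, h2⟩ := Finset.mem_Icc.mp hn
        have hn0 : (0 : ℝ) < n := by exact_mod_cast h1
        have hlogn : Real.log n ≤ Real.log z :=
          Real.log_le_log hn0 ((Nat.le_floor_iff hz0.le).mp h2)
        by_cases hw : logTri z n = 0
        · simp only [hw, mul_zero, ite_self]; positivity
        have hz2 := (mem_of_logTri_ne_zero hz0 hn0 hw).1.le
        by_cases hu : (n : ZMod (4 * p)) = (u : ZMod (4 * p))
        · by_cases hc : (n : ZMod q) = 1 ∧ n.Prime
          · rw [if_pos hc, if_pos ⟨hc.2, hz2, hu, (dvd_sub_one_iff_cast_eq_one h1).mpr hc.1⟩,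
              Nat.cast_one, one_mul]
            exact (mul_le_of_le_one_right
              (ArithmeticFunction.vonMangoldt.residueClass_nonneg _ n) (logTri_le_one _ _)).trans
              ((ArithmeticFunction.vonMangoldt.residueClass_le _ n).trans
                (ArithmeticFunction.vonMangoldt_le_log.trans hlogn))
          · rw [if_neg hc]; positivity
        · have : ArithmeticFunction.vonMangoldt.residueClass (u : ZMod (4 * p)) n = 0 :=
            Set.indicator_of_notMem (by simpa using hu) _
          simp only [this, zero_mul, ite_self]; positivity
    _ ≤ _ := by
        refine Finset.sum_le_sum_of_subset_of_nonneg (fun n hn => ?_) fun _ _ _ => by positivity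
        have := (Finset.mem_Icc.mp hn).2
        exact Finset.mem_range.mpr (by omega)

open Filter Topology Asymptotics in
theorem eventually_le_card_blockPairs {p : ℕ} (hp : p.Prime) {u : ℤ}
    (hu : Int.gcd u (4 * p) = 1) {δ ε : ℝ} (hδ : 0 < δ) (hδ' : δ ≤ 1 / 100) (hε : 0 < ε) :
    ∀ᶠ z : ℝ in atTop,
      (21 / 100 * (Nat.totient (4 * p) : ℝ)⁻¹ * (2 * δ / (1 - 2 * δ) - ε) - 3 * ε) *
        (z / Real.log z) ≤ (blockPairs p u δ z).card := by
  have : NeZero (4 * p) := ⟨by have := hp.pos; omega⟩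
  have hunit : IsUnit ((u : ℤ) : ZMod (4 * p)) := by
    rw [ZMod.coe_int_isUnit_iff_isCoprime, isCoprime_comm, Int.isCoprime_iff_gcd_eq_one]
    exact_mod_cast hu
  obtain ⟨C, hC⟩ := Chebyshev.psi_sub_theta_le_mul_sqrt
  have hC0 : 0 < |C| + 1 := by positivity
  filter_upwards [eventually_le_sum_sum_residueClass hunit hδ hδ' hε, eventually_gt_atTop 1,
    (isLittleO_log_rpow_atTop (show (0 : ℝ) < 1 / 2 by norm_num)).bound
      (show 0 < ε / (2 * (|C| + 1)) by positivity)] with z hz hz1 hlog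
  have hz0 : 0 < z := by linarith
  have hlog0 := Real.log_pos hz1
  rw [Real.norm_of_nonneg hlog0.le, Real.norm_of_nonneg (by positivity),
    ← Real.sqrt_eq_rpow] at hlog
  have hpr : ∀ q ∈ primeBlock δ z, q.Prime := fun q hq => ((mem_primeBlock hz0.le).mp hq).1
  have hnp := sum_sum_nonprime_le ((u : ℤ) : ZMod (4 * p)) hpr hz0.le
  have hpp := sum_sum_prime_le (p := p) (u := u) (δ := δ) hz1.le
  have herr : 2 * Real.log z * (Chebyshev.psi z - Chebyshev.theta z) ≤ ε * z := by
    calc _ ≤ 2 * (ε / (2 * (|C| + 1)) * √z) * ((|C| + 1) * √z) := by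
          have h1 : Chebyshev.psi z - Chebyshev.theta z ≤ (|C| + 1) * √z :=
            (hC z).trans (by gcongr; linarith [le_abs_self C])
          have h2 : 0 ≤ Chebyshev.psi z - Chebyshev.theta z := by
            linarith [Chebyshev.theta_le_psi z]
          gcongr
      _ = ε * (√z * √z) := by field_simp
      _ = ε * z := by rw [Real.mul_self_sqrt hz0.le]
  have hsplit : ∑ q ∈ primeBlock δ z, ∑ n ∈ (Finset.Icc 1 ⌊z⌋₊).filter
        (fun n : ℕ => (n : ZMod q) = 1),
      ArithmeticFunction.vonMangoldt.residueClass (u : ZMod (4 * p)) n * logTri z n =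
      ∑ q ∈ primeBlock δ z, ∑ n ∈ (Finset.Icc 1 ⌊z⌋₊).filter
        (fun n : ℕ => (n : ZMod q) = 1 ∧ n.Prime),
      ArithmeticFunction.vonMangoldt.residueClass (u : ZMod (4 * p)) n * logTri z n +
      ∑ q ∈ primeBlock δ z, ∑ n ∈ (Finset.Icc 1 ⌊z⌋₊).filter
        (fun n : ℕ => (n : ZMod q) = 1 ∧ ¬ n.Prime),
      ArithmeticFunction.vonMangoldt.residueClass (u : ZMod (4 * p)) n * logTri z n := by
    rw [← Finset.sum_add_distrib]
    refine Finset.sum_congr rfl fun q _ => ?_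
    simp only [← Finset.filter_filter]
    exact (Finset.sum_filter_add_sum_filter_not _ _ _).symm
  rw [← mul_div_assoc, div_le_iff₀ hlog0]
  linarith

end PrimesInBlock

section GoodPrimes

lemma primePi_eq_primeCounting (z : ℝ) : primePi z = Nat.primeCounting ⌊z⌋₊ := by
  rw [primePi, Nat.primeCounting, Nat.primeCounting', Nat.count_eq_card_filter_range]

open Filter Topology Asymptotics in
lemma eventually_primePi_le : ∀ᶠ z : ℝ in atTop, (primePi z : ℝ) ≤ 101 / 100 * (z / Real.log z) := by
  have hψ : Tendsto (fun x : ℝ => Chebyshev.psi x / x) atTop (𝓝 1) := by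
    have h := tendsto_psiRes_div (q := 1) (a := 1) isUnit_one
    simp only [Nat.totient_one, Nat.cast_one, inv_one] at h
    refine h.congr fun x => ?_
    rw [psiRes, Chebyshev.psi]
    congr 1
    refine Finset.sum_congr rfl fun n _ => ?_
    exact Set.indicator_of_mem (s := {n : ℕ | (n : ZMod 1) = 1}) (Subsingleton.elim _ _) _
  obtain ⟨C, hC⟩ := Chebyshev.primeCounting_sub_theta_div_log_isBigO.bound
  filter_upwards [hC, hψ.eventually_lt_const (show (1 : ℝ) < 1005 / 1000 by norm_num),
    eventually_gt_atTop 1, Real.tendsto_log_atTop.eventually_ge_atTop (200 * C)]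
    with z hz hψz hz1 hlog
  have hz0 : 0 < z := by linarith
  have hlog0 := Real.log_pos hz1
  rw [Real.norm_of_nonneg (show 0 ≤ z / Real.log z ^ 2 by positivity)] at hz
  have h1 := (le_abs_self _).trans hz
  rw [div_lt_iff₀ hz0] at hψz
  have h2 : Chebyshev.theta z / Real.log z ≤ 1005 / 1000 * (z / Real.log z) := by
    rw [← mul_div_assoc]
    gcongr
    exact (Chebyshev.theta_le_psi z).trans hψz.le
  have h3 : C * (z / Real.log z ^ 2) ≤ 5 / 1000 * (z / Real.log z) := by
    rw [pow_two, ← div_div, ← mul_div_assoc, div_le_iff₀ hlog0]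
    calc C * (z / Real.log z) ≤ (Real.log z / 200) * (z / Real.log z) := by gcongr; linarith
      _ = _ := by ring
  rw [primePi_eq_primeCounting]
  linarith

lemma largestPrimeFactor_eq {n q : ℕ} (hq : q.Prime) (hn : n ≠ 0) (hqn : q ∣ n)
    (h : ∀ r : ℕ, r.Prime → r ∣ n → r ≤ q) : largestPrimeFactor n = q := by
  have hn1 : ¬ n ≤ 1 := by
    have := Nat.le_of_dvd (by omega) hqn
    have := hq.two_le
    omega
  rw [largestPrimeFactor, if_neg hn1]
  refine le_antisymm (Finset.sup_le fun r hr => ?_) ?_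
  · exact h r (Nat.prime_of_mem_primeFactors hr) (Nat.dvd_of_mem_primeFactors hr)
  · exact Finset.le_sup (f := id) (Nat.mem_primeFactors.mpr ⟨hq, hqn, hn⟩)

lemma card_blockPairs_le (p : ℕ) (u : ℤ) {δ z : ℝ} (hz : 0 ≤ z) :
    (blockPairs p u δ z).card ≤ ((Finset.range (⌊z⌋₊ + 1)).filter (fun r : ℕ => r.Prime ∧
      z / 2 ≤ (r : ℝ) ∧ (r : ℝ) ≤ z ∧ ((r : ℤ) : ZMod (4 * p)) = (u : ZMod (4 * p)) ∧
      z ^ ((1 : ℝ) / 2 - 2 * δ) ≤ (largestPrimeFactor (r - 1) : ℝ) ∧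
      (largestPrimeFactor (r - 1) : ℝ) ≤ z ^ ((1 : ℝ) / 2 - δ))).card +
      (badPairs p u δ z).card := by
  have hlpf : ∀ x ∈ blockPairs p u δ z \ badPairs p u δ z,
      largestPrimeFactor (x.1 - 1) = x.2 := by
    rintro ⟨r, q⟩ hx
    simp only [blockPairs, badPairs, Finset.mem_sdiff, Finset.mem_filter, Finset.mem_product,
      not_and, not_exists] at hx
    obtain ⟨⟨hrq, hr, -, hu, hqr⟩, hx⟩ := hx
    obtain ⟨hq, hq1, -⟩ := (mem_primeBlock hz).mp hrq.2
    refine largestPrimeFactor_eq hq (by have := hr.two_le; omega) hqr fun n hn hnr => ?_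
    by_contra! hlt
    exact hx hrq hr hu hqr n hn hlt.ne' (hq1.trans (by exact_mod_cast hlt.le)) hnr
  rw [← Nat.sub_le_iff_le_add]
  refine (Finset.le_card_sdiff _ _).trans
    (Finset.card_le_card_of_injOn Prod.fst (fun x hx => ?_) fun x hx y hy hxy => ?_)
  · have h := hlpf x hx
    obtain ⟨h1, h2⟩ := Finset.mem_filter.mp (Finset.mem_sdiff.mp hx).1
    obtain ⟨h3, h4⟩ := Finset.mem_product.mp h1
    obtain ⟨-, h5, h6⟩ := (mem_primeBlock hz).mp h4
    have h7 : (x.1 : ℝ) ≤ z :=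
      (Nat.le_floor_iff hz).mp (by have := Finset.mem_range.mp h3; omega)
    exact Finset.mem_filter.mpr ⟨h3, h2.1, h2.2.1, h7, by simpa using h2.2.2.1, by rwa [h],
      by rwa [h]⟩
  · refine Prod.ext hxy ?_
    rw [← hlpf x hx, ← hlpf y hy, hxy]

end GoodPrimes

/-- There is an absolute constant `0 < δ < 1/12` such that for
every prime `p` and every integer `u` coprime to `4p`, there is `z₀(p)` such that
for all `z ≥ z₀(p)`, the number of primes `r` with `z/2 ≤ r ≤ z`,
`r ≡ u (mod 4p)` and `P(r−1) ∈ [z^{1/2−2δ}, z^{1/2−δ}]` is at least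
`(log((1−2δ)/(1−4δ)) / (5 φ(4p))) · π(z)`. -/
theorem rank_stats_stmt15 :
    ∃ δ : ℝ, 0 < δ ∧ δ < 1 / 12 ∧ ∀ p : ℕ, p.Prime → ∀ u : ℤ,
      Int.gcd u (4 * p) = 1 → ∃ z0 : ℝ, ∀ z : ℝ, z0 ≤ z →
        (Real.log ((1 - 2 * δ) / (1 - 4 * δ)) / (5 * Nat.totient (4 * p))) * primePi z
          ≤ (((Finset.range (⌊z⌋₊ + 1)).filter (fun r : ℕ => r.Prime ∧
                z / 2 ≤ (r : ℝ) ∧ (r : ℝ) ≤ z ∧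
                ((r : ℤ) : ZMod (4 * p)) = (u : ZMod (4 * p)) ∧
                z ^ ((1 : ℝ) / 2 - 2 * δ) ≤ (largestPrimeFactor (r - 1) : ℝ) ∧
                (largestPrimeFactor (r - 1) : ℝ) ≤ z ^ ((1 : ℝ) / 2 - δ))).card : ℝ) := by
  obtain ⟨C, hC, hbad⟩ := exists_card_badPairs_le
  obtain ⟨δ, hδ, hδ1, hCδ⟩ : ∃ δ : ℝ, 0 < δ ∧ δ ≤ 1 / 1000 ∧ C * δ ≤ 1 / 1000 := by
    refine ⟨1 / (1000 * (C + 1)), by positivity, ?_, ?_⟩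
    · gcongr; linarith
    · rw [← mul_div_assoc, mul_one, div_le_div_iff₀ (by positivity) (by norm_num)]; linarith
  refine ⟨δ, hδ, by linarith, fun p hp u hu => ?_⟩
  have hφ1 : (1 : ℝ) ≤ Nat.totient (4 * p) := by
    exact_mod_cast Nat.totient_pos.mpr (by have := hp.pos; omega)
  have hφ0 : (0 : ℝ) < Nat.totient (4 * p) := by linarith
  set φ : ℝ := (Nat.totient (4 * p) : ℝ) with hφ
  have hL : Real.log ((1 - 2 * δ) / (1 - 4 * δ)) ≤ 2010 / 1000 * δ := by
    have h4 : 0 < 1 - 4 * δ := by linarith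
    refine (Real.log_le_sub_one_of_pos (div_pos (by linarith) h4)).trans ?_
    rw [sub_le_iff_le_add, div_le_iff₀ h4]
    nlinarith
  have hL0 : 2 * δ ≤ 2 * δ / (1 - 2 * δ) := by
    rw [le_div_iff₀ (by linarith)]; nlinarith
  rw [← Filter.eventually_atTop]
  filter_upwards [hbad δ hδ (by linarith) p hp u, eventually_primePi_le,
    eventually_le_card_blockPairs hp hu hδ (by linarith)
      (show 0 < δ ^ 2 / φ by positivity), Filter.eventually_gt_atTop 1] with z h1 h2 h3 hz1
  have hz0 : 0 < z := by linarith
  have hlog0 := Real.log_pos hz1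
  have h4 : ((blockPairs p u δ z).card : ℝ) ≤ _ := Nat.cast_le.mpr
    (card_blockPairs_le p u (δ := δ) hz0.le)
  rw [Nat.cast_add] at h4
  refine le_trans ?_ (sub_le_iff_le_add.mpr h4)
  have hX : 0 < z / Real.log z := by positivity
  have h5 : C * δ ^ 2 * (z / (φ * Real.log z)) ≤ 1 / 1000 * δ * (φ⁻¹ * (z / Real.log z)) := by
    calc _ = C * δ * (δ * (φ⁻¹ * (z / Real.log z))) := by field_simp
      _ ≤ 1 / 1000 * (δ * (φ⁻¹ * (z / Real.log z))) := by gcongr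
      _ = _ := by ring
  have h6 : 416 / 1000 * δ * (φ⁻¹ * (z / Real.log z)) ≤
      (21 / 100 * φ⁻¹ * (2 * δ / (1 - 2 * δ) - δ ^ 2 / φ) - 3 * (δ ^ 2 / φ)) *
        (z / Real.log z) := by
    rw [← mul_assoc]
    refine mul_le_mul_of_nonneg_right ?_ hX.le
    have h7 : δ ^ 2 / φ ≤ δ ^ 2 := div_le_self (by positivity) hφ1
    calc 416 / 1000 * δ * φ⁻¹ ≤ φ⁻¹ * (21 / 100 * (2 * δ - δ ^ 2) - 3 * δ ^ 2) := by
          rw [mul_comm]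
          gcongr
          nlinarith
      _ ≤ φ⁻¹ * (21 / 100 * (2 * δ / (1 - 2 * δ) - δ ^ 2 / φ) - 3 * δ ^ 2) := by gcongr
      _ = _ := by ring
  have h8 : Real.log ((1 - 2 * δ) / (1 - 4 * δ)) / (5 * φ) * primePi z ≤
      2010 / 1000 * δ / (5 * φ) * (101 / 100 * (z / Real.log z)) := by gcongr
  have h9 : 2010 / 1000 * δ / (5 * φ) * (101 / 100 * (z / Real.log z)) =
      203010 / 500000 * δ * (φ⁻¹ * (z / Real.log z)) := by ring
  have h10 : 0 < δ * (φ⁻¹ * (z / Real.log z)) := by positivity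
  linarith
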